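/- arXiv:2310.20047 — 4 statements merged into one kernel-verified Lean document; each statement's English description precedes it below -/
import Mathlib

section
/- Let G be a Borel graph on a Polish space V(G) such that all degrees of G are even, there is a uniform bound d on the degrees, and there exists δ > 0 such that |E(F, V(G) \ F)| ≥ δ|F| for every finite F ⊆ V(G) (non-amenability). Then there exists a Borel G-invariant comeager set S ⊆ V(G) and a Borel orientation of the edges of the induced subgraph of G on S (a Borel subset O of the ordered edge relation containing exactly one of (x,y), (y,x) for each edge {x,y} with x, y ∈ S) such that every vertex of S has in-degree equal to out-degree. -/
open Set

/-- The set of edges of `G` with one endpoint in `A` and the other in `B`. -/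
def edgesBetween {V : Type*} (G : SimpleGraph V) (A B : Set V) : Set (Sym2 V) :=
  {e | e ∈ G.edgeSet ∧ ∃ a ∈ A, ∃ b ∈ B, e = s(a, b)}

/-- `S` is a union of connected components of `G`. -/
def Invariant {V : Type*} (G : SimpleGraph V) (S : Set V) : Prop :=
  ∀ ⦃x⦄, x ∈ S → ∀ ⦃y⦄, G.Reachable x y → y ∈ S

/-! ### Edge boundaries -/

/-- The ordered edges of `G` leaving `P`. -/
def edgeBdry {V : Type*} (G : SimpleGraph V) (P : Set V) : Set (V × V) :=
  {p | G.Adj p.1 p.2 ∧ p.1 ∈ P ∧ p.2 ∉ P}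

section Boundary

variable {V : Type*} {G : SimpleGraph V}

lemma edgeBdry_compl (P : Set V) : edgeBdry G Pᶜ = Prod.swap '' edgeBdry G P := by
  ext ⟨a, b⟩
  simp only [edgeBdry, mem_ofPred_eq, mem_compl_iff, not_not, mem_image, Prod.exists,
    Prod.swap_prod_mk, Prod.mk.injEq]
  constructor
  · rintro ⟨h, ha, hb⟩
    exact ⟨b, a, ⟨h.symm, hb, ha⟩, rfl, rfl⟩
  · rintro ⟨c, e, ⟨h, hc, he⟩, rfl, rfl⟩
    exact ⟨h.symm, he, hc⟩

lemma ncard_edgeBdry_compl (P : Set V) : (edgeBdry G Pᶜ).ncard = (edgeBdry G P).ncard := by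
  rw [edgeBdry_compl]
  exact ncard_image_of_injective _ Prod.swap_injective

lemma finite_edgesFrom (hLF : ∀ v : V, (G.neighborSet v).Finite) {F : Set V} (hF : F.Finite) :
    {p : V × V | G.Adj p.1 p.2 ∧ p.1 ∈ F}.Finite := by
  refine (hF.biUnion fun a _ => (hLF a).image (Prod.mk a)).subset ?_
  rintro ⟨a, b⟩ ⟨h, ha⟩
  exact mem_biUnion ha ⟨b, h, rfl⟩

lemma finite_edgeBdry (hLF : ∀ v : V, (G.neighborSet v).Finite) {P : Set V}
    (hP : P.Finite ∨ Pᶜ.Finite) : (edgeBdry G P).Finite := by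
  have key : ∀ F : Set V, F.Finite → (edgeBdry G F).Finite := fun F hF =>
    (finite_edgesFrom hLF hF).subset fun p hp => ⟨hp.1, hp.2.1⟩
  rcases hP with h | h
  · exact key P h
  · rw [← compl_compl P, edgeBdry_compl]
    exact (key _ h).image _

lemma ncard_edgesFrom (hLF : ∀ v : V, (G.neighborSet v).Finite) (F : Finset V) :
    {p : V × V | G.Adj p.1 p.2 ∧ p.1 ∈ F}.ncard = ∑ a ∈ F, (G.neighborSet a).ncard := by
  classical
  have : {p : V × V | G.Adj p.1 p.2 ∧ p.1 ∈ F} =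
      ((F.sigma fun a => (hLF a).toFinset).map
        ⟨fun q : (_ : V) × V => (q.1, q.2), by
          rintro ⟨a, b⟩ ⟨c, e⟩ h
          simp only [Prod.mk.injEq] at h
          rw [h.1, h.2]⟩ : Finset (V × V)) := by
    ext ⟨a, b⟩
    simp only [mem_ofPred_eq, Finset.coe_map, mem_image, Finset.mem_coe, Finset.mem_sigma,
      Finite.mem_toFinset, SimpleGraph.mem_neighborSet, Sigma.exists]
    constructor
    · rintro ⟨h, ha⟩
      exact ⟨a, b, ⟨ha, h⟩, rfl⟩
    · rintro ⟨c, e, ⟨hc, h⟩, hce⟩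
      obtain ⟨rfl, rfl⟩ := Prod.mk.inj hce
      exact ⟨h, hc⟩
  rw [this, ncard_coe_finset, Finset.card_map, Finset.card_sigma]
  exact Finset.sum_congr rfl fun a _ => (ncard_eq_toFinset_card _ (hLF a)).symm

lemma even_ncard_edgesWithin (hLF : ∀ v : V, (G.neighborSet v).Finite) {F : Set V}
    (hF : F.Finite) : Even {p : V × V | G.Adj p.1 p.2 ∧ p.1 ∈ F ∧ p.2 ∈ F}.ncard := by
  classical
  have hfin : {p : V × V | G.Adj p.1 p.2 ∧ p.1 ∈ F ∧ p.2 ∈ F}.Finite :=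
    (finite_edgesFrom hLF hF).subset fun p hp => ⟨hp.1, hp.2.1⟩
  rw [ncard_eq_toFinset_card _ hfin]
  have h0 : ∑ _p ∈ hfin.toFinset, (1 : ZMod 2) = 0 := by
    refine Finset.sum_involution (fun p _ => p.swap) (fun _ _ => by decide) ?_ ?_ ?_
    · rintro ⟨a, b⟩ hp _ h
      simp only [Finite.mem_toFinset, mem_ofPred_eq] at hp
      simp only [Prod.swap_prod_mk, Prod.mk.injEq] at h
      exact hp.1.ne h.2
    · rintro ⟨a, b⟩ hp
      simp only [Finite.mem_toFinset, mem_ofPred_eq, Prod.swap_prod_mk] at hp ⊢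
      exact ⟨hp.1.symm, hp.2.2, hp.2.1⟩
    · rintro ⟨a, b⟩ hp
      rfl
  rw [Finset.sum_const, nsmul_eq_mul, mul_one] at h0
  exact (ZMod.natCast_eq_zero_iff_even).1 h0

lemma even_ncard_edgeBdry (hLF : ∀ v : V, (G.neighborSet v).Finite)
    (heven : ∀ v : V, Even (G.neighborSet v).ncard) {P : Set V} (hP : P.Finite ∨ Pᶜ.Finite) :
    Even (edgeBdry G P).ncard := by
  have key : ∀ F : Set V, F.Finite → Even (edgeBdry G F).ncard := by
    intro F hF
    have h1 := ncard_edgesFrom hLF hF.toFinset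
    have h2 : Even {p : V × V | G.Adj p.1 p.2 ∧ p.1 ∈ hF.toFinset}.ncard := by
      rw [h1]
      exact Finset.even_sum _ fun a _ => heven a
    have h3 : {p : V × V | G.Adj p.1 p.2 ∧ p.1 ∈ hF.toFinset} =
        edgeBdry G F ∪ {p : V × V | G.Adj p.1 p.2 ∧ p.1 ∈ F ∧ p.2 ∈ F} := by
      ext p
      simp only [Finite.mem_toFinset, mem_ofPred_eq, edgeBdry, mem_union]
      tauto
    rw [h3, ncard_union_eq ?_ (finite_edgeBdry hLF (Or.inl hF))
      ((finite_edgesFrom hLF hF).subset fun p hp => ⟨hp.1, hp.2.1⟩)] at h2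
    · exact (Nat.even_add.1 h2).2 (even_ncard_edgesWithin hLF hF)
    · exact disjoint_left.2 fun p hp hq => hp.2.2 hq.2.2
  rcases hP with h | h
  · exact key P h
  · rw [← compl_compl P, ncard_edgeBdry_compl]
    exact key _ h

/-! ### Partial orientations satisfying the cut condition -/

/-- No finite or cofinite set is left by more than half of its boundary edges. -/
def CutCondition (G : SimpleGraph V) (O : Set (V × V)) : Prop :=
  ∀ P : Set V, P.Finite ∨ Pᶜ.Finite → 2 * (edgeBdry G P ∩ O).ncard ≤ (edgeBdry G P).ncard

open Classical in
/-- The weight of an ordered pair in the cut function of the partial orientation `O`. -/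
noncomputable def cutWeight (O : Set (V × V)) (p : V × V) : ℤ := 1 - 2 * (if p ∈ O then 1 else 0)

open Classical in
lemma cut_eq_sum {U : Finset (V × V)} {P : Set V} {O : Set (V × V)}
    (hU : edgeBdry G P ⊆ U) :
    ((edgeBdry G P).ncard : ℤ) - 2 * (edgeBdry G P ∩ O).ncard =
      ∑ p ∈ U, if p ∈ edgeBdry G P then cutWeight O p else 0 := by
  have e1 : edgeBdry G P = (U.filter (· ∈ edgeBdry G P) : Finset (V × V)) := by
    ext p
    simp only [Finset.coe_filter, mem_ofPred_eq]
    exact ⟨fun h => ⟨hU h, h⟩, fun h => h.2⟩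
  have e2 : edgeBdry G P ∩ O = ((U.filter (· ∈ edgeBdry G P)).filter (· ∈ O) :
      Finset (V × V)) := by
    rw [Finset.coe_filter]
    ext p
    simp only [mem_ofPred_eq, Finset.mem_filter, mem_inter_iff]
    exact ⟨fun h => ⟨⟨hU h.1, h.1⟩, h.2⟩, fun h => ⟨h.1.2, h.2⟩⟩
  have c1 := congrArg ncard e1
  have c2 := congrArg ncard e2
  rw [ncard_coe_finset] at c1 c2
  rw [c1, c2, ← Finset.sum_filter]
  simp only [cutWeight, Finset.sum_sub_distrib, ← Finset.mul_sum, Finset.sum_boole]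
  simp

open Classical in
lemma cutWeight_add_swap_nonneg {O : Set (V × V)} (hO : ∀ a b, (a, b) ∈ O → (b, a) ∉ O)
    (a b : V) : 0 ≤ cutWeight O (a, b) + cutWeight O (b, a) := by
  have := hO a b
  simp only [cutWeight]
  split_ifs with h1 h2 <;> simp_all

lemma cut_submodular (hLF : ∀ v : V, (G.neighborSet v).Finite) {O : Set (V × V)}
    (hO : ∀ a b, (a, b) ∈ O → (b, a) ∉ O) {P Q : Set V} (hP : P.Finite ∨ Pᶜ.Finite)
    (hQ : Q.Finite ∨ Qᶜ.Finite) {x y : V} (hxy : G.Adj x y) (h1 : (x, y) ∉ O)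
    (h2 : (y, x) ∉ O) (hxP : x ∈ P) (hyP : y ∉ P) (hyQ : y ∈ Q) (hxQ : x ∉ Q) :
    (((edgeBdry G (P ∩ Q)).ncard : ℤ) - 2 * (edgeBdry G (P ∩ Q) ∩ O).ncard) +
      (((edgeBdry G (P ∪ Q)).ncard : ℤ) - 2 * (edgeBdry G (P ∪ Q) ∩ O).ncard) + 2 ≤
    (((edgeBdry G P).ncard : ℤ) - 2 * (edgeBdry G P ∩ O).ncard) +
      (((edgeBdry G Q).ncard : ℤ) - 2 * (edgeBdry G Q ∩ O).ncard) := by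
  classical
  set W : Set (V × V) := edgeBdry G P ∪ edgeBdry G Q with hW
  have hWf : W.Finite := (finite_edgeBdry hLF hP).union (finite_edgeBdry hLF hQ)
  set U : Finset (V × V) := hWf.toFinset ∪ hWf.toFinset.image Prod.swap with hUdef
  have hUW : W ⊆ U := fun p hp => by simp [hUdef, hp]
  have hsymm : ∀ p, p ∈ U → p.swap ∈ U := by
    rintro ⟨a, b⟩ hp
    simp only [hUdef, Finset.mem_union, Finset.mem_image, Finite.mem_toFinset, Prod.exists,
      Prod.swap_prod_mk, Prod.mk.injEq] at hp ⊢
    rcases hp with hp | ⟨c, e, hp, rfl, rfl⟩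
    · exact Or.inr ⟨a, b, hp, rfl, rfl⟩
    · exact Or.inl hp
  have hadj : ∀ p, p ∈ U → G.Adj p.1 p.2 := by
    rintro ⟨a, b⟩ hp
    simp only [hUdef, Finset.mem_union, Finset.mem_image, Finite.mem_toFinset, Prod.exists,
      Prod.swap_prod_mk, Prod.mk.injEq] at hp
    rcases hp with hp | ⟨c, e, hp, rfl, rfl⟩
    · exact hp.elim (fun h => h.1) (fun h => h.1)
    · exact hp.elim (fun h => h.1.symm) (fun h => h.1.symm)
  have hPU : edgeBdry G P ⊆ U := subset_union_left.trans hUW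
  have hQU : edgeBdry G Q ⊆ U := subset_union_right.trans hUW
  have hIU : edgeBdry G (P ∩ Q) ⊆ U := by
    refine Subset.trans ?_ hUW
    intro p hp
    simp only [hW, edgeBdry, mem_union, mem_ofPred_eq, mem_inter_iff] at hp ⊢
    tauto
  have hUU : edgeBdry G (P ∪ Q) ⊆ U := by
    refine Subset.trans ?_ hUW
    intro p hp
    simp only [hW, edgeBdry, mem_union, mem_ofPred_eq] at hp ⊢
    tauto
  rw [cut_eq_sum hPU, cut_eq_sum hQU, cut_eq_sum hIU, cut_eq_sum hUU]
  set s : V × V → ℤ := fun p =>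
    if (p.1 ∈ P ∧ p.1 ∉ Q ∧ p.2 ∈ Q ∧ p.2 ∉ P) ∨ (p.1 ∈ Q ∧ p.1 ∉ P ∧ p.2 ∈ P ∧ p.2 ∉ Q)
      then 1 else 0 with hs
  have hpt : ∀ p ∈ U, (if p ∈ edgeBdry G P then cutWeight O p else 0) +
      (if p ∈ edgeBdry G Q then cutWeight O p else 0) =
      (if p ∈ edgeBdry G (P ∩ Q) then cutWeight O p else 0) +
      (if p ∈ edgeBdry G (P ∪ Q) then cutWeight O p else 0) + s p * cutWeight O p := by
    intro p hp
    have := hadj p hp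
    simp only [hs, edgeBdry, mem_ofPred_eq, this, true_and, mem_inter_iff, mem_union]
    by_cases a1 : p.1 ∈ P <;> by_cases a2 : p.1 ∈ Q <;> by_cases a3 : p.2 ∈ P <;>
      by_cases a4 : p.2 ∈ Q <;> simp [a1, a2, a3, a4]
  have hsum := Finset.sum_congr rfl hpt
  simp only [Finset.sum_add_distrib] at hsum
  have hswap : ∑ p ∈ U, s p * cutWeight O p = ∑ p ∈ U, s p * cutWeight O p.swap := by
    refine Finset.sum_nbij' Prod.swap Prod.swap hsymm hsymm (fun _ _ => rfl) (fun _ _ => rfl) ?_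
    intro p _
    have : s p = s p.swap := by
      simp only [hs, Prod.fst_swap, Prod.snd_swap]
      congr 1
      apply propext
      tauto
    rw [this, Prod.swap_swap]
  have hnn : ∀ p ∈ U, 0 ≤ s p * (cutWeight O p + cutWeight O p.swap) := by
    rintro ⟨a, b⟩ _
    apply mul_nonneg
    · simp only [hs]; split_ifs <;> norm_num
    · exact cutWeight_add_swap_nonneg hO a b
  have hxyU : (x, y) ∈ U := hPU ⟨hxy, hxP, hyP⟩
  have hyxU : (y, x) ∈ U := hQU ⟨hxy.symm, hyQ, hxQ⟩
  have hge : (4 : ℤ) ≤ ∑ p ∈ U, s p * (cutWeight O p + cutWeight O p.swap) := by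
    have hsub : ({(x, y), (y, x)} : Finset (V × V)) ⊆ U := by
      intro p hp
      simp only [Finset.mem_insert, Finset.mem_singleton] at hp
      rcases hp with rfl | rfl <;> assumption
    refine le_trans ?_ (Finset.sum_le_sum_of_subset_of_nonneg hsub fun p hp _ => hnn p hp)
    rw [Finset.sum_pair (by simp [hxy.ne])]
    simp [hs, cutWeight, h1, h2, hxP, hyP, hyQ, hxQ]
  simp only [mul_add, Finset.sum_add_distrib] at hge
  linarith

/-- An unoriented edge can be oriented without violating the cut condition. -/
lemma CutCondition.extend (hLF : ∀ v : V, (G.neighborSet v).Finite)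
    (heven : ∀ v : V, Even (G.neighborSet v).ncard) {O : Set (V × V)}
    (hO : ∀ a b, (a, b) ∈ O → (b, a) ∉ O) (hC : CutCondition G O) {x y : V}
    (hxy : G.Adj x y) (h1 : (x, y) ∉ O) (h2 : (y, x) ∉ O)
    (hn : ¬ CutCondition G (insert (x, y) O)) : CutCondition G (insert (y, x) O) := by
  have key : ∀ q : V × V, ¬ CutCondition G (insert q O) → ∃ P : Set V,
      (P.Finite ∨ Pᶜ.Finite) ∧ q.1 ∈ P ∧ q.2 ∉ P ∧
      (edgeBdry G P).ncard = 2 * (edgeBdry G P ∩ O).ncard := by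
    intro q hq
    simp only [CutCondition, not_forall, not_le] at hq
    obtain ⟨P, hP, hlt⟩ := hq
    have hle := hC P hP
    have hev := even_ncard_edgeBdry hLF heven hP
    have hqP : q ∈ edgeBdry G P := by
      by_contra hqP
      rw [inter_insert_of_notMem hqP] at hlt
      omega
    have hb : (edgeBdry G P ∩ insert q O).ncard ≤ (edgeBdry G P ∩ O).ncard + 1 := by
      rw [inter_insert_of_mem hqP]
      exact ncard_insert_le _ _
    obtain ⟨r, hr⟩ := hev
    exact ⟨P, hP, hqP.2.1, hqP.2.2, by omega⟩
  by_contra hn'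
  obtain ⟨P, hP, hxP, hyP, eP⟩ := key _ hn
  obtain ⟨Q, hQ, hyQ, hxQ, eQ⟩ := key _ hn'
  have hsub := cut_submodular hLF hO hP hQ hxy h1 h2 hxP hyP hyQ hxQ
  have hI := hC (P ∩ Q) (by
    rcases hP with hP | hP
    · exact Or.inl (hP.inter_of_left _)
    · rcases hQ with hQ | hQ
      · exact Or.inl (hQ.inter_of_right _)
      · right; rw [compl_inter]; exact hP.union hQ)
  have hU := hC (P ∪ Q) (by
    rcases hP with hP | hP
    · rcases hQ with hQ | hQ
      · exact Or.inl (hP.union hQ)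
      · right; rw [compl_union]; exact hQ.inter_of_right _
    · right; rw [compl_union]; exact hP.inter_of_left _)
  rw [eP, eQ] at hsub
  push_cast at hsub
  omega

end Boundary

/-! ### Indecomposable sets and separated families of edges -/

section Separation

variable {V : Type*} {G : SimpleGraph V}

/-- `F` is not a disjoint union of two nonempty sets without edges between them. -/
def Indecomposable (G : SimpleGraph V) (F : Set V) : Prop :=
  ∀ A ⊆ F, A.Nonempty → A ≠ F → ∃ a ∈ A, ∃ b ∈ F \ A, G.Adj a b

/-- There is a walk of length at most `n` from `x` to `y`. -/
def Near (G : SimpleGraph V) (n : ℕ) (x y : V) : Prop := ∃ p : G.Walk x y, p.length ≤ n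

lemma Near.refl (n : ℕ) (x : V) : Near G n x x := ⟨.nil, by simp⟩

lemma Near.symm {n : ℕ} {x y : V} (h : Near G n x y) : Near G n y x := by
  obtain ⟨p, hp⟩ := h
  exact ⟨p.reverse, by simpa using hp⟩

lemma Near.trans {m n : ℕ} {x y z : V} (h : Near G m x y) (h' : Near G n y z) :
    Near G (m + n) x z := by
  obtain ⟨p, hp⟩ := h
  obtain ⟨q, hq⟩ := h'
  exact ⟨p.append q, by rw [SimpleGraph.Walk.length_append]; omega⟩

lemma Near.mono {m n : ℕ} (hmn : m ≤ n) {x y : V} (h : Near G m x y) : Near G n x y := by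
  obtain ⟨p, hp⟩ := h
  exact ⟨p, hp.trans hmn⟩

lemma SimpleGraph.Adj.near {x y : V} (h : G.Adj x y) : Near G 1 x y :=
  ⟨h.toWalk, by simp⟩

lemma le_ncard_ball {F : Set V} (hF : F.Finite) (hI : Indecomposable G F) {x : V} (hx : x ∈ F)
    (k : ℕ) : k + 1 ≤ {y | y ∈ F ∧ Near G k x y}.ncard ∨ ∀ y ∈ F, Near G k x y := by
  induction k with
  | zero =>
    left
    rw [zero_add, Nat.succ_le_iff, ncard_pos (hF.subset fun y hy => hy.1)]
    exact ⟨x, hx, Near.refl _ _⟩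
  | succ k ih =>
    rcases ih with ih | ih
    · by_cases hall : ∀ y ∈ F, Near G k x y
      · exact Or.inr fun y hy => (hall y hy).mono (Nat.le_succ k)
      · left
        push Not at hall
        obtain ⟨z, hz, hnz⟩ := hall
        obtain ⟨a, ha, b, hb, hab⟩ := hI {y | y ∈ F ∧ Near G k x y} (fun y hy => hy.1)
          ⟨x, hx, Near.refl _ _⟩ (fun h => hnz (by rw [← h] at hz; exact hz.2))
        refine Nat.succ_le_of_lt (lt_of_le_of_lt ih (ncard_lt_ncard ?_
          (hF.subset fun y hy => hy.1)))
        refine ssubset_iff_exists.2 ⟨fun y hy => ⟨hy.1, hy.2.mono (Nat.le_succ k)⟩, b,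
          ⟨hb.1, ha.2.trans hab.near⟩, hb.2⟩
    · exact Or.inr fun y hy => (ih y hy).mono (Nat.le_succ k)

lemma ncard_separated_le {F X : Set V} (hF : F.Finite) (hI : Indecomposable G F) (hX : X ⊆ F)
    {k : ℕ} (hsep : ∀ x ∈ X, ∀ y ∈ X, Near G (2 * k) x y → x = y) :
    X.ncard ≤ 1 ∨ k * X.ncard ≤ F.ncard := by
  classical
  by_cases h1 : X.ncard ≤ 1
  · exact Or.inl h1
  right
  have hXf : X.Finite := hF.subset hX
  obtain ⟨x₁, hx₁, x₂, hx₂, hne⟩ := (one_lt_ncard hXf).1 (not_le.1 h1)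
  have hbig : ∀ x ∈ X, k + 1 ≤ {y | y ∈ F ∧ Near G k x y}.ncard := by
    intro x hx
    refine (le_ncard_ball hF hI (hX hx) k).resolve_right fun hall => hne ?_
    refine hsep _ hx₁ _ hx₂ ?_
    rw [two_mul]
    exact (hall _ (hX hx₁)).symm.trans (hall _ (hX hx₂))
  set D : V → Finset V := fun x => hF.toFinset.filter (Near G k x) with hD
  have hDc : ∀ x, {y | y ∈ F ∧ Near G k x y}.ncard = (D x).card := by
    intro x
    rw [← ncard_coe_finset]
    congr 1
    ext y
    simp [hD]
  have hdis : (hXf.toFinset : Set V).PairwiseDisjoint D := by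
    intro x hx y hy hxy
    refine Finset.disjoint_left.2 fun z hz hz' => hxy ?_
    simp only [hD, Finset.mem_filter] at hz hz'
    refine hsep _ (by simpa using hx) _ (by simpa using hy) ?_
    rw [two_mul]
    exact hz.2.trans hz'.2.symm
  calc k * X.ncard = ∑ _x ∈ hXf.toFinset, k := by
        rw [Finset.sum_const, smul_eq_mul, mul_comm, ncard_eq_toFinset_card _ hXf]
    _ ≤ ∑ x ∈ hXf.toFinset, (D x).card := by
        refine Finset.sum_le_sum fun x hx => ?_
        rw [← hDc]
        exact (Nat.le_succ k).trans (hbig x (by simpa using hx))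
    _ = (hXf.toFinset.biUnion D).card := (Finset.card_biUnion hdis).symm
    _ ≤ hF.toFinset.card := Finset.card_le_card (Finset.biUnion_subset.2 fun x _ =>
        Finset.filter_subset _ _)
    _ = F.ncard := (ncard_eq_toFinset_card _ hF).symm

/-- Distinct elements of `B` have no endpoints at distance at most `n`. -/
def Separated (G : SimpleGraph V) (n : ℕ) (B : Set (V × V)) : Prop :=
  ∀ p ∈ B, ∀ q ∈ B, ∀ u, (u = p.1 ∨ u = p.2) → ∀ v, (v = q.1 ∨ v = q.2) → Near G n u v → p = q

lemma Separated.swap {n : ℕ} {B : Set (V × V)} (h : Separated G n B) :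
    Separated G n (Prod.swap ⁻¹' B) := fun _ hp _ hq u hu v hv huv =>
  Prod.swap_injective (h _ hp _ hq u hu.symm v hv.symm huv)

lemma Separated.ncard_inter_edgeBdry_le {F : Set V} (hF : F.Finite) (hI : Indecomposable G F)
    {k : ℕ} {B : Set (V × V)} (hB : Separated G (2 * k) B) :
    (edgeBdry G F ∩ B).ncard ≤ 1 ∨ k * (edgeBdry G F ∩ B).ncard ≤ F.ncard := by
  have hinj : InjOn Prod.fst (edgeBdry G F ∩ B) := fun _ hp _ hq hpq =>
    hB _ hp.2 _ hq.2 _ (Or.inl rfl) _ (Or.inl rfl) (by rw [hpq]; exact Near.refl _ _)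
  rw [← hinj.ncard_image]
  refine ncard_separated_le hF hI ?_ ?_
  · rintro _ ⟨p, hp, rfl⟩
    exact hp.1.2.1
  · rintro _ ⟨p, hp, rfl⟩ _ ⟨q, hq, rfl⟩ hn
    rw [hB p hp.2 q hq.2 p.1 (Or.inl rfl) q.1 (Or.inl rfl) hn]

lemma cut_union_separated (hLF : ∀ v : V, (G.neighborSet v).Finite) {δ : ℝ} (hδ : 0 < δ)
    {F : Set V} (hF : F.Finite) (hI : Indecomposable G F)
    (hexp : δ * F.ncard ≤ ((edgeBdry G F).ncard : ℝ)) {O B : Set (V × V)}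
    (hC : 2 * (edgeBdry G F ∩ O).ncard ≤ (edgeBdry G F).ncard)
    (hCB : ∀ p ∈ B, 2 * (edgeBdry G F ∩ insert p O).ncard ≤ (edgeBdry G F).ncard)
    {ε : ℝ} {r k : ℕ} (hrk : r ≤ k) (hk : 4 ≤ ε * δ * k)
    (hL : r ≤ F.ncard → 2 * ((edgeBdry G F ∩ O).ncard : ℝ) + ε * (edgeBdry G F).ncard ≤
      (edgeBdry G F).ncard)
    (hB : Separated G (2 * k) B) :
    2 * (edgeBdry G F ∩ (O ∪ B)).ncard ≤ (edgeBdry G F).ncard ∧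
    (k ≤ F.ncard → 2 * ((edgeBdry G F ∩ (O ∪ B)).ncard : ℝ) + ε / 2 * (edgeBdry G F).ncard ≤
      (edgeBdry G F).ncard) := by
  have hfin := finite_edgeBdry hLF (Or.inl hF)
  have hε : 0 ≤ ε := by
    by_contra hε
    have : ε * δ * k ≤ 0 := mul_nonpos_of_nonpos_of_nonneg
      (mul_nonpos_of_nonpos_of_nonneg (not_le.1 hε).le hδ.le) k.cast_nonneg
    linarith
  have hun : (edgeBdry G F ∩ (O ∪ B)).ncard ≤
      (edgeBdry G F ∩ O).ncard + (edgeBdry G F ∩ B).ncard := by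
    rw [inter_union_distrib_left]
    exact ncard_union_le _ _
  have hmain : k * (edgeBdry G F ∩ B).ncard ≤ F.ncard → k ≤ F.ncard →
      2 * ((edgeBdry G F ∩ (O ∪ B)).ncard : ℝ) + ε / 2 * (edgeBdry G F).ncard ≤
      (edgeBdry G F).ncard := by
    intro h1 h2
    have hL' := hL (hrk.trans h2)
    have h1' : (k : ℝ) * (edgeBdry G F ∩ B).ncard ≤ F.ncard := by exact_mod_cast h1
    have hun' : ((edgeBdry G F ∩ (O ∪ B)).ncard : ℝ) ≤
      (edgeBdry G F ∩ O).ncard + (edgeBdry G F ∩ B).ncard := by exact_mod_cast hun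
    have h3 : (ε * δ) * ((k : ℝ) * (edgeBdry G F ∩ B).ncard) ≤ (ε * δ) * F.ncard :=
      mul_le_mul_of_nonneg_left h1' (mul_nonneg hε hδ.le)
    have h4 : ε * (δ * F.ncard) ≤ ε * (edgeBdry G F).ncard := mul_le_mul_of_nonneg_left hexp hε
    have h5 : 4 * ((edgeBdry G F ∩ B).ncard : ℝ) ≤ ε * δ * k * (edgeBdry G F ∩ B).ncard :=
      mul_le_mul_of_nonneg_right hk (Nat.cast_nonneg _)
    linarith
  constructor
  · by_cases h1 : (edgeBdry G F ∩ B).ncard ≤ 1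
    · rcases (edgeBdry G F ∩ B).eq_empty_or_nonempty with he | ⟨p, hp⟩
      · rw [inter_union_distrib_left, he, union_empty]
        exact hC
      · refine le_trans ?_ (hCB p hp.2)
        refine Nat.mul_le_mul_left 2 (ncard_le_ncard ?_ (hfin.inter_of_left _))
        rintro q ⟨hq, hqO | hqB⟩
        · exact ⟨hq, Or.inr hqO⟩
        · exact ⟨hq, Or.inl ((ncard_le_one (hfin.inter_of_left _)).1 h1 q ⟨hq, hqB⟩ p hp)⟩
    · have h2 := (hB.ncard_inter_edgeBdry_le hF hI).resolve_left h1
      have h3 : k ≤ F.ncard := le_trans (Nat.le_mul_of_pos_right k (by omega)) h2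
      have h4 := hmain h2 h3
      have h5 : 2 * ((edgeBdry G F ∩ (O ∪ B)).ncard : ℝ) ≤ (edgeBdry G F).ncard := by
        have : 0 ≤ ε / 2 * (edgeBdry G F).ncard := mul_nonneg (by linarith) (Nat.cast_nonneg _)
        linarith
      exact_mod_cast h5
  · intro h
    refine hmain ?_ h
    rcases hB.ncard_inter_edgeBdry_le hF hI with h1 | h1
    · exact le_trans (by simpa using Nat.mul_le_mul_left k h1) h
    · exact h1

lemma cut_of_indecomposable (hLF : ∀ v : V, (G.neighborSet v).Finite) {O : Set (V × V)}
    (h : ∀ F : Set V, F.Finite → Indecomposable G F →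
      2 * (edgeBdry G F ∩ O).ncard ≤ (edgeBdry G F).ncard) {F : Set V} (hF : F.Finite) :
    2 * (edgeBdry G F ∩ O).ncard ≤ (edgeBdry G F).ncard := by
  induction hn : F.ncard using Nat.strong_induction_on generalizing F with
  | _ n ih =>
  by_cases hI : Indecomposable G F
  · exact h F hF hI
  simp only [Indecomposable, not_forall, not_exists, not_and] at hI
  obtain ⟨A, hAF, hA, hne, hno⟩ := hI
  have hAf := hF.subset hAF
  have hBf : (F \ A).Finite := hF.subset sdiff_subset
  have hlt1 : A.ncard < n := hn ▸ ncard_lt_ncard (hAF.ssubset_of_ne hne) hF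
  have hlt2 : (F \ A).ncard < n := by
    rw [← hn]
    refine ncard_lt_ncard (sdiff_subset.ssubset_of_ne fun he => ?_) hF
    obtain ⟨a, ha⟩ := hA
    have := hAF ha
    rw [← he] at this
    exact this.2 ha
  have i1 := ih _ hlt1 hAf rfl
  have i2 := ih _ hlt2 hBf rfl
  have hsplit : edgeBdry G F = edgeBdry G A ∪ edgeBdry G (F \ A) := by
    ext ⟨a, b⟩
    simp only [edgeBdry, mem_ofPred_eq, mem_union, mem_sdiff]
    constructor
    · rintro ⟨hab, ha, hb⟩
      by_cases haA : a ∈ A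
      · exact Or.inl ⟨hab, haA, fun hbA => hb (hAF hbA)⟩
      · exact Or.inr ⟨hab, ⟨ha, haA⟩, fun hb' => hb hb'.1⟩
    · rintro (⟨hab, ha, hb⟩ | ⟨hab, ha, hb⟩)
      · exact ⟨hab, hAF ha, fun hbF => hno a ha b ⟨hbF, hb⟩ hab⟩
      · refine ⟨hab, ha.1, fun hbF => hb ⟨hbF, fun hbA => hno b hbA a ha hab.symm⟩⟩
  have hdis : Disjoint (edgeBdry G A) (edgeBdry G (F \ A)) :=
    disjoint_left.2 fun p hp hq => hq.2.1.2 hp.2.1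
  have f1 := finite_edgeBdry hLF (G := G) (Or.inl hAf)
  have f2 := finite_edgeBdry hLF (G := G) (Or.inl hBf)
  rw [hsplit, union_inter_distrib_right, ncard_union_eq hdis f1 f2, ncard_union_eq
    (hdis.mono inter_subset_left inter_subset_left) (f1.inter_of_left _) (f2.inter_of_left _)]
  omega

lemma ncard_edgeBdry_compl_inter (F : Set V) (O : Set (V × V)) :
    (edgeBdry G Fᶜ ∩ O).ncard = (edgeBdry G F ∩ Prod.swap ⁻¹' O).ncard := by
  rw [edgeBdry_compl, ← image_inter_preimage, ncard_image_of_injective _ Prod.swap_injective]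

lemma cutCondition_iff {O : Set (V × V)} : CutCondition G O ↔ ∀ F : Set V, F.Finite →
    2 * (edgeBdry G F ∩ O).ncard ≤ (edgeBdry G F).ncard ∧
    2 * (edgeBdry G F ∩ Prod.swap ⁻¹' O).ncard ≤ (edgeBdry G F).ncard := by
  constructor
  · intro h F hF
    refine ⟨h F (Or.inl hF), ?_⟩
    rw [← ncard_edgeBdry_compl_inter, ← ncard_edgeBdry_compl]
    exact h Fᶜ (Or.inr (by rwa [compl_compl]))
  · rintro h P (hP | hP)
    · exact (h P hP).1
    · have := (h _ hP).2
      rwa [← ncard_edgeBdry_compl_inter, ← ncard_edgeBdry_compl, compl_compl] at this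

lemma cutCondition_of_indecomposable (hLF : ∀ v : V, (G.neighborSet v).Finite) {O : Set (V × V)}
    (h : ∀ F : Set V, F.Finite → Indecomposable G F →
      2 * (edgeBdry G F ∩ O).ncard ≤ (edgeBdry G F).ncard ∧
      2 * (edgeBdry G F ∩ Prod.swap ⁻¹' O).ncard ≤ (edgeBdry G F).ncard) : CutCondition G O :=
  cutCondition_iff.2 fun _ hF => ⟨cut_of_indecomposable hLF (fun F hF hI => (h F hF hI).1) hF,
    cut_of_indecomposable hLF (fun F hF hI => (h F hF hI).2) hF⟩

/-- Indecomposable sets of size at least `r` satisfy the cut condition with a proportional slack. -/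
def SlackCondition (G : SimpleGraph V) (O : Set (V × V)) (ε : ℝ) (r : ℕ) : Prop :=
  ∀ F : Set V, F.Finite → Indecomposable G F → r ≤ F.ncard →
    2 * ((edgeBdry G F ∩ O).ncard : ℝ) + ε * (edgeBdry G F).ncard ≤ (edgeBdry G F).ncard ∧
    2 * ((edgeBdry G F ∩ Prod.swap ⁻¹' O).ncard : ℝ) + ε * (edgeBdry G F).ncard ≤
      (edgeBdry G F).ncard

lemma CutCondition.union_separated (hLF : ∀ v : V, (G.neighborSet v).Finite) {δ : ℝ}
    (hδ : 0 < δ) (hexp : ∀ F : Set V, F.Finite → δ * F.ncard ≤ ((edgeBdry G F).ncard : ℝ))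
    {O B : Set (V × V)} (hC : CutCondition G O) (hCB : ∀ p ∈ B, CutCondition G (insert p O))
    {ε : ℝ} {r k : ℕ} (hrk : r ≤ k) (hk : 4 ≤ ε * δ * k) (hL : SlackCondition G O ε r)
    (hB : Separated G (2 * k) B) :
    CutCondition G (O ∪ B) ∧ SlackCondition G (O ∪ B) (ε / 2) k := by
  have h1 : ∀ F : Set V, F.Finite → Indecomposable G F → _ := fun F hF hI =>
    cut_union_separated hLF hδ hF hI (hexp F hF) (cutCondition_iff.1 hC F hF).1
      (fun p hp => (cutCondition_iff.1 (hCB p hp) F hF).1) hrk hk (fun h => (hL F hF hI h).1) hB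
  have h2 : ∀ F : Set V, F.Finite → Indecomposable G F → _ := fun F hF hI =>
    cut_union_separated hLF hδ hF hI (hexp F hF) (cutCondition_iff.1 hC F hF).2
      (B := Prod.swap ⁻¹' B)
      (fun p hp => by
        refine le_of_eq_of_le ?_ (cutCondition_iff.1 (hCB p.swap hp) F hF).2
        congr 3
        ext q
        simp only [mem_insert_iff, mem_preimage]
        rw [Prod.swap_injective.eq_iff])
      hrk hk (fun h => (hL F hF hI h).2) hB.swap
  exact ⟨cutCondition_of_indecomposable hLF fun F hF hI => ⟨(h1 F hF hI).1, (h2 F hF hI).1⟩,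
    fun F hF hI hk => ⟨(h1 F hF hI).2 hk, (h2 F hF hI).2 hk⟩⟩

lemma cutCondition_empty : CutCondition G ∅ := fun P _ => by simp

lemma slackCondition_empty (r : ℕ) : SlackCondition G ∅ 1 r := fun F _ _ _ => by simp

/-- The cut condition for one new edge only has to be tested on sets meeting that edge. -/
lemma CutCondition.insert_of_local (hLF : ∀ v : V, (G.neighborSet v).Finite)
    {O : Set (V × V)} (hC : CutCondition G O) {p : V × V}
    (h : ∀ F : Set V, F.Finite → Indecomposable G F → p.1 ∈ F ∨ p.2 ∈ F →
      2 * (edgeBdry G F ∩ insert p O).ncard ≤ (edgeBdry G F).ncard ∧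
      2 * (edgeBdry G F ∩ Prod.swap ⁻¹' insert p O).ncard ≤ (edgeBdry G F).ncard) :
    CutCondition G (insert p O) := by
  refine cutCondition_of_indecomposable hLF fun F hF hI => ?_
  by_cases hp : p.1 ∈ F ∨ p.2 ∈ F
  · exact h F hF hI hp
  · push Not at hp
    convert cutCondition_iff.1 hC F hF using 4
    · exact inter_insert_of_notMem fun hpF => hp.1 hpF.2.1
    · ext q
      simp only [mem_inter_iff, mem_preimage, mem_insert_iff]
      refine and_congr_right fun hq => or_iff_right fun hqp => hp.2 ?_
      rw [← hqp]
      exact hq.2.1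

lemma Indecomposable.reachable {F : Set V} (hI : Indecomposable G F) {x y : V} (hx : x ∈ F)
    (hy : y ∈ F) : G.Reachable x y := by
  by_contra hn
  obtain ⟨a, ha, b, hb, hab⟩ := hI {z | z ∈ F ∧ G.Reachable x z} (fun z hz => hz.1)
    ⟨x, hx, SimpleGraph.Reachable.refl x⟩ (fun h => hn (by rw [← h] at hy; exact hy.2))
  exact hb.2 ⟨hb.1, ha.2.trans hab.reachable⟩

end Separation

/-! ### Borel enumeration of finite sections, and countable Borel colorings -/

section Enumeration

variable {V : Type*} [MeasurableSpace V] [StandardBorelSpace V]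

/-- A Borel set all of whose sections have at most `n` elements is covered by the graphs of `n`
Borel functions. -/
lemma exists_measurable_enumeration (n : ℕ) {E : Set (V × V)} (hE : MeasurableSet E)
    (hfin : ∀ x, {y | (x, y) ∈ E}.Finite) (hcard : ∀ x, {y | (x, y) ∈ E}.ncard ≤ n) :
    ∃ f : Fin n → V → V, (∀ i, Measurable (f i)) ∧ ∀ x y, (x, y) ∈ E → ∃ i, f i x = y := by
  classical
  induction n generalizing E with
  | zero =>
    refine ⟨fun i => i.elim0, fun i => i.elim0, fun x y hxy => ?_⟩
    have := (ncard_eq_zero (hfin x)).1 (Nat.le_zero.1 (hcard x))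
    exact absurd hxy (eq_empty_iff_forall_notMem.1 this y)
  | succ n ih =>
    set e := MeasureTheory.embeddingReal V
    have he : MeasurableEmbedding e := MeasureTheory.measurableEmbedding_embeddingReal V
    set T' : Set (V × (Fin (n + 1) → V)) :=
      {q | (∀ i j, i < j → e (q.2 i) < e (q.2 j)) ∧ ∀ i, (q.1, q.2 i) ∈ E} with hT'
    have hT'm : MeasurableSet T' := by
      have h1 : ∀ i, Measurable fun q : V × (Fin (n + 1) → V) => q.2 i := fun i =>
        (measurable_pi_apply i).comp measurable_snd
      have : T' = (⋂ i, ⋂ j, ⋂ _ : i < j, {q | e (q.2 i) < e (q.2 j)}) ∩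
          ⋂ i, {q | (q.1, q.2 i) ∈ E} := by
        ext q
        simp [hT']
      rw [this]
      refine (MeasurableSet.iInter fun i => MeasurableSet.iInter fun j =>
        MeasurableSet.iInter fun _ => measurableSet_lt (he.measurable.comp (h1 i))
          (he.measurable.comp (h1 j))).inter (MeasurableSet.iInter fun i =>
            (measurable_fst.prodMk (h1 i)) hE)
    have huniq : ∀ q ∈ T', ∀ y, (q.1, y) ∈ E → ∃ i, q.2 i = y := by
      rintro ⟨x, g⟩ ⟨hg, hgE⟩ y hy
      have hinj : Function.Injective g := by
        have : StrictMono (e ∘ g) := fun i j hij => hg i j hij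
        exact this.injective.of_comp
      have hsub : range g ⊆ {y | (x, y) ∈ E} := by
        rintro _ ⟨i, rfl⟩
        exact hgE i
      have hr : (range g).ncard = n + 1 := by
        rw [← image_univ, ncard_image_of_injective _ hinj, ncard_univ, Nat.card_fin]
      have := eq_of_subset_of_ncard_le hsub (by rw [hr]; exact hcard x) (hfin x)
      have hy' : y ∈ range g := by rw [this]; exact hy
      exact hy'
    have hinj : InjOn Prod.fst T' := by
      rintro ⟨x, g⟩ hg ⟨x', g'⟩ hg' (rfl : x = x')
      have hr : range (e ∘ g) = range (e ∘ g') := by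
        rw [range_comp, range_comp]
        congr 1
        apply Subset.antisymm
        · rintro _ ⟨i, rfl⟩
          exact huniq _ hg' _ (hg.2 i)
        · rintro _ ⟨i, rfl⟩
          exact huniq _ hg _ (hg'.2 i)
      have h1 : StrictMono (e ∘ g) := fun i j hij => hg.1 i j hij
      have h2 : StrictMono (e ∘ g') := fun i j hij => hg'.1 i j hij
      have := (StrictMono.range_inj h1 h2).1 hr
      rw [he.injective.comp_left this]
    set T : Set V := Prod.fst '' T' with hT
    have hTm : MeasurableSet T := hT'm.image_of_measurable_injOn measurable_fst hinj
    have hTc : ∀ x, {y | (x, y) ∈ E}.ncard = n + 1 → x ∈ T := by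
      intro x hx
      set s : Finset ℝ := (hfin x).toFinset.image e with hs
      have hsc : s.card = n + 1 := by
        rw [hs, Finset.card_image_of_injective _ he.injective, ← ncard_eq_toFinset_card _ (hfin x), hx]
      have hmem : ∀ i, ∃ y, (x, y) ∈ E ∧ e y = s.orderEmbOfFin hsc i := by
        intro i
        obtain ⟨y, hy, hye⟩ := Finset.mem_image.1 (s.orderEmbOfFin_mem hsc i)
        exact ⟨y, (hfin x).mem_toFinset.1 hy, hye⟩
      choose g hg using hmem
      refine ⟨(x, g), ⟨fun i j hij => ?_, fun i => (hg i).1⟩, rfl⟩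
      simp only [(hg i).2, (hg j).2]
      exact (s.orderEmbOfFin hsc).strictMono hij
    obtain ⟨f, hf, hfE⟩ := ih (E := E ∩ {p | p.1 ∈ Tᶜ})
      (hE.inter (measurable_fst hTm.compl))
      (fun x => (hfin x).subset fun y hy => hy.1) (fun x => by
        by_cases hx : x ∈ T
        · have : {y | (x, y) ∈ E ∩ {p | p.1 ∈ Tᶜ}} = ∅ := by
            ext y
            simp [hx]
          rw [this, ncard_empty]
          exact Nat.zero_le _
        · have h1 : {y | (x, y) ∈ E ∩ {p | p.1 ∈ Tᶜ}}.ncard ≤ {y | (x, y) ∈ E}.ncard :=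
            ncard_le_ncard (fun y hy => hy.1) (hfin x)
          have h2 := hcard x
          have h3 : {y | (x, y) ∈ E}.ncard ≠ n + 1 := fun h => hx (hTc x h)
          omega)
    have hex : ∀ x, ∃ g : Fin (n + 1) → V, (x ∈ T → (x, g) ∈ T') ∧ (x ∉ T → g = fun _ => x) := by
      intro x
      by_cases hx : x ∈ T
      · obtain ⟨⟨x', g⟩, hg, rfl⟩ := hx
        exact ⟨g, fun _ => hg, fun h => absurd (mem_image_of_mem _ hg) h⟩
      · exact ⟨fun _ => x, fun h => absurd h hx, fun _ => rfl⟩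
    choose g hg using hex
    have hgm : Measurable g := by
      intro B hB
      have : g ⁻¹' B = Prod.fst '' (T' ∩ {q | q.2 ∈ B}) ∪ (Tᶜ ∩ {x | (fun _ => x) ∈ B}) := by
        ext x
        by_cases hx : x ∈ T
        · simp only [mem_preimage, mem_union, mem_inter_iff, mem_compl_iff, hx, not_true,
            false_and, or_false]
          constructor
          · intro h
            exact ⟨(x, g x), ⟨(hg x).1 hx, h⟩, rfl⟩
          · rintro ⟨⟨x', g'⟩, ⟨h1, h2⟩, rfl⟩
            have := hinj h1 ((hg _).1 hx) rfl
            rw [Prod.mk.injEq] at this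
            rw [← this.2]
            exact h2
        · have : x ∉ Prod.fst '' (T' ∩ {q | q.2 ∈ B}) := fun h =>
            hx (image_mono inter_subset_left h)
          simp [this, hx, (hg x).2 hx]
      rw [this]
      refine MeasurableSet.union ?_ (hTm.compl.inter ?_)
      · exact (hT'm.inter (measurable_snd hB)).image_of_measurable_injOn measurable_fst
          (hinj.mono inter_subset_left)
      · exact (measurable_pi_lambda _ fun _ => measurable_id) hB
    refine ⟨fun i x => if x ∈ T then g x i else (Fin.lastCases x (fun j => f j x) i : V), ?_, ?_⟩
    · intro i
      refine Measurable.ite hTm ((measurable_pi_apply i).comp hgm) ?_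
      induction i using Fin.lastCases with
      | last => simpa using measurable_id'
      | cast j => simpa using hf j
    · intro x y hxy
      by_cases hx : x ∈ T
      · obtain ⟨i, hi⟩ := huniq _ ((hg x).1 hx) y hxy
        exact ⟨i, by simpa [hx] using hi⟩
      · obtain ⟨i, hi⟩ := hfE x y ⟨hxy, hx⟩
        exact ⟨i.castSucc, by simpa [hx] using hi⟩

end Enumeration

section Words

variable {V ι : Type*}

/-- Apply a word of functions to a point, the last letter acting first. -/
def applyWord (f : ι → V → V) (w : List ι) (x : V) : V := w.foldr f x

lemma applyWord_append (f : ι → V → V) (v w : List ι) (x : V) :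
    applyWord f (v ++ w) x = applyWord f v (applyWord f w x) := by
  simp [applyWord]

lemma measurable_applyWord [MeasurableSpace V] {f : ι → V → V} (hf : ∀ i, Measurable (f i))
    (w : List ι) : Measurable (applyWord f w) := by
  induction w with
  | nil => exact measurable_id
  | cons i w ih => exact (hf i).comp ih

lemma Near.exists_applyWord {G : SimpleGraph V} {f : ι → V → V}
    (hf : ∀ x y, G.Adj x y → ∃ i, f i x = y) {n : ℕ} {x y : V} (h : Near G n x y) :
    ∃ w : List ι, w.length ≤ n ∧ applyWord f w x = y := by
  obtain ⟨p, hp⟩ := h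
  induction p generalizing n with
  | nil => exact ⟨[], Nat.zero_le _, rfl⟩
  | cons hadj p ih =>
    obtain ⟨i, rfl⟩ := hf _ _ hadj
    rw [SimpleGraph.Walk.length_cons] at hp
    obtain ⟨w, hw, rfl⟩ := ih (n := n - 1) (by omega)
    refine ⟨w ++ [i], by simp; omega, ?_⟩
    rw [applyWord_append]
    rfl

lemma SimpleGraph.Reachable.exists_applyWord {G : SimpleGraph V} {f : ι → V → V}
    (hf : ∀ x y, G.Adj x y → ∃ i, f i x = y) {x y : V} (h : G.Reachable x y) :
    ∃ w : List ι, applyWord f w x = y := by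
  obtain ⟨p⟩ := h
  obtain ⟨w, -, hw⟩ := Near.exists_applyWord hf ⟨p, le_refl p.length⟩
  exact ⟨w, hw⟩

/-- The space is a countable union of Borel sets without distinct points at distance at
most `n`. -/
lemma exists_measurable_discrete_cover [TopologicalSpace V] [T2Space V]
    [SecondCountableTopology V] [MeasurableSpace V] [BorelSpace V] [Finite ι]
    {G : SimpleGraph V} {f : ι → V → V} (hfm : ∀ i, Measurable (f i))
    (hf : ∀ x y, G.Adj x y → ∃ i, f i x = y) (n : ℕ) :
    ∃ C : ℕ → Set V, (∀ k, MeasurableSet (C k)) ∧ ⋃ k, C k = univ ∧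
      ∀ k, ∀ x ∈ C k, ∀ y ∈ C k, Near G n x y → x = y := by
  classical
  obtain ⟨b, hbc, -, hb⟩ := TopologicalSpace.exists_countable_basis V
  obtain ⟨U, hU⟩ := (hbc.insert ∅).exists_eq_range (insert_nonempty _ _)
  have hUo : ∀ k, IsOpen (U k) := by
    intro k
    have : U k ∈ insert ∅ b := hU ▸ mem_range_self k
    rcases this with h | h
    · rw [h]; exact isOpen_empty
    · exact hb.isOpen h
  refine ⟨fun k => U k ∩ ⋂ w : {w : List ι | w.length ≤ n},
    ({x | applyWord f w x = x} ∪ (applyWord f w ⁻¹' U k)ᶜ), ?_, ?_, ?_⟩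
  · intro k
    have : Countable {w : List ι | w.length ≤ n} := (List.finite_length_le ι n).to_subtype.to_countable
    refine (hUo k).measurableSet.inter (MeasurableSet.iInter fun w => ?_)
    exact (measurableSet_eq_fun (measurable_applyWord hfm _) measurable_id).union
      (measurable_applyWord hfm _ (hUo k).measurableSet).compl
  · refine eq_univ_of_forall fun x => mem_iUnion.2 ?_
    have hfin : ((fun w => applyWord f w x) '' {w : List ι | w.length ≤ n} \ {x}).Finite :=
      ((List.finite_length_le ι n).image _).sdiff
    obtain ⟨u, hu, hxu, huO⟩ := hb.exists_subset_of_mem_open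
      (a := x) (u := ((fun w => applyWord f w x) '' {w : List ι | w.length ≤ n} \ {x})ᶜ)
      (fun h => h.2 rfl) hfin.isClosed.isOpen_compl
    obtain ⟨k, rfl⟩ : u ∈ range U := hU ▸ mem_insert_of_mem _ hu
    refine ⟨k, hxu, mem_iInter.2 fun w => ?_⟩
    by_cases hw : applyWord f w x = x
    · exact Or.inl hw
    · exact Or.inr fun h => huO h ⟨⟨w, w.2, rfl⟩, hw⟩
  · rintro k x ⟨-, hx⟩ y ⟨hy, -⟩ hxy
    obtain ⟨w, hw, rfl⟩ := hxy.exists_applyWord hf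
    rcases mem_iInter.1 hx ⟨w, hw⟩ with h | h
    · exact h.symm
    · exact absurd hy h

/-- Sets that are discrete at prescribed scales, of which every word-translate of almost every
point is hit at every label. -/
lemma exists_discrete_sequence [TopologicalSpace V] [T2Space V] [BaireSpace V]
    [SecondCountableTopology V] [MeasurableSpace V] [BorelSpace V] [Finite ι] [Nonempty ι]
    {G : SimpleGraph V} {f : ι → V → V} (hfm : ∀ i, Measurable (f i))
    (hf : ∀ x y, G.Adj x y → ∃ i, f i x = y) (R : ℕ → ℕ) :
    ∃ (A : ℕ → Set V) (l : ℕ → ι), (∀ m, MeasurableSet (A m)) ∧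
      (∀ m, ∀ x ∈ A m, ∀ y ∈ A m, Near G (R m) x y → x = y) ∧
      ∀ w i, {x | ∃ m, l m = i ∧ applyWord f w x ∈ A m} ∈ residual V := by
  classical
  choose C hCm hCU hCd using fun m => exists_measurable_discrete_cover hfm hf (R m)
  obtain ⟨b, hbc, -, hb⟩ := TopologicalSpace.exists_countable_basis V
  have : Countable (insert ∅ b : Set (Set V)) := (hbc.insert ∅).to_subtype
  have : Nonempty (insert ∅ b : Set (Set V)) := ⟨⟨∅, mem_insert _ _⟩⟩
  obtain ⟨t, ht⟩ := exists_surjective_nat ((insert ∅ b : Set (Set V)) × List ι × ι)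
  have hk : ∀ m, ∃ k, ((t m).1 : Set V).Nonempty →
      ¬ IsMeagre ((t m).1 ∩ applyWord f (t m).2.1 ⁻¹' C m k) := by
    intro m
    by_contra! hno
    have hne := (hno 0).1
    have hopen : IsOpen ((t m).1 : Set V) := by
      rcases (t m).1.2 with h | h
      · rw [h]; exact isOpen_empty
      · exact hb.isOpen h
    refine not_isMeagre_of_isOpen hopen hne ?_
    refine (isMeagre_iUnion fun k => (hno k).2).mono ?_
    rw [← inter_iUnion, ← preimage_iUnion, hCU, preimage_univ, inter_univ]
  choose k hk using hk
  refine ⟨fun m => C m (k m), fun m => (t m).2.2, fun m => hCm _ _, fun m => hCd _ _, ?_⟩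
  intro w i
  set D : Set V := {x | ∃ m, (t m).2.2 = i ∧ applyWord f w x ∈ C m (k m)} with hD
  have hDm : MeasurableSet D := by
    have : D = ⋃ m, {x | (t m).2.2 = i ∧ applyWord f w x ∈ C m (k m)} := by
      ext x; simp [hD]
    rw [this]
    exact MeasurableSet.iUnion fun m =>
      (MeasurableSet.const _).inter (measurable_applyWord hfm w (hCm _ _))
  obtain ⟨u, hu, hDu⟩ := hDm.compl.residualEq_isOpen
  have hmeas : IsMeagre (u ∩ D) := by
    rw [IsMeagre]
    filter_upwards [hDu.mem_iff] with x hx hxu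
    exact hx.2 hxu.1 hxu.2
  have hemp : u = ∅ := by
    by_contra hne
    obtain ⟨x, hx⟩ := nonempty_iff_ne_empty.2 hne
    obtain ⟨v, hv, hxv, hvu⟩ := hb.exists_subset_of_mem_open hx hu
    obtain ⟨m, hm⟩ := ht (⟨v, mem_insert_of_mem _ hv⟩, w, i)
    have := hk m
    rw [hm] at this
    refine this ⟨x, hxv⟩ (hmeas.mono ?_)
    rintro y ⟨hy1, hy2⟩
    exact ⟨hvu hy1, m, by rw [hm], hy2⟩
  filter_upwards [hDu.mem_iff] with x hx
  rw [hemp] at hx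
  by_contra h
  exact hx.1 h

end Words

/-! ### Measurability of the cut condition -/

section Measurability

lemma measurable_ncard_image {α W τ : Type*} [MeasurableSpace α] [MeasurableSpace W]
    [MeasurableEq W] (T : Finset τ) {g : τ → α → W} (hg : ∀ t, Measurable (g t))
    {P : τ → Set α} (hP : ∀ t, MeasurableSet (P t)) :
    Measurable fun x => {z | ∃ t ∈ T, x ∈ P t ∧ g t x = z}.ncard := by
  classical
  refine measurable_of_Ici fun n => ?_
  have : (fun x => {z | ∃ t ∈ T, x ∈ P t ∧ g t x = z}.ncard) ⁻¹' Ici n =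
      ⋃ J ∈ T.powersetCard n, (⋂ t ∈ J, P t) ∩
        ⋂ t ∈ J, ⋂ s ∈ J, ⋂ _ : t ≠ s, {x | g t x = g s x}ᶜ := by
    ext x
    simp only [mem_preimage, mem_Ici, mem_iUnion, mem_inter_iff, mem_iInter, mem_compl_iff,
      mem_ofPred_eq, Finset.mem_powersetCard, exists_prop]
    have hfin : {z | ∃ t ∈ T, x ∈ P t ∧ g t x = z}.Finite :=
      (T.finite_toSet.image fun t => g t x).subset fun z ⟨t, ht, _, hz⟩ => ⟨t, ht, hz⟩
    constructor
    · intro h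
      obtain ⟨S, hS, hSc⟩ := exists_subset_card_eq h
      have hsurj : SurjOn (fun t => g t x) {t | t ∈ T ∧ x ∈ P t} S := by
        intro z hz
        obtain ⟨t, ht, hx, rfl⟩ := hS hz
        exact ⟨t, ⟨ht, hx⟩, rfl⟩
      obtain ⟨J, hJ, hbij⟩ := hsurj.exists_bijOn_subset
      have hJf : J.Finite := T.finite_toSet.subset fun t ht => (hJ ht).1
      refine ⟨hJf.toFinset, ⟨fun t ht => (hJ (hJf.mem_toFinset.1 ht)).1, ?_⟩,
        fun t ht => (hJ (hJf.mem_toFinset.1 ht)).2, fun t ht s hs hts h => hts ?_⟩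
      · rw [← ncard_eq_toFinset_card J hJf, ← hSc, ← hbij.image_eq, hbij.injOn.ncard_image]
      · exact hbij.injOn (hJf.mem_toFinset.1 ht) (hJf.mem_toFinset.1 hs) h
    · rintro ⟨J, ⟨hJT, hJc⟩, hJP, hJ⟩
      rw [← hJc, ← Finset.card_image_of_injOn (f := fun t => g t x) (s := J), ← ncard_coe_finset]
      · refine ncard_le_ncard ?_ hfin
        intro z hz
        obtain ⟨t, ht, rfl⟩ := Finset.mem_image.1 hz
        exact ⟨t, hJT ht, hJP t ht, rfl⟩
      · intro t ht s hs hts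
        by_contra hne
        exact hJ t ht s hs hne hts
  rw [this]
  refine Finset.measurableSet_biUnion _ fun J _ => (Finset.measurableSet_biInter _ fun t _ =>
    hP t).inter (Finset.measurableSet_biInter _ fun t _ => Finset.measurableSet_biInter _
      fun s _ => MeasurableSet.iInter fun _ => (measurableSet_eq_fun (hg t) (hg s)).compl)

variable {V ι : Type*} [MeasurableSpace V] [MeasurableEq V] [MeasurableEq (V × V)]
  [Fintype ι] {G : SimpleGraph V} {f : ι → V → V}

lemma measurable_ncard_edgeBdry_inter (hG : MeasurableSet {p : V × V | G.Adj p.1 p.2})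
    (hfm : ∀ i, Measurable (f i)) (hf : ∀ x y, G.Adj x y → ∃ i, f i x = y)
    (L : Finset (List ι)) {Z : Set (V × V × V)} (hZ : MeasurableSet Z) :
    Measurable fun x => (edgeBdry G ((fun w => applyWord f w x) '' L) ∩
      {p | (x, p) ∈ Z}).ncard := by
  classical
  set g : List ι × ι → V → V × V := fun t x => (applyWord f t.1 x, f t.2 (applyWord f t.1 x))
    with hg
  have hw := measurable_applyWord hfm
  have hgm : ∀ t, Measurable (g t) := fun t => (hw _).prodMk ((hfm _).comp (hw _))
  set P : List ι × ι → Set V := fun t => (g t ⁻¹' {p : V × V | G.Adj p.1 p.2}) ∩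
    (⋂ w ∈ L, {x | applyWord f w x = f t.2 (applyWord f t.1 x)}ᶜ) ∩
    (fun x => (x, g t x)) ⁻¹' Z with hP
  have hPm : ∀ t, MeasurableSet (P t) := fun t =>
    ((hgm t hG).inter (Finset.measurableSet_biInter _ fun w _ =>
      (measurableSet_eq_fun (hw w) ((hfm _).comp (hw _))).compl)).inter
      ((measurable_id.prodMk (hgm t)) hZ)
  convert measurable_ncard_image (L ×ˢ Finset.univ) hgm hPm using 3 with x
  ext ⟨a, b⟩
  simp only [edgeBdry, mem_inter_iff, mem_ofPred_eq, mem_image, Finset.mem_coe, not_exists,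
    not_and, Finset.mem_product, Finset.mem_univ, and_true, Prod.exists, hP, hg, mem_preimage,
    mem_iInter, mem_compl_iff, Prod.mk.injEq]
  constructor
  · rintro ⟨⟨hab, ⟨w, hwL, rfl⟩, hb⟩, hz⟩
    obtain ⟨i, rfl⟩ := hf _ _ hab
    exact ⟨w, i, hwL, ⟨⟨hab, hb⟩, hz⟩, rfl, rfl⟩
  · rintro ⟨w, i, hwL, ⟨⟨hab, hb⟩, hz⟩, rfl, rfl⟩
    exact ⟨⟨hab, ⟨w, hwL, rfl⟩, hb⟩, hz⟩

lemma measurableSet_cutCondition_insert (hLF : ∀ v : V, (G.neighborSet v).Finite)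
    (hG : MeasurableSet {p : V × V | G.Adj p.1 p.2})
    (hfm : ∀ i, Measurable (f i)) (hf : ∀ x y, G.Adj x y → ∃ i, f i x = y)
    {O : Set (V × V)} (hO : MeasurableSet O) (hC : CutCondition G O) (i : ι) :
    MeasurableSet {x | CutCondition G (insert (x, f i x) O)} := by
  classical
  have hset : {x | CutCondition G (insert (x, f i x) O)} = ⋂ L : Finset (List ι),
      {x | 2 * (edgeBdry G ((fun w => applyWord f w x) '' L) ∩
          insert (x, f i x) O).ncard ≤ (edgeBdry G ((fun w => applyWord f w x) '' L)).ncard} ∩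
      {x | 2 * (edgeBdry G ((fun w => applyWord f w x) '' L) ∩ Prod.swap ⁻¹'
          insert (x, f i x) O).ncard ≤
          (edgeBdry G ((fun w => applyWord f w x) '' L)).ncard} := by
    ext x
    simp only [mem_ofPred_eq, mem_iInter, mem_inter_iff]
    constructor
    · exact fun h L => cutCondition_iff.1 h _ (L.finite_toSet.image _)
    · intro h
      refine hC.insert_of_local hLF fun F hF hI hx => ?_
      have hsurj : SurjOn (fun w => applyWord f w x) univ F := by
        intro y hy
        rcases hx with hx | hx
        · obtain ⟨w, hw⟩ := (hI.reachable hx hy).exists_applyWord hf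
          exact ⟨w, mem_univ _, hw⟩
        · obtain ⟨w, hw⟩ := (hI.reachable hx hy).exists_applyWord hf
          refine ⟨w ++ [i], mem_univ _, ?_⟩
          simp only [applyWord_append]
          exact hw
      obtain ⟨L, -, hL⟩ := hsurj.exists_bijOn_subset
      have hLf : L.Finite := hL.finite_iff_finite.2 hF
      have := h hLf.toFinset
      rwa [hLf.coe_toFinset, hL.image_eq] at this
  have hall : ∀ L : Finset (List ι), Measurable fun x =>
      (edgeBdry G ((fun w => applyWord f w x) '' L)).ncard := fun L => by
    simpa using measurable_ncard_edgeBdry_inter hG hfm hf L MeasurableSet.univ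
  have hZ : MeasurableSet {q : V × V × V | q.2 ∈ insert (q.1, f i q.1) O} :=
    (measurableSet_eq_fun measurable_snd (measurable_fst.prodMk
      ((hfm i).comp measurable_fst))).union (measurable_snd hO)
  have hZ' : MeasurableSet {q : V × V × V | q.2.swap ∈ insert (q.1, f i q.1) O} :=
    (measurableSet_eq_fun (measurable_swap.comp measurable_snd) (measurable_fst.prodMk
      ((hfm i).comp measurable_fst))).union ((measurable_swap.comp measurable_snd) hO)
  rw [hset]
  refine MeasurableSet.iInter fun L => MeasurableSet.inter ?_ ?_
  · exact measurableSet_le ((measurable_ncard_edgeBdry_inter hG hfm hf L hZ).const_mul 2) (hall L)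
  · exact measurableSet_le ((measurable_ncard_edgeBdry_inter hG hfm hf L hZ').const_mul 2)
      (hall L)

/-! ### The construction -/

/-- A Borel partial orientation that satisfies the cut condition, with slack `ε` on indecomposable
sets of size at least `r`. -/
structure GoodOrientation (G : SimpleGraph V) (ε : ℝ) (r : ℕ) (O : Set (V × V)) : Prop where
  measurableSet : MeasurableSet O
  adj : ∀ p ∈ O, G.Adj p.1 p.2
  asymm : ∀ a b, (a, b) ∈ O → (b, a) ∉ O
  cut : CutCondition G O
  slack : SlackCondition G O ε r

lemma GoodOrientation.exists_extension (hLF : ∀ v : V, (G.neighborSet v).Finite)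
    (heven : ∀ v : V, Even (G.neighborSet v).ncard)
    (hG : MeasurableSet {p : V × V | G.Adj p.1 p.2}) {δ : ℝ} (hδ : 0 < δ)
    (hexp : ∀ F : Set V, F.Finite → δ * F.ncard ≤ ((edgeBdry G F).ncard : ℝ))
    (hfm : ∀ i, Measurable (f i)) (hf : ∀ x y, G.Adj x y → ∃ i, f i x = y)
    {ε : ℝ} {r k : ℕ} (hrk : r ≤ k) (hk : 4 ≤ ε * δ * k) {A : Set V} (hA : MeasurableSet A)
    (hAd : ∀ x ∈ A, ∀ y ∈ A, Near G (2 * k + 2) x y → x = y) (i : ι)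
    {O : Set (V × V)} (hO : GoodOrientation G ε r O) :
    ∃ O', GoodOrientation G (ε / 2) k O' ∧ O ⊆ O' ∧
      ∀ x ∈ A, G.Adj x (f i x) → (x, f i x) ∈ O' ∨ (f i x, x) ∈ O' := by
  classical
  set D : Set V := {x | x ∈ A ∧ G.Adj x (f i x) ∧ (x, f i x) ∉ O ∧ (f i x, x) ∉ O} with hD
  set C : Set V := {x | CutCondition G (insert (x, f i x) O)} with hCdef
  set e : V → V × V := fun x => if x ∈ C then (x, f i x) else (f i x, x) with he
  have hgm : Measurable fun x => (x, f i x) := measurable_id.prodMk (hfm i)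
  have hgm' : Measurable fun x => (f i x, x) := (hfm i).prodMk measurable_id
  have hDm : MeasurableSet D := hA.inter ((hgm hG).inter
    ((hgm hO.measurableSet).compl.inter (hgm' hO.measurableSet).compl))
  have hCm : MeasurableSet C :=
    measurableSet_cutCondition_insert hLF hG hfm hf hO.measurableSet hO.cut i
  have hnear : ∀ x ∈ D, ∀ u, (u = (e x).1 ∨ u = (e x).2) → Near G 1 x u := by
    intro x hx u hu
    have : u = x ∨ u = f i x := by
      simp only [he] at hu
      split_ifs at hu
      · exact hu
      · exact hu.symm
    rcases this with rfl | rfl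
    · exact Near.refl _ _
    · exact hx.2.1.near
  have hsep : Separated G (2 * k) (e '' D) := by
    rintro _ ⟨x, hx, rfl⟩ _ ⟨y, hy, rfl⟩ u hu v hv huv
    have : Near G (2 * k + 2) x y := by
      have := ((hnear x hx u hu).trans huv).trans (hnear y hy v hv).symm
      exact this.mono (by omega)
    rw [hAd x hx.1 y hy.1 this]
  have hadj : ∀ x ∈ D, G.Adj (e x).1 (e x).2 := by
    intro x hx
    simp only [he]
    split_ifs
    · exact hx.2.1
    · exact hx.2.1.symm
  have hnotin : ∀ x ∈ D, e x ∉ O ∧ (e x).swap ∉ O := by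
    intro x hx
    simp only [he]
    split_ifs
    · exact ⟨hx.2.2.1, hx.2.2.2⟩
    · exact ⟨hx.2.2.2, hx.2.2.1⟩
  have hcut : ∀ p ∈ e '' D, CutCondition G (insert p O) := by
    rintro _ ⟨x, hx, rfl⟩
    simp only [he]
    split_ifs with hxC
    · exact hxC
    · exact hO.cut.extend hLF heven hO.asymm hx.2.1 hx.2.2.1 hx.2.2.2 hxC
  have hem : MeasurableSet (e '' D) := by
    have : e '' D = ((Prod.fst ⁻¹' (D ∩ C)) ∩ {p : V × V | p.2 = f i p.1}) ∪
        ((Prod.snd ⁻¹' (D ∩ Cᶜ)) ∩ {p : V × V | p.1 = f i p.2}) := by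
      ext ⟨a, b⟩
      simp only [mem_image, mem_union, mem_inter_iff, mem_preimage, mem_ofPred_eq, mem_compl_iff]
      constructor
      · rintro ⟨x, hx, hxe⟩
        simp only [he] at hxe
        split_ifs at hxe with hxC <;> obtain ⟨rfl, rfl⟩ := Prod.mk.inj hxe
        · exact Or.inl ⟨⟨hx, hxC⟩, rfl⟩
        · exact Or.inr ⟨⟨hx, hxC⟩, rfl⟩
      · rintro (⟨⟨hx, hxC⟩, rfl⟩ | ⟨⟨hx, hxC⟩, rfl⟩)
        · exact ⟨a, hx, by simp [he, hxC]⟩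
        · exact ⟨b, hx, by simp [he, hxC]⟩
    rw [this]
    exact ((measurable_fst (hDm.inter hCm)).inter (measurableSet_eq_fun measurable_snd
      ((hfm i).comp measurable_fst))).union ((measurable_snd (hDm.inter hCm.compl)).inter
      (measurableSet_eq_fun measurable_fst ((hfm i).comp measurable_snd)))
  obtain ⟨hc, hs⟩ := hO.cut.union_separated hLF hδ hexp hcut hrk hk hO.slack hsep
  refine ⟨O ∪ e '' D, ⟨hO.measurableSet.union hem, ?_, ?_, hc, hs⟩, subset_union_left, ?_⟩
  · rintro p (hp | ⟨x, hx, rfl⟩)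
    · exact hO.adj p hp
    · exact hadj x hx
  · rintro a b (h1 | h1) (h2 | h2)
    · exact hO.asymm a b h1 h2
    · obtain ⟨x, hx, hxe⟩ := h2
      have := (hnotin x hx).2
      rw [hxe] at this
      exact this h1
    · obtain ⟨x, hx, hxe⟩ := h1
      have := (hnotin x hx).2
      rw [hxe] at this
      exact this h2
    · have := hsep _ h1 _ h2 a (Or.inl rfl) a (Or.inr rfl) (Near.refl _ _)
      obtain ⟨x, hx, hxe⟩ := h1
      have hab := hadj x hx
      rw [hxe] at hab
      exact hab.ne (Prod.mk.inj this).1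
  · intro x hx hadj
    by_cases h1 : (x, f i x) ∈ O
    · exact Or.inl (Or.inl h1)
    by_cases h2 : (f i x, x) ∈ O
    · exact Or.inr (Or.inl h2)
    have hmem : e x ∈ e '' D := ⟨x, ⟨hx, hadj, h1, h2⟩, rfl⟩
    by_cases hxC : x ∈ C
    · left; right; simpa [he, hxC] using hmem
    · right; right; simpa [he, hxC] using hmem

lemma exists_goodOrientation_sequence (hLF : ∀ v : V, (G.neighborSet v).Finite)
    (heven : ∀ v : V, Even (G.neighborSet v).ncard)
    (hG : MeasurableSet {p : V × V | G.Adj p.1 p.2}) {δ : ℝ} (hδ : 0 < δ)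
    (hexp : ∀ F : Set V, F.Finite → δ * F.ncard ≤ ((edgeBdry G F).ncard : ℝ))
    (hfm : ∀ i, Measurable (f i)) (hf : ∀ x y, G.Adj x y → ∃ i, f i x = y)
    {K : ℕ → ℕ} (hKm : Monotone K) (hK : ∀ n, 4 ≤ (1 / 2) ^ n * δ * K (n + 1))
    {A : ℕ → Set V} (hA : ∀ n, MeasurableSet (A n))
    (hAd : ∀ n, ∀ x ∈ A n, ∀ y ∈ A n, Near G (2 * K (n + 1) + 2) x y → x = y) (l : ℕ → ι) :
    ∃ O : ℕ → Set (V × V), (∀ n, GoodOrientation G ((1 / 2) ^ n) (K n) (O n)) ∧ Monotone O ∧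
      ∀ n, ∀ x ∈ A n, G.Adj x (f (l n) x) →
        (x, f (l n) x) ∈ O (n + 1) ∨ (f (l n) x, x) ∈ O (n + 1) := by
  have step : ∀ n (O : {O // GoodOrientation G ((1 / 2) ^ n) (K n) O}),
      ∃ O' : {O // GoodOrientation G ((1 / 2) ^ (n + 1)) (K (n + 1)) O}, O.1 ⊆ O'.1 ∧
      ∀ x ∈ A n, G.Adj x (f (l n) x) → (x, f (l n) x) ∈ O'.1 ∨ (f (l n) x, x) ∈ O'.1 := by
    rintro n ⟨O, hO⟩
    obtain ⟨O', h1, h2, h3⟩ := hO.exists_extension hLF heven hG hδ hexp hfm hf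
      (hKm n.le_succ) (hK n) (hA n) (hAd n) (l n)
    refine ⟨⟨O', ?_⟩, h2, h3⟩
    rwa [pow_succ, mul_one_div]
  choose next hnext using step
  let O : ∀ n, {O // GoodOrientation G ((1 / 2) ^ n) (K n) O} := fun n =>
    Nat.rec ⟨∅, MeasurableSet.empty, fun p hp => hp.elim, fun _ _ h => h.elim, cutCondition_empty,
      by rw [pow_zero]; exact slackCondition_empty _⟩ (fun n O => next n O) n
  exact ⟨fun n => (O n).1, fun n => (O n).2, monotone_nat_of_le_succ fun n => (hnext n (O n)).1,
    fun n => (hnext n (O n)).2⟩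

end Measurability

lemma ncard_edgesBetween_compl_le {V : Type*} {G : SimpleGraph V}
    (hLF : ∀ v : V, (G.neighborSet v).Finite) {F : Set V} (hF : F.Finite) :
    (edgesBetween G F Fᶜ).ncard ≤ (edgeBdry G F).ncard := by
  have hfin := finite_edgeBdry hLF (G := G) (Or.inl hF)
  refine le_trans (ncard_le_ncard ?_ (hfin.image fun p => s(p.1, p.2))) (ncard_image_le hfin)
  rintro _ ⟨he, a, ha, b, hb, rfl⟩
  exact ⟨(a, b), ⟨he, ha, hb⟩, rfl⟩

/-- An orientation of all edges at `v` that satisfies the cut condition is balanced at `v`. -/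
lemma CutCondition.balanced {V : Type*} {G : SimpleGraph V}
    (hLF : ∀ v : V, (G.neighborSet v).Finite) {O : Set (V × V)} (hC : CutCondition G O)
    (hadj : ∀ p ∈ O, G.Adj p.1 p.2) (hasymm : ∀ a b, (a, b) ∈ O → (b, a) ∉ O) {v : V}
    (hv : ∀ u, G.Adj v u → (v, u) ∈ O ∨ (u, v) ∈ O) :
    {u | (u, v) ∈ O}.ncard = {u | (v, u) ∈ O}.ncard := by
  obtain ⟨h1, h2⟩ := cutCondition_iff.1 hC {v} (finite_singleton v)
  have e1 : edgeBdry G {v} ∩ O = Prod.mk v '' {u | (v, u) ∈ O} := by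
    ext ⟨a, b⟩
    constructor
    · rintro ⟨⟨-, (rfl : a = v), -⟩, h⟩
      exact ⟨b, h, rfl⟩
    · rintro ⟨u, hu, h⟩
      obtain ⟨rfl, rfl⟩ := Prod.mk.inj h
      exact ⟨⟨hadj _ hu, rfl, (hadj _ hu).ne'⟩, hu⟩
  have e2 : edgeBdry G {v} ∩ Prod.swap ⁻¹' O = Prod.mk v '' {u | (u, v) ∈ O} := by
    ext ⟨a, b⟩
    constructor
    · rintro ⟨⟨-, (rfl : a = v), -⟩, h⟩
      exact ⟨b, h, rfl⟩
    · rintro ⟨u, hu, h⟩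
      obtain ⟨rfl, rfl⟩ := Prod.mk.inj h
      exact ⟨⟨(hadj _ hu).symm, rfl, (hadj _ hu).ne⟩, hu⟩
  have e3 : edgeBdry G {v} = (edgeBdry G {v} ∩ O) ∪ (edgeBdry G {v} ∩ Prod.swap ⁻¹' O) := by
    rw [← inter_union_distrib_left, eq_comm, inter_eq_left]
    rintro ⟨a, b⟩ ⟨hab, (rfl : a = v), -⟩
    exact hv b hab
  have hfin := finite_edgeBdry hLF (G := G) (Or.inl (finite_singleton v))
  have hd : Disjoint (edgeBdry G {v} ∩ O) (edgeBdry G {v} ∩ Prod.swap ⁻¹' O) :=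
    disjoint_left.2 fun p hp hq => hasymm _ _ hp.2 hq.2
  have e4 := ncard_union_eq hd (hfin.inter_of_left _) (hfin.inter_of_left _)
  rw [← e3] at e4
  have hinj : Function.Injective (Prod.mk v : V → V × V) := Prod.mk_right_injective v
  rw [← ncard_image_of_injective {u | (u, v) ∈ O} hinj,
    ← ncard_image_of_injective {u | (v, u) ∈ O} hinj, ← e1, ← e2]
  omega

lemma CutCondition.iUnion {V : Type*} {G : SimpleGraph V}
    (hLF : ∀ v : V, (G.neighborSet v).Finite) {O : ℕ → Set (V × V)} (hO : Monotone O)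
    (hC : ∀ n, CutCondition G (O n)) : CutCondition G (⋃ n, O n) := by
  intro P hP
  have hfin : (edgeBdry G P ∩ ⋃ n, O n).Finite := (finite_edgeBdry hLF hP).inter_of_left _
  obtain ⟨n, hn⟩ : ∃ n, edgeBdry G P ∩ ⋃ n, O n ⊆ O n := by
    have h := Directed.exists_mem_subset_of_finset_subset_biUnion (s := hfin.toFinset)
      hO.directed_le (by simp)
    simpa only [hfin.coe_toFinset] using h
  refine le_trans (Nat.mul_le_mul_left 2 (ncard_le_ncard ?_
    ((finite_edgeBdry hLF hP).inter_of_left _))) (hC n P hP)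
  exact fun p hp => ⟨hp.1, hn hp⟩

/-- Every bounded degree non-amenable Borel graph with only even degrees
admits a Borel balanced orientation on a Borel comeager invariant set. -/
theorem stmt_2 {V : Type*} [TopologicalSpace V] [PolishSpace V]
    [MeasurableSpace V] [BorelSpace V]
    (G : SimpleGraph V) (hGmeas : MeasurableSet {p : V × V | G.Adj p.1 p.2})
    (d : ℕ) (δ : ℝ) (hδ : 0 < δ)
    (hLF : ∀ v : V, (G.neighborSet v).Finite)
    (heven : ∀ v : V, Even (G.neighborSet v).ncard)
    (hdeg : ∀ v : V, (G.neighborSet v).ncard ≤ d)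
    (hexp : ∀ F : Set V, F.Finite →
      δ * F.ncard ≤ ((edgesBetween G F Fᶜ).ncard : ℝ)) :
    ∃ S : Set V, MeasurableSet S ∧ S ∈ residual V ∧ Invariant G S ∧
      ∃ O : Set (V × V), MeasurableSet O ∧
        (∀ p ∈ O, G.Adj p.1 p.2 ∧ p.1 ∈ S ∧ p.2 ∈ S) ∧
        (∀ x ∈ S, ∀ y ∈ S, G.Adj x y → Xor' ((x, y) ∈ O) ((y, x) ∈ O)) ∧
        (∀ v ∈ S, {u : V | (u, v) ∈ O}.ncard = {u : V | (v, u) ∈ O}.ncard) := by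
  classical
  rcases isEmpty_or_nonempty V with hV | hV
  · exact ⟨univ, MeasurableSet.univ, Filter.univ_mem, fun _ _ _ _ => mem_univ _, ∅,
      MeasurableSet.empty, fun p hp => hp.elim, fun x => isEmptyElim x, fun v => isEmptyElim v⟩
  have hexp' : ∀ F : Set V, F.Finite → δ * F.ncard ≤ ((edgeBdry G F).ncard : ℝ) := fun F hF =>
    (hexp F hF).trans (by exact_mod_cast ncard_edgesBetween_compl_le hLF hF)
  obtain ⟨f, hfm, hf⟩ := exists_measurable_enumeration (d + 1) hGmeas hLF
    fun x => (hdeg x).trans d.le_succ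
  replace hf : ∀ x y, G.Adj x y → ∃ i, f i x = y := hf
  set K : ℕ → ℕ := fun n => ⌈2 ^ (n + 1) / δ⌉₊ with hKdef
  have hKm : Monotone K := monotone_nat_of_le_succ fun n => Nat.ceil_mono (by
    gcongr
    · norm_num
    · omega)
  have hK : ∀ n, 4 ≤ (1 / 2) ^ n * δ * K (n + 1) := by
    intro n
    have h1 : (2 : ℝ) ^ (n + 1 + 1) / δ ≤ K (n + 1) := Nat.le_ceil _
    rw [div_le_iff₀ hδ] at h1
    have h2 : (0 : ℝ) < (1 / 2) ^ n := by positivity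
    calc (4 : ℝ) = (1 / 2) ^ n * 2 ^ (n + 1 + 1) := by
          rw [pow_succ, pow_succ, ← mul_assoc, ← mul_assoc, ← mul_pow]
          norm_num
      _ ≤ (1 / 2) ^ n * (K (n + 1) * δ) := mul_le_mul_of_nonneg_left h1 h2.le
      _ = (1 / 2) ^ n * δ * K (n + 1) := by ring
  obtain ⟨A, l, hA, hAd, hres⟩ :=
    exists_discrete_sequence (G := G) hfm hf fun n => 2 * K (n + 1) + 2
  obtain ⟨O, hO, hOm, hOA⟩ := exists_goodOrientation_sequence hLF heven hGmeas hδ hexp' hfm hf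
    hKm hK hA hAd l
  set S : Set V := ⋂ w, ⋂ i, {x | ∃ m, l m = i ∧ applyWord f w x ∈ A m} with hS
  have hSm : MeasurableSet S := by
    refine MeasurableSet.iInter fun w => MeasurableSet.iInter fun i => ?_
    rw [ofPred_exists]
    exact MeasurableSet.iUnion fun m =>
      (MeasurableSet.const _).inter (measurable_applyWord hfm w (hA m))
  have hSinv : Invariant G S := by
    intro x hx y hxy
    obtain ⟨v, rfl⟩ := hxy.exists_applyWord hf
    simp only [hS, mem_iInter] at hx ⊢
    intro w i
    have := hx (w ++ v) i
    simpa only [mem_ofPred_eq, applyWord_append] using this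
  have hcover : ∀ x ∈ S, ∀ y, G.Adj x y → (x, y) ∈ ⋃ n, O n ∨ (y, x) ∈ ⋃ n, O n := by
    intro x hx y hxy
    obtain ⟨i, rfl⟩ := hf x y hxy
    simp only [hS, mem_iInter] at hx
    obtain ⟨m, rfl, hm⟩ := hx [] i
    exact (hOA m x hm hxy).imp (fun h => mem_iUnion.2 ⟨_, h⟩) fun h => mem_iUnion.2 ⟨_, h⟩
  have hadj : ∀ p ∈ ⋃ n, O n, G.Adj p.1 p.2 := by
    intro p hp
    obtain ⟨n, hn⟩ := mem_iUnion.1 hp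
    exact (hO n).adj p hn
  have hasymm : ∀ a b, (a, b) ∈ ⋃ n, O n → (b, a) ∉ ⋃ n, O n := by
    intro a b h h'
    obtain ⟨n, hn⟩ := mem_iUnion.1 h
    obtain ⟨m, hm⟩ := mem_iUnion.1 h'
    exact (hO (max n m)).asymm a b (hOm (le_max_left _ _) hn) (hOm (le_max_right _ _) hm)
  have hcut := CutCondition.iUnion hLF hOm fun n => (hO n).cut
  refine ⟨S, hSm, ?_, hSinv, (⋃ n, O n) ∩ {p | p.1 ∈ S ∧ p.2 ∈ S}, ?_, ?_, ?_, ?_⟩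
  · exact countable_iInter_mem.2 fun w => countable_iInter_mem.2 fun i => hres w i
  · exact (MeasurableSet.iUnion fun n => (hO n).measurableSet).inter
      ((measurable_fst hSm).inter (measurable_snd hSm))
  · exact fun p hp => ⟨hadj p hp.1, hp.2⟩
  · intro x hx y hy hxy
    rcases hcover x hx y hxy with h | h
    · exact Or.inl ⟨⟨h, hx, hy⟩, fun h' => hasymm _ _ h h'.1⟩
    · exact Or.inr ⟨⟨h, hy, hx⟩, fun h' => hasymm _ _ h h'.1⟩
  · intro v hv
    have hbal := hcut.balanced hLF hadj hasymm (hcover v hv)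
    have h1 : {u | (u, v) ∈ (⋃ n, O n) ∩ {p | p.1 ∈ S ∧ p.2 ∈ S}} = {u | (u, v) ∈ ⋃ n, O n} :=
      Subset.antisymm (fun u hu => hu.1) fun u hu =>
        ⟨hu, hSinv hv (hadj _ hu).symm.reachable, hv⟩
    have h2 : {u | (v, u) ∈ (⋃ n, O n) ∩ {p | p.1 ∈ S ∧ p.2 ∈ S}} = {u | (v, u) ∈ ⋃ n, O n} :=
      Subset.antisymm (fun u hu => hu.1) fun u hu =>
        ⟨hu, hv, hSinv hv (hadj _ hu).reachable⟩
    rw [h1, h2, hbal]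
end

section
/- (Tutte's theorem for locally finite graphs.) A locally finite graph G admits a perfect matching if and only if for every finite set X ⊆ V(G), the graph G − X (the induced subgraph on V(G) \ X) has at most |X| many finite connected components of odd size. -/
open Set

/-- The finite odd connected components of the induced subgraph of `G` on `V \ X`. -/
def oddComponents {V : Type*} (G : SimpleGraph V) (X : Set V) :
    Set ((G.induce Xᶜ).ConnectedComponent) :=
  {C | C.supp.Finite ∧ Odd C.supp.ncard}

/-- Tutte's condition: for every finite `X ⊆ V(G)`, `G − X` has at most `|X|` many
finite components of odd size. -/
def TutteCond {V : Type*} (G : SimpleGraph V) : Prop :=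
  ∀ X : Set V, X.Finite → (oddComponents G X).encard ≤ X.encard

open SimpleGraph hiding oddComponents

/-- A map that is a local isomorphism along a connected component carries it onto
a connected component. -/
lemma SimpleGraph.ConnectedComponent.supp_mk_eq_image {A B : Type*} {H : SimpleGraph A}
    {K : SimpleGraph B} (φ : A → B) (c : H.ConnectedComponent)
    (h : ∀ a ∈ c.supp, ∀ y, K.Adj (φ a) y ↔ ∃ b, H.Adj a b ∧ φ b = y)
    {a : A} (ha : a ∈ c.supp) :
    (K.connectedComponentMk (φ a)).supp = φ '' c.supp := by
  ext y
  rw [ConnectedComponent.mem_supp_iff, ConnectedComponent.eq]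
  constructor
  · intro hy
    obtain ⟨p⟩ := hy.symm
    have key : ∀ {x y : B} (_ : K.Walk x y), x ∈ φ '' c.supp → y ∈ φ '' c.supp := by
      intro x y p
      induction p with
      | nil => exact id
      | cons hadj _ ih =>
        rintro ⟨a, ha, rfl⟩
        obtain ⟨b, hab, rfl⟩ := (h a ha _).1 hadj
        exact ih ⟨b, (c.mem_supp_congr_adj hab).1 ha, rfl⟩
    exact key p ⟨a, ha, rfl⟩
  · rintro ⟨b, hb, rfl⟩
    obtain ⟨p⟩ : H.Reachable b a := by
      rw [← ConnectedComponent.eq]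
      exact hb.trans ha.symm
    have key : ∀ {x y : A} (_ : H.Walk x y), x ∈ c.supp → K.Reachable (φ x) (φ y) := by
      intro x y p
      induction p with
      | nil => exact fun _ => Reachable.refl _
      | cons hadj _ ih =>
        intro hx
        exact ((h _ hx _).2 ⟨_, hadj, rfl⟩).reachable.trans
          (ih ((c.mem_supp_congr_adj hadj).1 hx))
    exact key p hb

/-- A perfect matching leaves every finite odd component of `G - X` through a vertex of `X`. -/
lemma exists_adj_of_mem_oddComponents {V : Type*} {G : SimpleGraph V} {M : G.Subgraph}
    (hM : M.IsPerfectMatching) {X : Set V} {C : (G.induce Xᶜ).ConnectedComponent}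
    (hC : C ∈ oddComponents G X) : ∃ w ∈ X, ∃ v ∈ C.supp, M.Adj v.1 w := by
  classical
  by_contra! h
  have hmatch : (M.induce (Subtype.val '' C.supp)).IsMatching := by
    rintro _ ⟨v, hv, rfl⟩
    obtain ⟨w, hw, huniq⟩ := hM.1 (hM.2 v.1)
    have hwX : w ∉ X := fun hwX => h w hwX v hv hw
    have hadj : (G.induce Xᶜ).Adj v ⟨w, hwX⟩ := hw.adj_sub
    exact ⟨w, ⟨⟨v, hv, rfl⟩, ⟨⟨w, hwX⟩, (C.mem_supp_congr_adj hadj).1 hv, rfl⟩, hw⟩,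
      fun y hy => huniq y hy.2.2⟩
  have hfin : (M.induce (Subtype.val '' C.supp)).verts.Finite := hC.1.image _
  have := hfin.fintype
  have heven := hmatch.even_card
  rw [← Set.ncard_eq_toFinset_card'] at heven
  have hcard : (M.induce (Subtype.val '' C.supp)).verts.ncard = C.supp.ncard :=
    Set.ncard_image_of_injective _ Subtype.val_injective
  rw [hcard] at heven
  exact Nat.not_even_iff_odd.2 hC.2 heven

lemma TutteCond.of_isPerfectMatching {V : Type*} {G : SimpleGraph V}
    {M : G.Subgraph} (hM : M.IsPerfectMatching) : TutteCond G := by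
  intro X _
  have key : ∀ C : (G.induce Xᶜ).ConnectedComponent, ∃ w, C ∈ oddComponents G X →
      w ∈ X ∧ ∃ v ∈ C.supp, M.Adj v.1 w := by
    intro C
    by_cases hC : C ∈ oddComponents G X
    · obtain ⟨w, hw, hv⟩ := exists_adj_of_mem_oddComponents hM hC
      exact ⟨w, fun _ => ⟨hw, hv⟩⟩
    · obtain ⟨v, -⟩ := C.nonempty_supp
      exact ⟨v, fun h => absurd h hC⟩
  choose f hf using key
  refine Set.encard_le_encard_of_injOn (f := f) (fun C hC => (hf C hC).1) ?_
  intro C hC D hD hCD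
  obtain ⟨v, hv, hvw⟩ := (hf C hC).2
  obtain ⟨u, hu, huw⟩ := (hf D hD).2
  rw [← hCD] at huw
  have : v = u := Subtype.ext (hM.1.eq_of_adj_right hvw huw)
  subst this
  exact ConnectedComponent.eq_of_common_vertex hv hu

/-- The induced subgraph on `T` with all edges between vertices outside of `S` added. -/
def cliqueOutside {V : Type*} (G : SimpleGraph V) (S T : Set V) : SimpleGraph T :=
  SimpleGraph.fromRel fun u v => G.Adj u v ∨ (u.1 ∉ S ∧ v.1 ∉ S)

lemma cliqueOutside_adj {V : Type*} {G : SimpleGraph V} {S T : Set V} {u v : T} :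
    (cliqueOutside G S T).Adj u v ↔ G.Adj u v ∨ (u ≠ v ∧ u.1 ∉ S ∧ v.1 ∉ S) := by
  have := G.adj_comm u v
  have h : G.Adj u v → u ≠ v := fun h he => h.ne (congrArg Subtype.val he)
  simp only [cliqueOutside, SimpleGraph.fromRel_adj]
  tauto

/-- All but at most one odd component of `cliqueOutside G S T - u` are odd components
of `G - u`. -/
lemma ncard_oddComponents_cliqueOutside_le {V : Type*} {G : SimpleGraph V} (hG : TutteCond G)
    {S T : Set V} (hT : T.Finite) (hN : ∀ v ∈ S, ∀ w, G.Adj v w → w ∈ T) (u : Set T) :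
    ((⊤ : (cliqueOutside G S T).Subgraph).deleteVerts u).coe.oddComponents.ncard
      ≤ u.ncard + 1 := by
  have := hT.to_subtype
  set H := cliqueOutside G S T with hH
  set D := ((⊤ : H.Subgraph).deleteVerts u).coe with hD
  set X : Set V := Subtype.val '' u
  have hXfin : X.Finite := u.toFinite.image _
  have hXcard : X.ncard = u.ncard := Set.ncard_image_of_injective _ Subtype.val_injective
  have hDadj : ∀ a b, D.Adj a b ↔ H.Adj a.1 b.1 := by
    intro a b
    have ha := a.2
    have hb := b.2
    simp only [Subgraph.deleteVerts_verts, Subgraph.verts_top, Set.mem_sdiff, Set.mem_univ,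
      true_and] at ha hb
    simp [hD, ha, hb]
  let φ : ((⊤ : H.Subgraph).deleteVerts u).verts → (Xᶜ : Set V) := fun a =>
    ⟨a.1.1, by
      rintro ⟨b, hb, hab⟩
      exact a.2.2 (Subtype.ext hab ▸ hb)⟩
  have hφ : Function.Injective φ := fun a b hab =>
    Subtype.ext (Subtype.ext (congrArg (fun z : (Xᶜ : Set V) => z.1) hab))
  set O : Set D.ConnectedComponent := {c ∈ D.oddComponents | ∀ a ∈ c.supp, a.1.1 ∈ S}
  have hsupp : ∀ c ∈ O, ∀ a ∈ c.supp,
      ((G.induce Xᶜ).connectedComponentMk (φ a)).supp = φ '' c.supp := by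
    intro c hc a ha
    refine ConnectedComponent.supp_mk_eq_image φ c (fun x hx y => ?_) ha
    have hxS := hc.2 x hx
    constructor
    · intro hadj
      have hadj' : G.Adj x.1.1 y.1 := hadj
      have hyu : (⟨y.1, hN _ hxS _ hadj'⟩ : T) ∉ u := fun h => y.2 ⟨_, h, rfl⟩
      refine ⟨⟨⟨y.1, hN _ hxS _ hadj'⟩, ⟨trivial, hyu⟩⟩, ?_, rfl⟩
      rw [hDadj, hH, cliqueOutside_adj]
      exact Or.inl hadj'
    · rintro ⟨b, hb, rfl⟩
      rw [hDadj, hH, cliqueOutside_adj] at hb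
      exact hb.resolve_right fun h => h.2.1 hxS
  have hOle : O.ncard ≤ u.ncard := by
    have hle : O.encard ≤ (oddComponents G X).encard := by
      refine Set.encard_le_encard_of_injOn
        (f := fun c => (G.induce Xᶜ).connectedComponentMk (φ c.nonempty_supp.some)) ?_ ?_
      · intro c hc
        have h := hsupp c hc _ c.nonempty_supp.some_mem
        refine ⟨?_, ?_⟩
        · rw [h]
          exact c.supp.toFinite.image _
        · rw [h, Set.ncard_image_of_injective _ hφ]
          exact hc.1
      · intro c hc d hd hcd
        have h := congrArg ConnectedComponent.supp hcd
        simp only at h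
        rw [hsupp c hc _ c.nonempty_supp.some_mem, hsupp d hd _ d.nonempty_supp.some_mem] at h
        exact ConnectedComponent.supp_injective (hφ.image_injective h)
    have := hle.trans (hG X hXfin)
    rw [← hXcard]
    rw [← O.toFinite.cast_ncard_eq, ← hXfin.cast_ncard_eq] at this
    exact_mod_cast this
  have hrest : (D.oddComponents \ O).ncard ≤ 1 := by
    rw [Set.ncard_le_one]
    intro c hc d hd
    have hex : ∀ c ∈ D.oddComponents \ O, ∃ a ∈ c.supp, a.1.1 ∉ S := by
      intro c hc
      by_contra! h
      exact hc.2 ⟨hc.1, h⟩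
    obtain ⟨a, ha, haS⟩ := hex c hc
    obtain ⟨b, hb, hbS⟩ := hex d hd
    by_cases hab : a = b
    · subst hab
      exact ConnectedComponent.eq_of_common_vertex ha hb
    · have hadj : D.Adj a b := by
        rw [hDadj, hH, cliqueOutside_adj]
        exact Or.inr ⟨fun h => hab (Subtype.ext h), haS, hbS⟩
      exact ConnectedComponent.eq_of_common_vertex ((c.mem_supp_congr_adj hadj).1 ha) hb
  have := Set.ncard_le_ncard_sdiff_add_ncard D.oddComponents O
  omega

/-- Under Tutte's condition a finite graph has evenly many vertices. -/
lemma TutteCond.even_card {V : Type*} [Finite V] {G : SimpleGraph V} (hG : TutteCond G) :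
    Even (Nat.card V) := by
  by_contra hodd
  rw [Nat.not_even_iff_odd] at hodd
  have hcard : Nat.card ((∅ : Set V)ᶜ : Set V) = Nat.card V := by simp
  have h := (G.induce (∅ : Set V)ᶜ).odd_ncard_oddComponents
  rw [hcard] at h
  obtain ⟨c, hc⟩ := Set.nonempty_of_ncard_ne_zero (h.2 hodd).pos.ne'
  have h0 := hG ∅ Set.finite_empty
  rw [Set.encard_empty, nonpos_iff_eq_zero, Set.encard_eq_zero] at h0
  exact Set.eq_empty_iff_forall_notMem.1 h0 c ⟨Set.toFinite _, hc⟩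

/-- Every finite vertex set lies in a finite vertex set of even size. -/
lemma TutteCond.exists_even_superset {V : Type*} {G : SimpleGraph V} (hG : TutteCond G)
    {T : Set V} (hT : T.Finite) : ∃ T', T ⊆ T' ∧ T'.Finite ∧ Even T'.ncard := by
  by_cases heven : Even T.ncard
  · exact ⟨T, subset_rfl, hT, heven⟩
  by_cases huniv : T = Set.univ
  · subst huniv
    have := Set.finite_univ_iff.1 hT
    rw [Set.ncard_univ] at heven
    exact absurd hG.even_card heven
  · obtain ⟨z, hz⟩ := (Set.ne_univ_iff_exists_notMem T).1 huniv
    refine ⟨insert z T, Set.subset_insert _ _, hT.insert z, ?_⟩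
    rw [Set.ncard_insert_of_notMem hz hT]
    exact (Nat.not_even_iff_odd.1 heven).add_one

/-- Under Tutte's condition every finite vertex set is covered by a matching. -/
lemma TutteCond.exists_matching_on {V : Type*} {G : SimpleGraph V}
    (hLF : ∀ v : V, (G.neighborSet v).Finite) (hG : TutteCond G) {S : Set V} (hS : S.Finite) :
    ∃ m : V → V, ∀ v ∈ S, G.Adj v (m v) ∧ m (m v) = v := by
  classical
  obtain ⟨T, hST, hT, heven⟩ := hG.exists_even_superset
    (hS.union (hS.biUnion fun v _ => hLF v))
  have hN : ∀ v ∈ S, ∀ w, G.Adj v w → w ∈ T := fun v hv w hw =>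
    hST (Or.inr (Set.mem_biUnion hv hw))
  have := hT.to_subtype
  obtain ⟨M, hM⟩ : ∃ M : (cliqueOutside G S T).Subgraph, M.IsPerfectMatching := by
    rw [SimpleGraph.tutte]
    intro u hu
    have hle := ncard_oddComponents_cliqueOutside_le hG hT hN u
    have hpar := ((⊤ : (cliqueOutside G S T).Subgraph).deleteVerts u).coe.odd_ncard_oddComponents
    have hcard : Nat.card ((⊤ : (cliqueOutside G S T).Subgraph).deleteVerts u).verts + u.ncard
        = T.ncard := by
      rw [Nat.card_coe_set_eq, Subgraph.deleteVerts_verts, Subgraph.verts_top,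
        Set.ncard_sdiff_add_ncard_of_subset (Set.subset_univ _), Set.ncard_univ,
        Nat.card_coe_set_eq]
    unfold SimpleGraph.IsTutteViolator at hu
    grind
  choose m hm using Subgraph.isPerfectMatching_iff.1 hM
  refine ⟨fun v => if hv : v ∈ T then m ⟨v, hv⟩ else v, fun v hv => ?_⟩
  have hvT : v ∈ T := hST (Or.inl hv)
  have hadj := (hm ⟨v, hvT⟩).1
  have hmm : m (m ⟨v, hvT⟩) = ⟨v, hvT⟩ := ((hm _).2 _ hadj.symm).symm
  simp only [hvT, dif_pos, Subtype.coe_prop, Subtype.coe_eta, hmm, and_true]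
  exact (cliqueOutside_adj.1 hadj.adj_sub).resolve_right fun h => h.2.1 hv

/-- Under Tutte's condition, by compactness, some involution moves every vertex to a neighbor. -/
lemma TutteCond.exists_involution {V : Type*} {G : SimpleGraph V}
    (hLF : ∀ v : V, (G.neighborSet v).Finite) (hG : TutteCond G) :
    ∃ f : V → V, ∀ v, G.Adj v (f v) ∧ f (f v) = v := by
  classical
  have hnbr : ∀ v, ∃ w, G.Adj v w := fun v => by
    obtain ⟨m, hm⟩ := hG.exists_matching_on hLF (Set.finite_singleton v)
    exact ⟨m v, (hm v rfl).1⟩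
  choose n hn using hnbr
  let _ : TopologicalSpace V := ⊥
  have : DiscreteTopology V := ⟨rfl⟩
  have hcomp : IsCompact (Set.univ.pi fun v => G.neighborSet v) :=
    isCompact_univ_pi fun v => (hLF v).isCompact
  have hclosed : ∀ v, IsClosed {f : V → V | f (f v) = v} := fun v => by
    have heq : {f : V → V | f (f v) = v} = (⋃ w, {f : V → V | f v = w ∧ f w ≠ v})ᶜ := by
      ext f
      simp
    rw [heq, isClosed_compl_iff]
    refine isOpen_iUnion fun w => ?_
    have heval : ∀ u, Continuous fun f : V → V => f u := fun u => continuous_apply u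
    have hw : IsOpen {f : V → V | f v = w} :=
      (isOpen_discrete {w}).preimage (heval v)
    have hv : IsOpen {f : V → V | f w ≠ v} :=
      (isOpen_discrete {x | x ≠ v}).preimage (heval w)
    exact hw.inter hv
  obtain ⟨f, hf, hinv⟩ := hcomp.inter_iInter_nonempty (fun v => {f : V → V | f (f v) = v})
    hclosed fun s => by
      obtain ⟨m, hm⟩ := hG.exists_matching_on hLF s.finite_toSet
      refine ⟨fun v => if G.Adj v (m v) ∧ m (m v) = v then m v else n v, ?_, ?_⟩
      · intro v _
        simp only [mem_neighborSet]
        split_ifs with h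
        exacts [h.1, hn v]
      · simp only [Set.mem_iInter]
        intro v hv
        obtain ⟨h1, h2⟩ := hm v hv
        simp [h1, h2, h1.symm]
  exact ⟨f, fun v => ⟨hf v trivial, Set.mem_iInter.1 hinv v⟩⟩

/-- **Tutte's theorem.** A locally finite graph admits a perfect matching
if and only if it satisfies Tutte's condition. -/
theorem stmt_3 {V : Type*} (G : SimpleGraph V)
    (hLF : ∀ v : V, (G.neighborSet v).Finite) :
    (∃ M : G.Subgraph, M.IsPerfectMatching) ↔ TutteCond G := by
  refine ⟨fun ⟨M, hM⟩ => TutteCond.of_isPerfectMatching hM, fun hG => ?_⟩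
  obtain ⟨f, hf⟩ := hG.exists_involution hLF
  let M : G.Subgraph :=
    { verts := Set.univ
      Adj := fun v w => f v = w
      adj_sub := by
        rintro v _ rfl
        exact (hf v).1
      edge_vert := fun _ => trivial
      symm := ⟨by
        rintro v _ rfl
        exact (hf v).2⟩ }
  exact ⟨M, Subgraph.isPerfectMatching_iff.2 fun v => ⟨f v, rfl, fun _ h => Eq.symm h⟩⟩
end

section
/- Let G be a locally finite Borel graph on a Polish space V(G), and suppose there is ε > 0 such that for every finite set X ⊆ V(G), |X| ≥ |C_odd(X)| + ε·|hull_odd(X)|. Then there exists a Borel G-invariant comeager set S ⊆ V(G) and a Borel set M of edges of G such that M is a perfect matching of the induced subgraph of G on S. -/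
open Set

/-- `hull_odd(X) := X ∪ ⋃ C_odd(X)`. -/
def hullOdd {V : Type*} (G : SimpleGraph V) (X : Set V) : Set V :=
  X ∪ Subtype.val '' (⋃ C ∈ oddComponents G X, C.supp)

/-- `M` (a symmetric set of ordered pairs) is a perfect matching of the induced
subgraph of `G` on `S`. -/
def IsPerfectMatchingOn {V : Type*} (G : SimpleGraph V) (S : Set V) (M : Set (V × V)) : Prop :=
  (∀ p ∈ M, G.Adj p.1 p.2) ∧
  (∀ x y : V, (x, y) ∈ M → (y, x) ∈ M) ∧
  (∀ p ∈ M, p.1 ∈ S ∧ p.2 ∈ S) ∧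
  (∀ x ∈ S, ∃! y : V, (x, y) ∈ M)

/-! ### Separation of countably many analytic sets, and Borel colorings -/

section Separation

open MeasureTheory

variable {V : Type*} [MeasurableSpace V]

/-- The sets `A n` can be enlarged to measurable sets with empty intersection. -/
def SeqSeparable (A : ℕ → Set V) : Prop :=
  ∃ B : ℕ → Set V, (∀ n, A n ⊆ B n) ∧ (∀ n, MeasurableSet (B n)) ∧ ⋂ n, B n = ∅

lemma SeqSeparable.of_iUnion {A : ℕ → Set V} (k : ℕ) {A' : ℕ → ℕ → Set V}
    (hk : A k ⊆ ⋃ m, A' m k) (hne : ∀ m, ∀ n ≠ k, A n ⊆ A' m n)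
    (h : ∀ m, SeqSeparable (A' m)) : SeqSeparable A := by
  choose B hAB hB hempty using h
  refine ⟨fun n => if n = k then ⋃ m, B m k else ⋂ m, B m n, fun n => ?_, fun n => ?_, ?_⟩
  · by_cases hn : n = k
    · subst hn
      simpa using hk.trans (iUnion_mono fun m => hAB m n)
    · simpa [hn] using fun m => (hne m n hn).trans (hAB m n)
  · by_cases hn : n = k
    · simpa [hn] using MeasurableSet.iUnion fun m => hB m k
    · simpa [hn] using MeasurableSet.iInter fun m => hB m n
  · rw [eq_empty_iff_forall_notMem]
    intro x hx
    rw [mem_iInter] at hx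
    have hxk := hx k
    simp only [if_true, mem_iUnion] at hxk
    obtain ⟨m, hm⟩ := hxk
    have : x ∈ ⋂ n, B m n := by
      rw [mem_iInter]
      intro n
      by_cases hn : n = k
      · exact hn ▸ hm
      · have := hx n
        simp only [hn, if_false, mem_iInter] at this
        exact this m
    simp [hempty] at this

lemma SeqSeparable.of_disjoint {A : ℕ → Set V} {i j : ℕ} {U W : Set V} (hU : MeasurableSet U)
    (hW : MeasurableSet W) (hi : A i ⊆ U) (hj : A j ⊆ W) (h : Disjoint U W) (hij : i ≠ j) :
    SeqSeparable A := by
  refine ⟨fun n => if n = i then U else if n = j then W else univ, fun n => ?_, fun n => ?_, ?_⟩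
  · dsimp only
    split_ifs with h1 h2
    · exact h1 ▸ hi
    · exact h2 ▸ hj
    · exact subset_univ _
  · dsimp only
    split_ifs
    exacts [hU, hW, MeasurableSet.univ]
  · rw [eq_empty_iff_forall_notMem]
    intro x hx
    rw [mem_iInter] at hx
    have h1 := hx i
    have h2 := hx j
    simp only [if_true, hij.symm, if_false] at h1 h2
    exact disjoint_left.1 h h1 h2

variable [TopologicalSpace V] [T2Space V] [OpensMeasurableSpace V]

/-- Novikov's separation theorem for continuous images of the Baire space. -/
lemma seqSeparable_range {f : ℕ → (ℕ → ℕ) → V} (hf : ∀ n, Continuous (f n))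
    (hempty : ⋂ n, range (f n) = ∅) : SeqSeparable fun n => range (f n) := by
  let box : ℕ → (ℕ → ℕ) → ℕ → Set (ℕ → ℕ) := fun t z n =>
    {y | ∀ d, Nat.pair n d < t → y d = z (Nat.pair n d)}
  by_contra hsep
  have step : ∀ t z, ¬ SeqSeparable (fun n => f n '' box t z n) →
      ∃ m, ¬ SeqSeparable (fun n => f n '' box (t + 1) (Function.update z t m) n) := by
    intro t z ht
    by_contra! hcon
    refine ht (SeqSeparable.of_iUnion (Nat.unpair t).1 ?_ ?_ hcon)
    · rintro _ ⟨y, hy, rfl⟩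
      refine mem_iUnion.2 ⟨y (Nat.unpair t).2, y, fun d hd => ?_, rfl⟩
      rcases (Nat.lt_succ_iff.1 hd).lt_or_eq with h | h
      · rw [Function.update_of_ne h.ne]
        exact hy d h
      · rw [h, Function.update_self, ← h, Nat.unpair_pair]
    · rintro m n hn _ ⟨y, hy, rfl⟩
      refine ⟨y, fun d hd => ?_, rfl⟩
      rcases (Nat.lt_succ_iff.1 hd).lt_or_eq with h | h
      · rw [Function.update_of_ne h.ne]
        exact hy d h
      · exact absurd (by rw [← h, Nat.unpair_pair]) hn
  choose! next hnext using step
  let w : ℕ → ℕ → ℕ := fun t => Nat.rec 0 (fun t z => Function.update z t (next t z)) t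
  have hw : ∀ t, ¬ SeqSeparable (fun n => f n '' box t (w t) n) := by
    intro t
    induction t with
    | zero =>
      have : ∀ n, box 0 (w 0) n = univ := fun n => by simp [box]
      simpa [this] using hsep
    | succ t ih => exact hnext t _ ih
  have hstable : ∀ s t, s < t → w t s = w (s + 1) s := by
    intro s t hst
    induction t, hst using Nat.le_induction with
    | base => rfl
    | succ t ht ih =>
      rw [← ih]
      exact Function.update_of_ne (Nat.lt_of_succ_le ht).ne _ _
  let y : ℕ → ℕ → ℕ := fun n d => w (Nat.pair n d + 1) (Nat.pair n d)
  obtain ⟨i, hi⟩ : ∃ i, f i (y i) ≠ f 0 (y 0) := by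
    by_contra! hall
    have : f 0 (y 0) ∈ ⋂ n, range (f n) := mem_iInter.2 fun n => ⟨y n, hall n⟩
    simp [hempty] at this
  obtain ⟨U, W, hU, hW, hiU, hiW, hUW⟩ := t2_separation hi
  have small : ∀ n, ∀ O : Set V, IsOpen O → f n (y n) ∈ O →
      ∃ t, ∀ t' ≥ t, f n '' box t' (w t') n ⊆ O := by
    intro n O hO hn
    have hO' : (f n) ⁻¹' O ∈ nhds (y n) := (hO.preimage (hf n)).mem_nhds hn
    rw [nhds_pi, Filter.mem_pi] at hO'
    obtain ⟨I, hI, s, hs, hsO⟩ := hO'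
    obtain ⟨t, ht⟩ := (hI.image fun d => Nat.pair n d).bddAbove
    refine ⟨t + 1, fun t' ht' => ?_⟩
    rintro _ ⟨z, hz, rfl⟩
    refine hsO fun d hd => ?_
    have hlt : Nat.pair n d < t' :=
      lt_of_lt_of_le (Nat.lt_succ_of_le (ht (mem_image_of_mem _ hd))) ht'
    rw [hz d hlt, hstable _ _ hlt]
    exact mem_of_mem_nhds (hs d)
  obtain ⟨t₁, ht₁⟩ := small i U hU hiU
  obtain ⟨t₂, ht₂⟩ := small 0 W hW hiW
  refine hw (max t₁ t₂) (SeqSeparable.of_disjoint (i := i) (j := 0) hU.measurableSet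
    hW.measurableSet (ht₁ _ (le_max_left _ _)) (ht₂ _ (le_max_right _ _)) hUW ?_)
  rintro rfl
  exact hi rfl

/-- **Novikov's separation theorem**. -/
theorem MeasureTheory.AnalyticSet.seqSeparable {A : ℕ → Set V} (hA : ∀ n, AnalyticSet (A n))
    (hempty : ⋂ n, A n = ∅) : SeqSeparable A := by
  by_cases h : ∃ n, A n = ∅
  · obtain ⟨n, hn⟩ := h
    refine ⟨fun k => if k = n then ∅ else univ, fun k => ?_, fun k => ?_, ?_⟩
    · by_cases hk : k = n
      · simp [hk, hn]
      · simp [hk]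
    · by_cases hk : k = n <;> simp [hk]
    · exact eq_empty_iff_forall_notMem.2 fun x hx => by simpa using mem_iInter.1 hx n
  · push Not at h
    have : ∀ n, ∃ f : (ℕ → ℕ) → V, Continuous f ∧ range f = A n := fun n => by
      have := hA n
      rw [AnalyticSet] at this
      exact this.resolve_left (h n).ne_empty
    choose f hf hfA using this
    have := seqSeparable_range hf (by simpa [hfA] using hempty)
    simpa [hfA] using this

end Separation

section Coloring

open MeasureTheory

variable {V : Type*} [TopologicalSpace V] [PolishSpace V] [MeasurableSpace V] [BorelSpace V]

/-- An analytic relation with finite sections has a countable Borel coloring. -/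
theorem exists_measurable_coloring {D : Set (V × V)} (hD : AnalyticSet D)
    (hfin : ∀ x, {y | (x, y) ∈ D}.Finite) :
    ∃ c : V → ℕ, Measurable c ∧ ∀ x y, (x, y) ∈ D → x ≠ y → c x ≠ c y := by
  rcases isEmpty_or_nonempty V with hV | hV
  · exact ⟨fun _ => 0, measurable_const, fun x => hV.elim x⟩
  obtain ⟨b, hbc, -, hb⟩ := TopologicalSpace.exists_countable_basis V
  have hbne : b.Nonempty := by
    obtain ⟨x⟩ := hV
    obtain ⟨u, hu, -⟩ := hb.exists_subset_of_mem_open (mem_univ x) isOpen_univ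
    exact ⟨u, hu⟩
  obtain ⟨U, rfl⟩ := hbc.exists_eq_range hbne
  have hUo : ∀ n, IsOpen (U n) := fun n => hb.isOpen (mem_range_self n)
  let E : ℕ → Set (V × V) := fun n => D ∩ {p | p.2 ∈ U n ∧ p.2 ≠ p.1}
  have hE : ∀ n, AnalyticSet (E n) := by
    intro n
    have h1 : MeasurableSet {p : V × V | p.2 ∈ U n ∧ p.2 ≠ p.1} :=
      (measurable_snd (hUo n).measurableSet).inter
        (measurableSet_eq_fun measurable_snd measurable_fst).compl
    rw [show E n = ⋂ i : Bool, cond i D {p : V × V | p.2 ∈ U n ∧ p.2 ≠ p.1} from inter_eq_iInter]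
    refine AnalyticSet.iInter fun i => ?_
    cases i
    exacts [h1.analyticSet, hD]
  let A : ℕ → Set V := fun n => (U n)ᶜ ∪ Prod.fst '' E n
  have hA : ∀ n, AnalyticSet (A n) := by
    intro n
    rw [show A n = ⋃ i : Bool, cond i (U n)ᶜ (Prod.fst '' E n) from union_eq_iUnion]
    refine AnalyticSet.iUnion fun i => ?_
    cases i
    exacts [(hE n).image_of_continuous continuous_fst, (hUo n).isClosed_compl.analyticSet]
  have hAe : ⋂ n, A n = ∅ := by
    rw [eq_empty_iff_forall_notMem]
    intro x hx
    rw [mem_iInter] at hx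
    obtain ⟨_, ⟨n, rfl⟩, hxn, hn⟩ := hb.exists_subset_of_mem_open
      (show x ∈ ({y | (x, y) ∈ D} \ {x})ᶜ by simp)
      ((hfin x).subset sdiff_subset).isClosed.isOpen_compl
    rcases hx n with h | ⟨⟨x', y⟩, ⟨hxy, hy, hne⟩, rfl⟩
    · exact h hxn
    · exact hn hy ⟨hxy, hne⟩
  obtain ⟨B, hAB, hB, hBe⟩ := AnalyticSet.seqSeparable hA hAe
  have hex : ∀ x, ∃ n, x ∉ B n := by
    intro x
    by_contra! h
    have : x ∈ ⋂ n, B n := mem_iInter.2 h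
    simp [hBe] at this
  classical
  refine ⟨fun x => Nat.find (hex x), measurable_find hex fun n => (hB n).compl, ?_⟩
  intro x y hxy hne hc
  have hx := Nat.find_spec (hex x)
  have hy := Nat.find_spec (hex y)
  rw [← show Nat.find (hex x) = Nat.find (hex y) from hc] at hy
  have hx' : x ∉ A _ := fun h => hx (hAB _ h)
  have hy' : y ∉ A _ := fun h => hy (hAB _ h)
  simp only [A, mem_union, mem_compl_iff, not_or, not_not] at hx' hy'
  exact hx'.2 ⟨(x, y), ⟨hxy, hy'.1, hne.symm⟩, rfl⟩

end Coloring

/-! ### Tutte's condition relative to a set of removed vertices -/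

section Tutte

variable {V : Type*} (G : SimpleGraph V)

/-- The finite set `Y` induces a connected subgraph: no nonempty proper part is closed
under adjacency. -/
def ConnectedOn (Y : Finset V) : Prop :=
  ∀ K ⊆ Y, K.Nonempty → (∀ u ∈ K, ∀ w ∈ Y, G.Adj u w → w ∈ K) → K = Y

/-- `C` is a finite odd connected component of `G - Z`. -/
structure IsOddPiece (Z : Set V) (C : Finset V) : Prop where
  odd : Odd C.card
  connectedOn : ConnectedOn G C
  notMem : ∀ u ∈ C, u ∉ Z
  closed : ∀ u ∈ C, ∀ w, G.Adj u w → w ∈ C ∨ w ∈ Z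

/-- Tutte's condition for the graph `G - A`. -/
def TutteOff (A : Set V) : Prop :=
  ∀ (X : Finset V) (𝒞 : Finset (Finset V)),
    (∀ C ∈ 𝒞, IsOddPiece G (↑X ∪ A) C) → 𝒞.card ≤ X.card

/-- `M` is a symmetric set of ordered pairs forming a matching of `G`. -/
structure IsPartialMatching (M : Set (V × V)) : Prop where
  adj : ∀ x y, (x, y) ∈ M → G.Adj x y
  symm : ∀ x y, (x, y) ∈ M → (y, x) ∈ M
  unique : ∀ x y z, (x, y) ∈ M → (x, z) ∈ M → y = z

/-- Some matching of `G - A` covers `F \ A`. -/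
def MatchableOff (A : Set V) (F : Finset V) : Prop :=
  ∃ M : Set (V × V), IsPartialMatching G M ∧ (∀ x y, (x, y) ∈ M → x ∉ A) ∧
    ∀ v ∈ F, v ∉ A → ∃ w, (v, w) ∈ M

variable {G}

lemma MatchableOff.mono {A : Set V} {F F' : Finset V} (h : MatchableOff G A F) (hF : F' ⊆ F) :
    MatchableOff G A F' := by
  obtain ⟨M, hM, hA, hc⟩ := h
  exact ⟨M, hM, hA, fun v hv => hc v (hF hv)⟩

lemma IsOddPiece.nonempty {Z : Set V} {C : Finset V} (h : IsOddPiece G Z C) : C.Nonempty :=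
  Finset.card_pos.1 h.odd.pos

lemma IsOddPiece.eq_of_mem {Z : Set V} {C C' : Finset V} (h : IsOddPiece G Z C)
    (h' : IsOddPiece G Z C') {v : V} (hv : v ∈ C) (hv' : v ∈ C') : C = C' := by
  classical
  have key : ∀ {C C' : Finset V}, IsOddPiece G Z C → IsOddPiece G Z C' → v ∈ C → v ∈ C' →
      C ∩ C' = C := by
    intro C C' h h' hv hv'
    refine h.connectedOn _ Finset.inter_subset_left ⟨v, Finset.mem_inter.2 ⟨hv, hv'⟩⟩ ?_
    intro u hu w hw huw
    rw [Finset.mem_inter] at hu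
    exact Finset.mem_inter.2 ⟨hw, (h'.closed u hu.2 w huw).resolve_right (h.notMem w hw)⟩
  rw [← key h h' hv hv', Finset.inter_comm, key h' h hv' hv]

/-- Pieces that avoid `Z'` and whose neighbors in `Z` all lie in `Z'` are pieces for `Z'`. -/
lemma IsOddPiece.change {Z Z' : Set V} {C : Finset V} (h : IsOddPiece G Z C)
    (hmem : ∀ u ∈ C, u ∉ Z') (hadj : ∀ u ∈ C, ∀ w ∈ Z, G.Adj u w → w ∈ Z') :
    IsOddPiece G Z' C :=
  ⟨h.odd, h.connectedOn, hmem, fun u hu w huw =>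
    (h.closed u hu w huw).imp_right fun hw => hadj u hu w hw huw⟩

/-- The necessity of Tutte's condition. -/
lemma MatchableOff.card_le {A : Set V} {F X : Finset V} {𝒞 : Finset (Finset V)}
    (h : MatchableOff G A F) (hF : ∀ C ∈ 𝒞, C ⊆ F)
    (h𝒞 : ∀ C ∈ 𝒞, IsOddPiece G (↑X ∪ A) C) : 𝒞.card ≤ X.card := by
  obtain ⟨M, hM, hA, hcov⟩ := h
  have hout : ∀ C ∈ 𝒞, ∃ x ∈ X, ∃ c ∈ C, (c, x) ∈ M := by
    intro C hC
    by_contra! hcon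
    have hpart : ∀ c ∈ C, ∃ w ∈ C, (c, w) ∈ M := by
      intro c hc
      obtain ⟨w, hw⟩ := hcov c (hF C hC hc) fun h => (h𝒞 C hC).notMem c hc (Or.inr h)
      refine ⟨w, ?_, hw⟩
      rcases (h𝒞 C hC).closed c hc w (hM.adj _ _ hw) with h | h | h
      · exact h
      · exact absurd hw (hcon w h c hc)
      · exact absurd h (hA _ _ (hM.symm _ _ hw))
    choose! g hgC hgM using hpart
    have hsum : ∑ c ∈ C, (1 : ZMod 2) = 0 := by
      refine Finset.sum_involution (fun c _ => g c) (fun _ _ => by decide) ?_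
        (fun c hc => hgC c hc) ?_
      · intro c hc _ heq
        have := hM.adj _ _ (hgM c hc)
        rw [heq] at this
        exact G.loopless.irrefl _ this
      · intro c hc
        exact hM.unique _ _ _ (hgM _ (hgC c hc)) (hM.symm _ _ (hgM c hc))
    rw [Finset.sum_const, nsmul_one, ZMod.natCast_eq_zero_iff_even] at hsum
    exact Nat.not_even_iff_odd.2 (h𝒞 C hC).odd hsum
  rcases 𝒞.eq_empty_or_nonempty with rfl | ⟨C₀, hC₀⟩
  · simp
  have : Nonempty V := ⟨(h𝒞 C₀ hC₀).nonempty.choose⟩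
  choose! x hxX c hcC hM' using hout
  refine Finset.card_le_card_of_injOn x (fun C hC => hxX C hC) ?_
  intro C hC C' hC' heq
  have h1 := hM.symm _ _ (hM' C hC)
  have h2 := hM.symm _ _ (hM' C' hC')
  have heq' : x C = x C' := heq
  rw [heq'] at h1
  have := hM.unique _ _ _ h1 h2
  exact (h𝒞 C hC).eq_of_mem (h𝒞 C' hC') (hcC C hC) (this ▸ hcC C' hC')

/-- Tutte's condition only has to be checked for connected hulls. -/
lemma TutteOff.of_connectedOn [DecidableEq V] {A : Set V}
    (h : ∀ (X : Finset V) (𝒞 : Finset (Finset V)), (∀ C ∈ 𝒞, IsOddPiece G (↑X ∪ A) C) →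
      ConnectedOn G (X ∪ 𝒞.biUnion id) → 𝒞.card ≤ X.card) : TutteOff G A := by
  have main : ∀ (n : ℕ) (X : Finset V) (𝒞 : Finset (Finset V)),
      (X ∪ 𝒞.biUnion id).card = n → (∀ C ∈ 𝒞, IsOddPiece G (↑X ∪ A) C) → 𝒞.card ≤ X.card := by
    intro n
    induction n using Nat.strong_induction_on with
    | _ n ih =>
      intro X 𝒞 hn h𝒞
      by_cases hconn : ConnectedOn G (X ∪ 𝒞.biUnion id)
      · exact h X 𝒞 h𝒞 hconn
      set Y := X ∪ 𝒞.biUnion id with hY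
      have hCY : ∀ C ∈ 𝒞, C ⊆ Y := fun C hC =>
        (Finset.subset_biUnion_of_mem id hC).trans Finset.subset_union_right
      have hXY : X ⊆ Y := Finset.subset_union_left
      simp only [ConnectedOn, not_forall] at hconn
      obtain ⟨K, hKY, hKne, hKcl, hne⟩ := hconn
      have hsplit : ∀ C ∈ 𝒞, ∀ v ∈ C, v ∈ K → C ⊆ K := by
        intro C hC v hv hvK
        have : C ∩ K = C := (h𝒞 C hC).connectedOn _ Finset.inter_subset_left
          ⟨v, Finset.mem_inter.2 ⟨hv, hvK⟩⟩ fun u hu w hw huw =>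
            Finset.mem_inter.2 ⟨hw, hKcl u (Finset.mem_inter.1 hu).2 w (hCY C hC hw) huw⟩
        exact Finset.inter_eq_left.1 this
      have h1 : (𝒞.filter (· ⊆ K)).card ≤ (X ∩ K).card := by
        refine ih _ ?_ _ _ rfl ?_
        · rw [← hn]
          refine Finset.card_lt_card (lt_of_le_of_lt (b := K) ?_ (hKY.ssubset_of_ne hne))
          refine Finset.union_subset Finset.inter_subset_right (Finset.biUnion_subset.2 ?_)
          exact fun C hC => (Finset.mem_filter.1 hC).2
        · intro C hC
          rw [Finset.mem_filter] at hC
          refine (h𝒞 C hC.1).change ?_ ?_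
          · rintro u hu (hu' | hu')
            · exact (h𝒞 C hC.1).notMem u hu (Or.inl (Finset.mem_inter.1 hu').1)
            · exact (h𝒞 C hC.1).notMem u hu (Or.inr hu')
          · rintro u hu w (hw | hw) huw
            · exact Or.inl (Finset.mem_inter.2 ⟨hw, hKcl u (hC.2 hu) w (hXY hw) huw⟩)
            · exact Or.inr hw
      have h2 : (𝒞.filter (¬ · ⊆ K)).card ≤ (X \ K).card := by
        have hdisj : ∀ C ∈ 𝒞.filter (¬ · ⊆ K), ∀ v ∈ C, v ∉ K := fun C hC v hv hvK =>
          (Finset.mem_filter.1 hC).2 (hsplit C (Finset.mem_filter.1 hC).1 v hv hvK)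
        refine ih _ ?_ _ _ rfl ?_
        · rw [← hn]
          refine Finset.card_lt_card (lt_of_le_of_lt (b := Y \ K) ?_ ?_)
          · refine Finset.union_subset (Finset.sdiff_subset_sdiff hXY subset_rfl)
              (Finset.biUnion_subset.2 fun C hC v hv => ?_)
            exact Finset.mem_sdiff.2 ⟨hCY C (Finset.mem_filter.1 hC).1 hv, hdisj C hC v hv⟩
          · exact Finset.sdiff_ssubset hKY hKne
        · intro C hC
          have hC𝒞 := (Finset.mem_filter.1 hC).1
          refine (h𝒞 C hC𝒞).change ?_ ?_
          · rintro u hu (hu' | hu')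
            · exact (h𝒞 C hC𝒞).notMem u hu (Or.inl (Finset.mem_sdiff.1 hu').1)
            · exact (h𝒞 C hC𝒞).notMem u hu (Or.inr hu')
          · rintro u hu w (hw | hw) huw
            · refine Or.inl (Finset.mem_sdiff.2 ⟨hw, fun hwK => ?_⟩)
              exact hdisj C hC u hu (hKcl w hwK u (hCY C hC𝒞 hu) huw.symm)
            · exact Or.inr hw
      have h3 := Finset.card_filter_add_card_filter_not (s := 𝒞) (· ⊆ K)
      have h4 := Finset.card_inter_add_card_sdiff X K
      omega
  exact fun X 𝒞 h𝒞 => main _ X 𝒞 rfl h𝒞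

/-- An odd piece is the vertex set of an odd component. -/
lemma IsOddPiece.exists_oddComponent {X C : Finset V} (h : IsOddPiece G ↑X C) :
    ∃ D ∈ oddComponents G (X : Set V), Subtype.val '' D.supp = (C : Set V) := by
  classical
  obtain ⟨v, hv⟩ := h.nonempty
  let H := G.induce (X : Set V)ᶜ
  let v' : ((X : Set V)ᶜ : Set V) := ⟨v, h.notMem v hv⟩
  have hsub : ∀ w : ((X : Set V)ᶜ : Set V), H.Reachable v' w → (w : V) ∈ C := by
    rintro w ⟨p⟩
    have : ∀ {a b} (p : H.Walk a b), (a : V) ∈ C → (b : V) ∈ C := by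
      intro a b p
      induction p with
      | nil => exact id
      | @cons _ b _ hab _ ih =>
        exact fun ha => ih ((h.closed _ ha _ hab).resolve_right fun hb => b.2 hb)
    exact this p hv
  have hfull : C.filter (fun w => ∃ hw : w ∈ (X : Set V)ᶜ, H.Reachable v' ⟨w, hw⟩) = C := by
    refine h.connectedOn _ (Finset.filter_subset _ _)
      ⟨v, Finset.mem_filter.2 ⟨hv, v'.2, SimpleGraph.Reachable.refl _⟩⟩ ?_
    intro u hu w hw huw
    obtain ⟨-, hu', hr⟩ := Finset.mem_filter.1 hu
    have hadj : H.Adj ⟨u, hu'⟩ ⟨w, h.notMem w hw⟩ := huw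
    exact Finset.mem_filter.2 ⟨hw, h.notMem w hw, hr.trans hadj.reachable⟩
  have himg : Subtype.val '' (H.connectedComponentMk v').supp = (C : Set V) := by
    ext w
    constructor
    · rintro ⟨w, hw, rfl⟩
      exact hsub w (SimpleGraph.ConnectedComponent.exact hw).symm
    · intro hw
      have hw' : w ∈ C := hw
      rw [← hfull] at hw'
      obtain ⟨-, hw', hr⟩ := Finset.mem_filter.1 hw'
      exact ⟨⟨w, hw'⟩, SimpleGraph.ConnectedComponent.sound hr.symm, rfl⟩
  refine ⟨H.connectedComponentMk v', ⟨?_, ?_⟩, himg⟩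
  · refine Finite.of_finite_image ?_ Subtype.val_injective.injOn
    rw [himg]
    exact C.finite_toSet
  · rw [← ncard_image_of_injective _ Subtype.val_injective, himg, ncard_coe_finset]
    exact h.odd

/-- The expanding form of Tutte's condition, in terms of odd pieces. -/
lemma expansion_of_oddComponents [DecidableEq V] {ε : ℝ} (hε : 0 < ε)
    (hTutte : ∀ X : Set V, X.Finite →
      (oddComponents G X).Finite ∧ (hullOdd G X).Finite ∧
      (oddComponents G X).ncard + ε * (hullOdd G X).ncard ≤ (X.ncard : ℝ))
    (X : Finset V) (𝒞 : Finset (Finset V)) (h𝒞 : ∀ C ∈ 𝒞, IsOddPiece G ↑X C) :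
    𝒞.card + ε * (X ∪ 𝒞.biUnion id).card ≤ (X.card : ℝ) := by
  obtain ⟨hfin, hhull, hle⟩ := hTutte X X.finite_toSet
  have hD : ∀ C ∈ 𝒞, ∃ D ∈ oddComponents G (X : Set V), Subtype.val '' D.supp = (C : Set V) :=
    fun C hC => (h𝒞 C hC).exists_oddComponent
  rcases 𝒞.eq_empty_or_nonempty with rfl | ⟨C₀, hC₀⟩
  · have h2 : X.card ≤ (hullOdd G (X : Set V)).ncard := by
      rw [← ncard_coe_finset]
      exact ncard_le_ncard subset_union_left hhull
    have h2' : (X.card : ℝ) ≤ (hullOdd G (X : Set V)).ncard := by exact_mod_cast h2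
    rw [ncard_coe_finset] at hle
    simp only [Finset.card_empty, Finset.biUnion_empty, Finset.union_empty, Nat.cast_zero]
    have := Nat.cast_nonneg (α := ℝ) (oddComponents G (X : Set V)).ncard
    nlinarith [mul_le_mul_of_nonneg_left h2' hε.le]
  have : Nonempty (G.induce (X : Set V)ᶜ).ConnectedComponent := ⟨(hD C₀ hC₀).choose⟩
  choose! D hDodd hDC using hD
  have h1 : 𝒞.card ≤ (oddComponents G (X : Set V)).ncard := by
    rw [← ncard_coe_finset]
    refine ncard_le_ncard_of_injOn D hDodd ?_ hfin
    intro C hC C' hC' heq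
    rw [← Finset.coe_inj, ← hDC C hC, ← hDC C' hC', heq]
  have h2 : (X ∪ 𝒞.biUnion id).card ≤ (hullOdd G (X : Set V)).ncard := by
    rw [← ncard_coe_finset]
    refine ncard_le_ncard ?_ hhull
    intro v hv
    rcases Finset.mem_union.1 (Finset.mem_coe.1 hv) with hv | hv
    · exact Or.inl hv
    · obtain ⟨C, hC, hvC⟩ := Finset.mem_biUnion.1 hv
      have : v ∈ Subtype.val '' (D C).supp := by
        rw [hDC C hC]
        exact hvC
      exact Or.inr (image_mono (subset_biUnion_of_mem (u := fun D => D.supp) (hDodd C hC)) this)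
  rw [ncard_coe_finset] at hle
  have h1' : (𝒞.card : ℝ) ≤ (oddComponents G (X : Set V)).ncard := by exact_mod_cast h1
  have h2' : ((X ∪ 𝒞.biUnion id).card : ℝ) ≤ (hullOdd G (X : Set V)).ncard := by
    exact_mod_cast h2
  nlinarith [mul_le_mul_of_nonneg_left h2' hε.le]

open Classical in
/-- The vertices of `Y` at distance at most `k` from `v` in `G`. -/
noncomputable def ballIn (G : SimpleGraph V) (Y : Finset V) (v : V) (k : ℕ) : Finset V :=
  Y.filter fun u => ∃ p : G.Walk v u, p.length ≤ k

lemma mem_ballIn {Y : Finset V} {v u : V} {k : ℕ} :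
    u ∈ ballIn G Y v k ↔ u ∈ Y ∧ ∃ p : G.Walk v u, p.length ≤ k := by
  simp [ballIn]

lemma ballIn_subset (Y : Finset V) (v : V) (k : ℕ) : ballIn G Y v k ⊆ Y :=
  fun _ h => (mem_ballIn.1 h).1

lemma ConnectedOn.min_le_card_ballIn {Y : Finset V} (hY : ConnectedOn G Y) {v : V}
    (hv : v ∈ Y) (k : ℕ) : min (k + 1) Y.card ≤ (ballIn G Y v k).card := by
  have hvmem : ∀ k, v ∈ ballIn G Y v k := fun k => mem_ballIn.2 ⟨hv, .nil, by simp⟩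
  induction k with
  | zero => exact (min_le_left _ _).trans (Finset.card_pos.2 ⟨v, hvmem 0⟩)
  | succ k ih =>
    have hmono : ballIn G Y v k ⊆ ballIn G Y v (k + 1) := by
      intro u hu
      obtain ⟨huY, p, hp⟩ := mem_ballIn.1 hu
      exact mem_ballIn.2 ⟨huY, p, hp.trans k.le_succ⟩
    by_cases heq : ballIn G Y v k = Y
    · rw [heq] at hmono
      exact (min_le_right _ _).trans (Finset.card_le_card hmono)
    · have hlt : ballIn G Y v k ⊂ ballIn G Y v (k + 1) := by
        refine hmono.ssubset_of_ne fun h => heq ?_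
        refine hY _ (ballIn_subset Y v k) ⟨v, hvmem k⟩ fun u hu w hw huw => ?_
        obtain ⟨-, p, hp⟩ := mem_ballIn.1 hu
        rw [h]
        refine mem_ballIn.2 ⟨hw, p.append (.cons huw .nil), ?_⟩
        rw [SimpleGraph.Walk.length_append]
        simpa using hp
      have := Finset.card_lt_card hlt
      omega

lemma ConnectedOn.exists_walk {Y : Finset V} (hY : ConnectedOn G Y) {v w : V} (hv : v ∈ Y)
    (hw : w ∈ Y) : ∃ p : G.Walk v w, p.length ≤ Y.card := by
  have h := hY.min_le_card_ballIn hv Y.card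
  rw [min_eq_right Y.card.le_succ] at h
  have := Finset.eq_of_subset_of_card_le (ballIn_subset Y v _) h
  rw [← this] at hw
  exact (mem_ballIn.1 hw).2

/-- Few pairwise distant points are close to a connected set. -/
lemma ConnectedOn.card_mul_le {Y : Finset V} (hY : ConnectedOn G Y) {r : ℕ} (hr : r ≤ Y.card)
    {T : Finset V} (hT : ∀ x ∈ T, ∃ u ∈ Y, ∃ p : G.Walk u x, p.length ≤ 2)
    (hfar : ∀ x ∈ T, ∀ y ∈ T, (∃ p : G.Walk x y, p.length ≤ 2 * r + 4) → x = y) :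
    T.card * r ≤ Y.card := by
  classical
  rcases T.eq_empty_or_nonempty with rfl | ⟨x₀, hx₀⟩
  · simp
  have : Nonempty V := ⟨x₀⟩
  choose! u huY hux using hT
  let B : V → Finset V := fun x => ballIn G Y (u x) r
  have hB : ∀ x ∈ T, r ≤ (B x).card := by
    intro x hx
    have := hY.min_le_card_ballIn (huY x hx) r
    have h2 : r ≤ min (r + 1) Y.card := le_min r.le_succ hr
    exact h2.trans this
  have hdisj : (T : Set V).PairwiseDisjoint B := by
    intro x hx y hy hxy
    refine Finset.disjoint_left.2 fun w hwx hwy => hxy (hfar x hx y hy ?_)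
    obtain ⟨-, p, hp⟩ := mem_ballIn.1 hwx
    obtain ⟨-, q, hq⟩ := mem_ballIn.1 hwy
    obtain ⟨p', hp'⟩ := hux x hx
    obtain ⟨q', hq'⟩ := hux y hy
    refine ⟨p'.reverse.append (p.append (q.reverse.append q')), ?_⟩
    simp only [SimpleGraph.Walk.length_append, SimpleGraph.Walk.length_reverse]
    omega
  calc T.card * r ≤ ∑ x ∈ T, (B x).card := by
        simpa using Finset.card_nsmul_le_sum T (fun x => (B x).card) r hB
    _ = (T.biUnion B).card := (Finset.card_biUnion hdisj).symm
    _ ≤ Y.card := Finset.card_le_card (Finset.biUnion_subset.2 fun x _ => ballIn_subset _ _ _)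

end Tutte

/-! ### Tutte's condition yields matchings covering finite sets -/

section FiniteTutte

variable {V : Type*} {G : SimpleGraph V}

/-- A vertex of the finite approximation that lies in `F`. -/
def IsInner (F W : Finset V) (k : ℕ) (a : W ⊕ Fin k) : Prop :=
  ∃ u : W, a = Sum.inl u ∧ (u : V) ∈ F

/-- The graph induced by `G` on `W` together with `k` new vertices, where the vertices outside
`F` are turned into a clique. -/
def cliqueClosure (G : SimpleGraph V) (F W : Finset V) (k : ℕ) : SimpleGraph (W ⊕ Fin k) where
  Adj a b := a ≠ b ∧ ((¬ IsInner F W k a ∧ ¬ IsInner F W k b) ∨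
    ∃ u w : W, a = Sum.inl u ∧ b = Sum.inl w ∧ G.Adj u w)
  symm := ⟨by
    rintro a b ⟨hab, h | ⟨u, w, ha, hb, h⟩⟩
    · exact ⟨hab.symm, Or.inl h.symm⟩
    · exact ⟨hab.symm, Or.inr ⟨w, u, hb, ha, h.symm⟩⟩⟩
  loopless := ⟨fun _ h => h.1 rfl⟩

lemma cliqueClosure_adj_inl {F W : Finset V} {k : ℕ} {u w : W} (h : G.Adj (u : V) w) :
    (cliqueClosure G F W k).Adj (Sum.inl u) (Sum.inl w) :=
  ⟨fun he => h.ne (congrArg Subtype.val (Sum.inl_injective he)), Or.inr ⟨u, w, rfl, rfl, h⟩⟩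

lemma exists_of_cliqueClosure_adj {F W : Finset V} {k : ℕ} {u : W} {b : W ⊕ Fin k}
    (hu : (u : V) ∈ F) (h : (cliqueClosure G F W k).Adj (Sum.inl u) b) :
    ∃ w : W, b = Sum.inl w ∧ G.Adj (u : V) w := by
  rcases h.2 with h | ⟨u', w, hu', hb, h⟩
  · exact absurd ⟨u, rfl, hu⟩ h.1
  · obtain rfl := Sum.inl_injective hu'
    exact ⟨w, hb, h⟩

lemma TutteOff.ncard_oddComponents_le {A : Set V} (h : TutteOff G A) {F W : Finset V} {k : ℕ}
    (hWA : ∀ w ∈ W, w ∉ A) (hFW : ∀ v ∈ F, ∀ w, G.Adj v w → w ∉ A → w ∈ W)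
    (u : Set (W ⊕ Fin k)) :
    ((⊤ : (cliqueClosure G F W k).Subgraph).deleteVerts u).coe.oddComponents.ncard ≤
      u.ncard + 1 := by
  classical
  set S := (⊤ : (cliqueClosure G F W k).Subgraph).deleteVerts u with hS
  have hmemS : ∀ a, a ∈ S.verts ↔ a ∉ u := by simp [hS]
  have hadjS : ∀ a b : S.verts, (cliqueClosure G F W k).Adj a b → S.coe.Adj a b := by
    intro a b hab
    have ha := (hmemS _).1 a.2
    have hb := (hmemS _).1 b.2
    simp [hS, hab, ha, hb]
  have hSadj : ∀ a b : S.verts, S.coe.Adj a b → (cliqueClosure G F W k).Adj a b :=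
    fun a b hab => S.adj_sub hab
  let 𝒪 := S.coe.oddComponents
  let 𝒪₁ := {D ∈ 𝒪 | ∀ a ∈ D.supp, IsInner F W k a}
  let 𝒪₀ := {D ∈ 𝒪 | ¬ ∀ a ∈ D.supp, IsInner F W k a}
  have hunion : 𝒪 = 𝒪₁ ∪ 𝒪₀ := by
    ext D
    simp only [𝒪₁, 𝒪₀, mem_union, mem_ofPred_eq]
    tauto
  have h₀ : 𝒪₀.ncard ≤ 1 := by
    refine (ncard_le_one (toFinite _)).2 ?_
    rintro D ⟨-, hD⟩ D' ⟨-, hD'⟩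
    push Not at hD hD'
    obtain ⟨a, haD, ha⟩ := hD
    obtain ⟨a', haD', ha'⟩ := hD'
    have h1 : S.coe.connectedComponentMk a = D := haD
    have h2 : S.coe.connectedComponentMk a' = D' := haD'
    rw [← h1, ← h2]
    by_cases hne : a = a'
    · rw [hne]
    · exact SimpleGraph.ConnectedComponent.sound
        (hadjS a a' ⟨fun he => hne (Subtype.ext he), Or.inl ⟨ha, ha'⟩⟩).reachable
  let X : Finset V := (W.attach.filter fun w => Sum.inl w ∈ u).image Subtype.val
  have hmemX : ∀ w : W, (w : V) ∈ X ↔ Sum.inl w ∈ u := by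
    intro w
    simp [X]
  have hX : X.card ≤ u.ncard := by
    refine Finset.card_image_le.trans ?_
    rw [← ncard_coe_finset]
    refine ncard_le_ncard_of_injOn Sum.inl (fun w hw => ?_) Sum.inl_injective.injOn (toFinite _)
    exact (Finset.mem_filter.1 hw).2
  have h₁ : 𝒪₁.ncard ≤ X.card := by
    rcases isEmpty_or_nonempty V with hV | ⟨⟨v₀⟩⟩
    · have : 𝒪₁ = ∅ := by
        refine eq_empty_iff_forall_notMem.2 fun D hD => ?_
        obtain ⟨a, ha⟩ := D.nonempty_supp
        obtain ⟨w, -, -⟩ := hD.2 a ha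
        exact hV.elim w
      simp [this]
    let π : S.verts → V := fun a => Sum.elim Subtype.val (fun _ => v₀) (a : W ⊕ Fin k)
    have hπ : ∀ (a : S.verts) (w : W), (a : W ⊕ Fin k) = Sum.inl w → π a = w := by
      intro a w ha
      simp [π, ha]
    have hπinj : ∀ a b : S.verts, IsInner F W k a → IsInner F W k b → π a = π b → a = b := by
      rintro a b ⟨w, ha, -⟩ ⟨w', hb, -⟩ hab
      rw [hπ a w ha, hπ b w' hb] at hab
      rw [Subtype.ext hab, ← hb] at ha
      exact Subtype.ext ha
    have hπadj : ∀ a b : S.verts, IsInner F W k a → S.coe.Adj a b → G.Adj (π a) (π b) := by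
      rintro a b ⟨w, ha, hw⟩ hab
      have := hSadj a b hab
      rw [ha] at this
      obtain ⟨w', hb, hadj⟩ := exists_of_cliqueClosure_adj hw this
      rwa [hπ a w ha, hπ b w' hb]
    let Φ : S.coe.ConnectedComponent → Finset V := fun D => (toFinite (π '' D.supp)).toFinset
    have hΦ : ∀ D v, v ∈ Φ D ↔ ∃ a ∈ D.supp, π a = v := by
      intro D v
      simp [Φ]
    have hpiece : ∀ D ∈ 𝒪₁, IsOddPiece G (↑X ∪ A) (Φ D) := by
      rintro D ⟨hodd, hin⟩
      have hstep : ∀ a b, a ∈ D.supp → S.coe.Adj a b → b ∈ D.supp := fun a b ha hab =>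
        (D.mem_supp_congr_adj hab).1 ha
      refine ⟨?_, ?_, ?_, ?_⟩
      · rw [← ncard_coe_finset, Set.Finite.coe_toFinset, InjOn.ncard_image]
        · exact hodd
        · exact fun a ha b hb hab => hπinj a b (hin a ha) (hin b hb) hab
      · intro K hK hKne hKcl
        refine Finset.Subset.antisymm hK fun v hv => ?_
        obtain ⟨x, hx⟩ := hKne
        obtain ⟨a, ha, rfl⟩ := (hΦ D x).1 (hK hx)
        obtain ⟨b, hb, rfl⟩ := (hΦ D v).1 hv
        have hreach : S.coe.Reachable a b :=
          SimpleGraph.ConnectedComponent.exact (ha.trans hb.symm)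
        obtain ⟨p⟩ := hreach
        clear hb hv
        induction p with
        | nil => exact hx
        | @cons a c b hac p ih =>
          have hc := hstep a c ha hac
          exact ih hc (hKcl _ hx _ ((hΦ D _).2 ⟨c, hc, rfl⟩) (hπadj a c (hin a ha) hac))
      · intro v hv hv'
        obtain ⟨a, ha, rfl⟩ := (hΦ D v).1 hv
        obtain ⟨w, haw, -⟩ := hin a ha
        rw [hπ a w haw] at hv'
        rcases hv' with hv' | hv'
        · exact (hmemS a).1 a.2 (haw ▸ (hmemX w).1 hv')
        · exact hWA w w.2 hv'
      · intro v hv z hvz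
        obtain ⟨a, ha, rfl⟩ := (hΦ D v).1 hv
        obtain ⟨w, haw, hw⟩ := hin a ha
        rw [hπ a w haw] at hvz
        by_cases hzA : z ∈ A
        · exact Or.inr (Or.inr hzA)
        have hzW := hFW w hw z hvz hzA
        by_cases hzu : Sum.inl ⟨z, hzW⟩ ∈ u
        · exact Or.inr (Or.inl ((hmemX ⟨z, hzW⟩).2 hzu))
        · let b : S.verts := ⟨Sum.inl ⟨z, hzW⟩, (hmemS _).2 hzu⟩
          have hab : S.coe.Adj a b := by
            refine hadjS a b ?_
            rw [haw]
            exact cliqueClosure_adj_inl hvz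
          exact Or.inl ((hΦ D z).2 ⟨b, hstep a b ha hab, hπ b ⟨z, hzW⟩ rfl⟩)
    have hinj : InjOn Φ 𝒪₁ := by
      intro D hD D' hD' heq
      obtain ⟨a, ha⟩ := D.nonempty_supp
      have : π a ∈ Φ D' := by
        rw [← heq]
        exact (hΦ D _).2 ⟨a, ha, rfl⟩
      obtain ⟨b, hb, hab⟩ := (hΦ D' _).1 this
      have := hπinj b a (hD'.2 b hb) (hD.2 a ha) hab
      rw [this] at hb
      exact ha.symm.trans hb
    have := h X ((toFinite 𝒪₁).toFinset.image Φ) (by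
      intro C hC
      obtain ⟨D, hD, rfl⟩ := Finset.mem_image.1 hC
      exact hpiece D ((toFinite 𝒪₁).mem_toFinset.1 hD))
    rwa [Finset.card_image_of_injOn (by rwa [Set.Finite.coe_toFinset]),
      ← ncard_eq_toFinset_card 𝒪₁ (toFinite 𝒪₁)] at this
  change 𝒪.ncard ≤ _
  rw [hunion]
  exact (ncard_union_le _ _).trans (by omega)

/-- In a locally finite graph satisfying Tutte's condition, every finite set is covered by
a matching. -/
theorem TutteOff.matchableOff (hLF : ∀ v : V, (G.neighborSet v).Finite) {A : Set V}
    (h : TutteOff G A) (F : Finset V) : MatchableOff G A F := by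
  classical
  let F' := F.filter (· ∉ A)
  let W := (F' ∪ F'.biUnion fun v => (hLF v).toFinset).filter (· ∉ A)
  have hF'W : ∀ v ∈ F', v ∈ W := fun v hv =>
    Finset.mem_filter.2 ⟨Finset.mem_union_left _ hv, (Finset.mem_filter.1 hv).2⟩
  have hWA : ∀ w ∈ W, w ∉ A := fun w hw => (Finset.mem_filter.1 hw).2
  have hFW : ∀ v ∈ F', ∀ w, G.Adj v w → w ∉ A → w ∈ W := fun v hv w hvw hwA =>
    Finset.mem_filter.2 ⟨Finset.mem_union_right _
      (Finset.mem_biUnion.2 ⟨v, hv, (hLF v).mem_toFinset.2 hvw⟩), hwA⟩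
  have hviol : ∀ u, ¬ (cliqueClosure G F' W (W.card % 2)).IsTutteViolator u := by
    intro u hu
    have hle := h.ncard_oddComponents_le hWA hFW u
    rw [SimpleGraph.IsTutteViolator] at hu
    have hodd := SimpleGraph.odd_ncard_oddComponents
      ((⊤ : (cliqueClosure G F' W (W.card % 2)).Subgraph).deleteVerts u).coe
    have hcard : Nat.card ((⊤ : (cliqueClosure G F' W (W.card % 2)).Subgraph).deleteVerts u).verts
        + u.ncard = W.card + W.card % 2 := by
      have h1 := ncard_add_ncard_compl u
      have h2 : ((⊤ : (cliqueClosure G F' W (W.card % 2)).Subgraph).deleteVerts u).verts = uᶜ := by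
        ext a
        simp
      rw [h2, Nat.card_coe_set_eq, add_comm, h1]
      simp
    have heq := le_antisymm hle hu
    rw [heq, Nat.odd_iff, Nat.odd_iff] at hodd
    omega
  obtain ⟨M, hM, hMspan⟩ := SimpleGraph.tutte.2 hviol
  have hMuniq : ∀ a b c, M.Adj a b → M.Adj a c → b = c := fun a b c hb hc =>
    (hM (hMspan a)).unique hb hc
  refine ⟨{p | ∃ a b : W, M.Adj (Sum.inl a) (Sum.inl b) ∧ G.Adj (a : V) b ∧ p = (↑a, ↑b)},
    ⟨?_, ?_, ?_⟩, ?_, ?_⟩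
  · rintro x y ⟨a, b, -, hab, heq⟩
    obtain ⟨rfl, rfl⟩ := Prod.mk.inj heq
    exact hab
  · rintro x y ⟨a, b, hM, hab, heq⟩
    obtain ⟨rfl, rfl⟩ := Prod.mk.inj heq
    exact ⟨b, a, hM.symm, hab.symm, rfl⟩
  · rintro x y z ⟨a, b, hM, -, heq⟩ ⟨a', c, hM', -, heq'⟩
    obtain ⟨rfl, rfl⟩ := Prod.mk.inj heq
    obtain ⟨haa, rfl⟩ := Prod.mk.inj heq'
    obtain rfl := Subtype.ext haa
    rw [Sum.inl_injective (hMuniq _ _ _ hM hM')]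
  · rintro x y ⟨a, b, -, -, heq⟩
    obtain ⟨rfl, rfl⟩ := Prod.mk.inj heq
    exact hWA a a.2
  · intro v hv hvA
    have hvF' : v ∈ F' := Finset.mem_filter.2 ⟨hv, hvA⟩
    obtain ⟨b, hb, -⟩ := hM (hMspan (Sum.inl ⟨v, hF'W v hvF'⟩))
    obtain ⟨w, rfl, hadj⟩ := exists_of_cliqueClosure_adj hvF' hb.adj_sub
    exact ⟨w, _, w, hb, hadj, rfl⟩

/-- If every finite set is coverable after removing `A`, then any vertex can be removed together
with a suitable neighbor. -/
lemma exists_adj_matchableOff (hLF : ∀ v : V, (G.neighborSet v).Finite) {A : Set V}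
    (h : ∀ F, MatchableOff G A F) {x : V} (hx : x ∉ A) :
    ∃ y, G.Adj x y ∧ y ∉ A ∧ ∀ F, MatchableOff G (A ∪ {x, y}) F := by
  classical
  by_contra! hcon
  have hbad : ∀ y, ∃ F, G.Adj x y → y ∉ A → ¬ MatchableOff G (A ∪ {x, y}) F := by
    intro y
    by_cases hy : G.Adj x y ∧ y ∉ A
    · obtain ⟨F, hF⟩ := hcon y hy.1 hy.2
      exact ⟨F, fun _ _ => hF⟩
    · exact ⟨∅, fun h1 h2 => absurd ⟨h1, h2⟩ hy⟩
  choose F hF using hbad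
  obtain ⟨M, hM, hMA, hcov⟩ := h (insert x ((hLF x).toFinset.biUnion F))
  obtain ⟨y, hxy⟩ := hcov x (Finset.mem_insert_self _ _) hx
  have hadj := hM.adj x y hxy
  refine hF y hadj (hMA y x (hM.symm x y hxy)) ⟨M \ {(x, y), (y, x)}, ⟨?_, ?_, ?_⟩, ?_, ?_⟩
  · exact fun a b hab => hM.adj a b hab.1
  · rintro a b ⟨hab, hne⟩
    refine ⟨hM.symm a b hab, fun h => hne ?_⟩
    simp only [mem_insert_iff, mem_singleton_iff, Prod.mk.injEq] at h ⊢
    tauto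
  · exact fun a b c hab hac => hM.unique a b c hab.1 hac.1
  · rintro a b ⟨hab, hne⟩ (ha | rfl | ha)
    · exact hMA a b hab ha
    · exact hne (by simp [hM.unique _ _ _ hab hxy])
    · obtain rfl : a = y := ha
      exact hne (by simp [hM.unique _ _ _ hab (hM.symm _ _ hxy)])
  · intro v hv hvA
    simp only [mem_union, mem_insert_iff, mem_singleton_iff, not_or] at hvA
    obtain ⟨w, hw⟩ := hcov v (Finset.mem_insert_of_mem
      (Finset.mem_biUnion.2 ⟨y, (hLF x).mem_toFinset.2 hadj, hv⟩)) hvA.1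
    refine ⟨w, hw, ?_⟩
    simp only [mem_insert_iff, mem_singleton_iff, Prod.mk.injEq]
    tauto

end FiniteTutte

/-! ### Borel enumerations of neighbors and of connected components -/

section Enumeration

open MeasureTheory

variable {V : Type*} {G : SimpleGraph V}

/-- Apply the functions `e j`, for `j` in the list `l`, one after the other. -/
def follow (e : ℕ → V → V) : List ℕ → V → V
  | [], x => x
  | j :: l, x => follow e l (e j x)

lemma measurable_follow [MeasurableSpace V] {e : ℕ → V → V} (he : ∀ j, Measurable (e j))
    (l : List ℕ) : Measurable (follow e l) := by
  induction l with
  | nil => exact measurable_id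
  | cons j l ih => exact ih.comp (he j)

/-- The functions `e j` enumerate the neighbors of every vertex. -/
structure EnumeratesNeighbors (G : SimpleGraph V) (e : ℕ → V → V) : Prop where
  eq_or_adj : ∀ j x, e j x = x ∨ G.Adj x (e j x)
  exists_eq : ∀ x y, G.Adj x y → ∃ j, e j x = y

lemma EnumeratesNeighbors.exists_walk_iff {e : ℕ → V → V} (he : EnumeratesNeighbors G e) (k : ℕ)
    (x y : V) : (∃ p : G.Walk x y, p.length ≤ k) ↔ ∃ l : List ℕ, l.length ≤ k ∧ follow e l x = y := by
  constructor
  · rintro ⟨p, hp⟩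
    suffices ∃ l : List ℕ, l.length = p.length ∧ follow e l x = y by
      obtain ⟨l, hl, h⟩ := this
      exact ⟨l, hl.trans_le hp, h⟩
    clear hp
    induction p with
    | nil => exact ⟨[], rfl, rfl⟩
    | @cons a b c hab p ih =>
      obtain ⟨j, rfl⟩ := he.exists_eq a b hab
      obtain ⟨l, hl, h⟩ := ih
      exact ⟨j :: l, by simp [hl], h⟩
  · rintro ⟨l, hl, h⟩
    suffices ∀ x, follow e l x = y → ∃ p : G.Walk x y, p.length ≤ l.length by
      obtain ⟨p, hp⟩ := this x h
      exact ⟨p, hp.trans hl⟩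
    clear hl h
    induction l with
    | nil =>
      rintro x rfl
      exact ⟨.nil, by simp [follow]⟩
    | cons j l ih =>
      intro x h
      obtain ⟨p, hp⟩ := ih (e j x) h
      rcases he.eq_or_adj j x with hx | hx
      · exact ⟨p.copy hx rfl, by simpa using hp.trans (Nat.le_succ _)⟩
      · exact ⟨.cons hx p, by simpa using hp⟩

lemma EnumeratesNeighbors.reachable_iff {e : ℕ → V → V} (he : EnumeratesNeighbors G e)
    (x y : V) : G.Reachable x y ↔ ∃ l : List ℕ, follow e l x = y := by
  constructor
  · rintro ⟨p⟩
    obtain ⟨l, -, h⟩ := (he.exists_walk_iff p.length x y).1 ⟨p, le_rfl⟩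
    exact ⟨l, h⟩
  · rintro ⟨l, h⟩
    obtain ⟨p, -⟩ := (he.exists_walk_iff l.length x y).2 ⟨l, le_rfl, h⟩
    exact ⟨p⟩

lemma finite_setOf_exists_walk (hLF : ∀ v : V, (G.neighborSet v).Finite) (k : ℕ) (x : V) :
    {y | ∃ p : G.Walk x y, p.length ≤ k}.Finite := by
  induction k generalizing x with
  | zero =>
    refine (finite_singleton x).subset ?_
    rintro y ⟨p, hp⟩
    exact (SimpleGraph.Walk.eq_of_length_eq_zero (Nat.le_zero.1 hp)).symm
  | succ k ih =>
    refine ((finite_singleton x).union ((hLF x).biUnion fun z _ => ih z)).subset ?_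
    rintro y ⟨p, hp⟩
    cases p with
    | nil => exact Or.inl rfl
    | @cons _ z _ hxz p =>
      exact Or.inr (mem_biUnion hxz ⟨p, by simpa using hp⟩)

open Classical in
lemma matchableOff_image_iff {ι : Type*} {x : V} (g : ι → V → V) {A : Set V}
    (hg : ∀ i w, G.Adj (g i x) w → ∃ j, g j x = w) (s : Finset ι) :
    MatchableOff G A (s.image fun i => g i x) ↔
      ∃ m : Finset (ι × ι), (∀ p ∈ m, p.swap ∈ m) ∧
        (∀ p ∈ m, G.Adj (g p.1 x) (g p.2 x) ∧ g p.1 x ∉ A) ∧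
        (∀ p ∈ m, ∀ q ∈ m, g p.1 x = g q.1 x → g p.2 x = g q.2 x) ∧
        ∀ i ∈ s, g i x ∉ A → ∃ p ∈ m, g p.1 x = g i x := by
  constructor
  · rintro ⟨M, hM, hMA, hcov⟩
    have hpart : ∀ i ∈ s, g i x ∉ A → ∃ j, (g i x, g j x) ∈ M := by
      intro i hi hiA
      obtain ⟨w, hw⟩ := hcov _ (Finset.mem_image_of_mem _ hi) hiA
      obtain ⟨j, rfl⟩ := hg i w (hM.adj _ _ hw)
      exact ⟨j, hw⟩
    rcases s.eq_empty_or_nonempty with rfl | ⟨i₀, -⟩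
    · exact ⟨∅, by simp⟩
    have : Nonempty ι := ⟨i₀⟩
    choose! t ht using hpart
    let m₀ : Finset (ι × ι) := (s.filter fun i => g i x ∉ A).image fun i => (i, t i)
    let m := m₀ ∪ m₀.image Prod.swap
    have hmM : ∀ p ∈ m, (g p.1 x, g p.2 x) ∈ M := by
      have h₀ : ∀ p ∈ m₀, (g p.1 x, g p.2 x) ∈ M := by
        intro p hp
        obtain ⟨i, hi, rfl⟩ := Finset.mem_image.1 hp
        rw [Finset.mem_filter] at hi
        exact ht i hi.1 hi.2
      intro p hp
      rcases Finset.mem_union.1 hp with hp | hp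
      · exact h₀ p hp
      · obtain ⟨q, hq, rfl⟩ := Finset.mem_image.1 hp
        exact hM.symm _ _ (h₀ q hq)
    refine ⟨m, fun p hp => ?_, fun p hp => ⟨hM.adj _ _ (hmM p hp), hMA _ _ (hmM p hp)⟩,
      fun p hp q hq hpq => ?_, fun i hi hiA => ⟨(i, t i), ?_, rfl⟩⟩
    · rcases Finset.mem_union.1 hp with hp | hp
      · exact Finset.mem_union_right _ (Finset.mem_image_of_mem _ hp)
      · obtain ⟨q, hq, rfl⟩ := Finset.mem_image.1 hp
        rw [Prod.swap_swap]
        exact Finset.mem_union_left _ hq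
    · have := hmM q hq
      rw [← hpq] at this
      exact hM.unique _ _ _ (hmM p hp) this
    · exact Finset.mem_union_left _ (Finset.mem_image_of_mem _ (Finset.mem_filter.2 ⟨hi, hiA⟩))
  · rintro ⟨m, hswap, hadj, huniq, hcov⟩
    refine ⟨{q | ∃ p ∈ m, q = (g p.1 x, g p.2 x)}, ⟨?_, ?_, ?_⟩, ?_, ?_⟩
    · rintro a b ⟨p, hp, h⟩
      obtain ⟨rfl, rfl⟩ := Prod.mk.inj h
      exact (hadj p hp).1
    · rintro a b ⟨p, hp, h⟩
      obtain ⟨rfl, rfl⟩ := Prod.mk.inj h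
      exact ⟨p.swap, hswap p hp, rfl⟩
    · rintro a b c ⟨p, hp, h⟩ ⟨q, hq, h'⟩
      obtain ⟨rfl, rfl⟩ := Prod.mk.inj h
      obtain ⟨h1, rfl⟩ := Prod.mk.inj h'
      exact huniq p hp q hq h1
    · rintro a b ⟨p, hp, h⟩
      obtain ⟨rfl, rfl⟩ := Prod.mk.inj h
      exact (hadj p hp).2
    · intro v hv hvA
      obtain ⟨i, hi, rfl⟩ := Finset.mem_image.1 hv
      obtain ⟨p, hp, h⟩ := hcov i hi hvA
      exact ⟨g p.2 x, p, hp, by rw [h]⟩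

variable [TopologicalSpace V] [PolishSpace V] [MeasurableSpace V] [BorelSpace V]

theorem exists_enumeratesNeighbors (hG : MeasurableSet {p : V × V | G.Adj p.1 p.2})
    (hLF : ∀ v : V, (G.neighborSet v).Finite) :
    ∃ e : ℕ → V → V, (∀ j, Measurable (e j)) ∧ EnumeratesNeighbors G e := by
  classical
  let D : Set (V × V) := Prod.snd '' {q : V × V × V | G.Adj q.1 q.2.1 ∧ G.Adj q.1 q.2.2}
  have hD : AnalyticSet D := by
    refine AnalyticSet.image_of_continuous (MeasurableSet.analyticSet ?_) continuous_snd
    exact ((measurable_fst.prodMk (measurable_fst.comp measurable_snd)) hG).inter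
      ((measurable_fst.prodMk (measurable_snd.comp measurable_snd)) hG)
  have hDmem : ∀ y y', (y, y') ∈ D ↔ ∃ z, G.Adj z y ∧ G.Adj z y' := by
    intro y y'
    constructor
    · rintro ⟨⟨z, q⟩, h, rfl⟩
      exact ⟨z, h⟩
    · rintro ⟨z, h⟩
      exact ⟨(z, y, y'), h, rfl⟩
  have hDfin : ∀ y, {y' | (y, y') ∈ D}.Finite := by
    intro y
    refine ((hLF y).biUnion fun z _ => hLF z).subset fun y' hy' => ?_
    obtain ⟨z, hzy, hzy'⟩ := (hDmem y y').1 hy'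
    exact mem_biUnion hzy.symm hzy'
  obtain ⟨c, hc, hcD⟩ := exists_measurable_coloring hD hDfin
  have hcol : ∀ x y y', G.Adj x y → G.Adj x y' → c y = c y' → y = y' := by
    intro x y y' hy hy' h
    by_contra hne
    exact hcD y y' ((hDmem y y').2 ⟨x, hy, hy'⟩) hne h
  let e : ℕ → V → V := fun j x => if h : ∃ y, G.Adj x y ∧ c y = j then h.choose else x
  have he : ∀ j x y, G.Adj x y → c y = j → e j x = y := by
    intro j x y hxy hy
    have h : ∃ y, G.Adj x y ∧ c y = j := ⟨y, hxy, hy⟩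
    simp only [e, dif_pos h]
    exact hcol x _ _ h.choose_spec.1 hxy (h.choose_spec.2.trans hy.symm)
  have he' : ∀ j x, (¬ ∃ y, G.Adj x y ∧ c y = j) → e j x = x := fun j x h => dif_neg h
  refine ⟨e, fun j => ?_, ⟨fun j x => ?_, fun x y hxy => ⟨c y, he _ x y hxy rfl⟩⟩⟩
  · have himg : ∀ B : Set V, MeasurableSet B →
        MeasurableSet {x | ∃ y, (G.Adj x y ∧ c y = j) ∧ y ∈ B} := by
      intro B hB
      have : MeasurableSet {p : V × V | (G.Adj p.1 p.2 ∧ c p.2 = j) ∧ p.2 ∈ B} :=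
        (hG.inter (measurableSet_eq_fun (hc.comp measurable_snd) measurable_const)).inter
          (measurable_snd hB)
      convert this.image_of_measurable_injOn measurable_fst ?_ using 1
      · ext x
        simp
      · rintro ⟨x, y⟩ ⟨⟨hxy, hy⟩, -⟩ ⟨x', y'⟩ ⟨⟨hxy', hy'⟩, -⟩ (rfl : x = x')
        rw [hcol x y y' hxy hxy' (hy.trans hy'.symm)]
    intro B hB
    have hpre : e j ⁻¹' B = {x | ∃ y, (G.Adj x y ∧ c y = j) ∧ y ∈ B} ∪
        (B \ {x | ∃ y, (G.Adj x y ∧ c y = j) ∧ y ∈ univ}) := by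
      ext x
      by_cases h : ∃ y, G.Adj x y ∧ c y = j
      · obtain ⟨y, hxy, hy⟩ := h
        constructor
        · intro hx
          exact Or.inl ⟨y, ⟨hxy, hy⟩, he j x y hxy hy ▸ hx⟩
        · rintro (⟨z, ⟨hxz, hz⟩, hzB⟩ | ⟨-, hx⟩)
          · rw [mem_preimage, he j x z hxz hz]
            exact hzB
          · exact absurd ⟨y, ⟨hxy, hy⟩, trivial⟩ hx
      · rw [mem_preimage, he' j x h]
        constructor
        · exact fun hx => Or.inr ⟨hx, fun ⟨y, hy, _⟩ => h ⟨y, hy⟩⟩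
        · rintro (⟨y, hy, -⟩ | ⟨hx, -⟩)
          · exact absurd ⟨y, hy⟩ h
          · exact hx
    rw [hpre]
    exact (himg B hB).union (hB.diff (himg univ MeasurableSet.univ))
  · by_cases h : ∃ y, G.Adj x y ∧ c y = j
    · obtain ⟨y, hxy, hy⟩ := h
      rw [he j x y hxy hy]
      exact Or.inr hxy
    · exact Or.inl (he' j x h)

/-- There is a countable Borel coloring for which distinct vertices of the same color are
at distance greater than `k`. -/
theorem exists_distance_coloring (hLF : ∀ v : V, (G.neighborSet v).Finite) {e : ℕ → V → V}
    (hem : ∀ j, Measurable (e j)) (he : EnumeratesNeighbors G e) (k : ℕ) :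
    ∃ c : V → ℕ, Measurable c ∧
      ∀ x y, (∃ p : G.Walk x y, p.length ≤ k) → c x = c y → x = y := by
  have hD : MeasurableSet {q : V × V | ∃ l : List ℕ, l.length ≤ k ∧ follow e l q.1 = q.2} := by
    simp only [ofPred_exists, ofPred_and]
    exact MeasurableSet.iUnion fun l => (MeasurableSet.const _).inter
      (measurableSet_eq_fun ((measurable_follow hem l).comp measurable_fst) measurable_snd)
  obtain ⟨c, hc, hcD⟩ := exists_measurable_coloring hD.analyticSet (fun x => by
    simpa only [mem_ofPred_eq, ← he.exists_walk_iff] using finite_setOf_exists_walk hLF k x)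
  refine ⟨c, hc, fun x y hxy hcxy => ?_⟩
  by_contra hne
  exact hcD x y ((he.exists_walk_iff k x y).1 hxy) hne hcxy

open Classical in
lemma measurableSet_matchableOff {ι : Type*} [Countable ι]
    (hG : MeasurableSet {p : V × V | G.Adj p.1 p.2}) {g : ι → V → V}
    (hgm : ∀ i, Measurable (g i)) (hg : ∀ x i w, G.Adj (g i x) w → ∃ j, g j x = w)
    {A : V → Set V} (hA : ∀ i, MeasurableSet {x | g i x ∈ A x}) (s : Finset ι) :
    MeasurableSet {x | MatchableOff G (A x) (s.image fun i => g i x)} := by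
  simp only [matchableOff_image_iff g (hg _)]
  have hAi : ∀ i, Measurable fun x => g i x ∉ A x := fun i =>
    measurableSet_setOfPred.1 (hA i).compl
  have hadj : ∀ i j, Measurable fun x => G.Adj (g i x) (g j x) := fun i j =>
    measurableSet_setOfPred.1 (((hgm i).prodMk (hgm j)) hG)
  have heq : ∀ i j, Measurable fun x => g i x = g j x := fun i j =>
    measurableSet_setOfPred.1 (measurableSet_eq_fun (hgm i) (hgm j))
  refine measurableSet_setOfPred.2 (Measurable.exists fun m => measurable_const.and
    (((Measurable.forall fun p => measurable_const.imp ((hadj _ _).and (hAi _)))).and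
    ((Measurable.forall fun p => measurable_const.imp (Measurable.forall fun q =>
      measurable_const.imp ((heq _ _).imp (heq _ _)))).and
    (Measurable.forall fun i => measurable_const.imp ((hAi i).imp
      (Measurable.exists fun p => measurable_const.and (heq _ _)))))))

end Enumeration

/-! ### Extending a sparse Borel matching -/

section Extension

open MeasureTheory

variable {V : Type*} {G : SimpleGraph V}

/-- The vertices covered by `M`. -/
def covered (M : Set (V × V)) : Set V :=
  {x | ∃ y, (x, y) ∈ M}

/-- Every connected set of size `s ≥ m` has at most `c * s` neighbors in `D`. -/
def SparseWith (G : SimpleGraph V) (D : Set V) (c : ℝ) (m : ℕ) : Prop :=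
  ∀ Y : Finset V, ConnectedOn G Y → m ≤ Y.card →
    ({a ∈ D | ∃ u ∈ Y, G.Adj u a}.ncard : ℝ) ≤ c * Y.card

/-- The matching `M` together with the edges `(x, f x)` for `x ∈ B`. -/
def addEdges (M : Set (V × V)) (B : Set V) (f : V → V) : Set (V × V) :=
  M ∪ ({p | p.1 ∈ B ∧ f p.1 = p.2} ∪ {p | p.2 ∈ B ∧ f p.2 = p.1})

lemma mem_addEdges {M : Set (V × V)} {B : Set V} {f : V → V} {x y : V} :
    (x, y) ∈ addEdges M B f ↔ (x, y) ∈ M ∨ (x ∈ B ∧ f x = y) ∨ (y ∈ B ∧ f y = x) :=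
  Iff.rfl

lemma mem_covered_addEdges {M : Set (V × V)} {B : Set V} {f : V → V} {a : V} :
    a ∈ covered (addEdges M B f) ↔ a ∈ covered M ∨ ∃ x ∈ B, a = x ∨ a = f x := by
  constructor
  · rintro ⟨b, hb | ⟨ha, -⟩ | ⟨hb, h⟩⟩
    · exact Or.inl ⟨b, hb⟩
    · exact Or.inr ⟨a, ha, Or.inl rfl⟩
    · exact Or.inr ⟨b, hb, Or.inr h.symm⟩
  · rintro (⟨b, hb⟩ | ⟨x, hx, rfl | rfl⟩)
    · exact ⟨b, Or.inl hb⟩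
    · exact ⟨f a, Or.inr (Or.inl ⟨hx, rfl⟩)⟩
    · exact ⟨x, Or.inr (Or.inr ⟨hx, rfl⟩)⟩

lemma IsPartialMatching.addEdges {M : Set (V × V)} (hM : IsPartialMatching G M) {B : Set V}
    {f : V → V} (hB : ∀ x ∈ B, x ∉ covered M ∧ f x ∉ covered M ∧ G.Adj x (f x))
    (hfar : ∀ x ∈ B, ∀ y ∈ B, (∃ p : G.Walk x y, p.length ≤ 2) → x = y) :
    IsPartialMatching G (addEdges M B f) := by
  have hadj : ∀ x y, (x, y) ∈ _root_.addEdges M B f → G.Adj x y := by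
    simp only [mem_addEdges]
    rintro x y (h | ⟨hx, rfl⟩ | ⟨hy, rfl⟩)
    · exact hM.adj _ _ h
    · exact (hB x hx).2.2
    · exact (hB y hy).2.2.symm
  have hne : ∀ x ∈ B, f x ∉ B := fun x hx hfx => by
    have h := (hB x hx).2.2
    exact h.ne (hfar x hx _ hfx ⟨.cons h .nil, by simp⟩)
  refine ⟨hadj, ?_, ?_⟩
  · rintro x y (h | h | h)
    · exact Or.inl (hM.symm _ _ h)
    · exact Or.inr (Or.inr h)
    · exact Or.inr (Or.inl h)
  · simp only [mem_addEdges]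
    rintro x y z (h | ⟨hx, rfl⟩ | ⟨hy, rfl⟩) (h' | ⟨hx', rfl⟩ | ⟨hz, h'⟩)
    · exact hM.unique _ _ _ h h'
    · exact absurd ⟨y, h⟩ (hB x hx').1
    · exact absurd ⟨y, h⟩ (h' ▸ (hB z hz).2.1)
    · exact absurd ⟨z, h'⟩ (hB x hx).1
    · rfl
    · exact absurd hx (h' ▸ hne z hz)
    · exact absurd ⟨z, h'⟩ (hB y hy).2.1
    · exact absurd hx' (hne y hy)
    · have h1 := (hB y hy).2.2
      have h2 := (hB z hz).2.2
      rw [h'] at h2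
      exact hfar y hy z hz ⟨.cons h1 (.cons h2.symm .nil), by simp⟩

section Far

variable {D D' B : Set V} {f : V → V} {r : ℕ}

lemma exists_near_of_adj (hadj : ∀ x ∈ B, G.Adj x (f x))
    (hD' : ∀ a, a ∈ D' ↔ a ∈ D ∨ ∃ x ∈ B, a = x ∨ a = f x) {u a : V} (hua : G.Adj u a)
    (ha : a ∈ D') : a ∈ D ∨
      ∃ x ∈ B, (∃ p : G.Walk u x, p.length ≤ 2) ∧ (a = x ∨ a = f x) := by
  refine ((hD' a).1 ha).imp_right ?_
  rintro ⟨x, hx, rfl | rfl⟩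
  · exact ⟨a, hx, ⟨.cons hua .nil, by simp⟩, Or.inl rfl⟩
  · exact ⟨x, hx, ⟨.cons hua (.cons (hadj x hx).symm .nil), by simp⟩, Or.inr rfl⟩

lemma SparseWith.add (hLF : ∀ v : V, (G.neighborSet v).Finite) {c : ℝ} {m : ℕ}
    (h : SparseWith G D c m) (hmr : m ≤ r) (hr : 0 < r) (hadj : ∀ x ∈ B, G.Adj x (f x))
    (hD' : ∀ a, a ∈ D' ↔ a ∈ D ∨ ∃ x ∈ B, a = x ∨ a = f x)
    (hfar : ∀ x ∈ B, ∀ y ∈ B, (∃ p : G.Walk x y, p.length ≤ 2 * r + 4) → x = y) :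
    SparseWith G D' (c + 2 / r) r := by
  classical
  intro Y hY hrY
  have hTfin : {x ∈ B | ∃ u ∈ Y, ∃ p : G.Walk u x, p.length ≤ 2}.Finite := by
    refine (Y.finite_toSet.biUnion fun u _ => finite_setOf_exists_walk hLF 2 u).subset ?_
    rintro x ⟨-, u, hu, hp⟩
    exact mem_biUnion hu hp
  obtain ⟨T, hT⟩ := hTfin.exists_finset
  have hcard := hY.card_mul_le hrY (T := T) (fun x hx => ((hT x).1 hx).2)
    fun x hx y hy => hfar x ((hT x).1 hx).1 y ((hT y).1 hy).1
  have hDfin : {a ∈ D | ∃ u ∈ Y, G.Adj u a}.Finite := by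
    refine (Y.finite_toSet.biUnion fun u _ => hLF u).subset ?_
    rintro a ⟨-, u, hu, hua⟩
    exact mem_biUnion hu hua
  have hsub : {a ∈ D' | ∃ u ∈ Y, G.Adj u a} ⊆
      {a ∈ D | ∃ u ∈ Y, G.Adj u a} ∪ ↑(T ∪ T.image f) := by
    rintro a ⟨ha, u, hu, hua⟩
    rcases exists_near_of_adj hadj hD' hua ha with ha | ⟨x, hx, hp, hax⟩
    · exact Or.inl ⟨ha, u, hu, hua⟩
    · have hxT : x ∈ T := (hT x).2 ⟨hx, u, hu, hp⟩
      right
      rcases hax with rfl | rfl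
      · exact Finset.mem_union_left _ hxT
      · exact Finset.mem_union_right _ (Finset.mem_image_of_mem _ hxT)
  have hle := (ncard_le_ncard hsub (hDfin.union (Finset.finite_toSet _))).trans
    (ncard_union_le _ _)
  rw [ncard_coe_finset] at hle
  have hle' : ({a ∈ D' | ∃ u ∈ Y, G.Adj u a}.ncard : ℝ) ≤
      {a ∈ D | ∃ u ∈ Y, G.Adj u a}.ncard + 2 * T.card := by
    have := (Finset.card_union_le T (T.image f)).trans
      (Nat.add_le_add_left Finset.card_image_le _)
    exact_mod_cast hle.trans (by omega)
  have hr' : (0 : ℝ) < r := by exact_mod_cast hr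
  have hT' : (T.card : ℝ) ≤ Y.card / r := by
    rw [le_div_iff₀ hr']
    exact_mod_cast hcard
  calc _ ≤ _ := hle'
    _ ≤ c * Y.card + 2 * (Y.card / r) := by gcongr; exact h Y hY (hmr.trans hrY)
    _ = (c + 2 / r) * Y.card := by ring

lemma SparseWith.tutteOff (hLF : ∀ v : V, (G.neighborSet v).Finite) {ε c : ℝ}
    (hexp : ∀ (X : Finset V) (𝒞 : Finset (Finset V)) (Y : Finset V),
      (∀ C ∈ 𝒞, IsOddPiece G ↑X C) → (∀ y ∈ Y, y ∈ X ∨ ∃ C ∈ 𝒞, y ∈ C) →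
        𝒞.card + ε * Y.card ≤ (X.card : ℝ))
    (h : SparseWith G D' c r) (hc : c ≤ ε) (hadj : ∀ x ∈ B, G.Adj x (f x))
    (hD' : ∀ a, a ∈ D' ↔ a ∈ D ∨ ∃ x ∈ B, a = x ∨ a = f x)
    (hfar : ∀ x ∈ B, ∀ y ∈ B, (∃ p : G.Walk x y, p.length ≤ 2 * r + 4) → x = y)
    (hD : ∀ F, MatchableOff G D F)
    (hB : ∀ x ∈ B, ∀ F : Finset V, (∀ v ∈ F, G.Reachable x v) →
      MatchableOff G (D ∪ {x, f x}) F) : TutteOff G D' := by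
  classical
  refine TutteOff.of_connectedOn fun X 𝒞 h𝒞 hconn => ?_
  set Y := X ∪ 𝒞.biUnion id with hY
  have hCY : ∀ C ∈ 𝒞, C ⊆ Y := fun C hC =>
    (Finset.subset_biUnion_of_mem id hC).trans Finset.subset_union_right
  rcases le_or_gt r Y.card with hr | hr
  · have hfin : {a ∈ D' | ∃ u ∈ Y, G.Adj u a}.Finite := by
      refine (Y.finite_toSet.biUnion fun u _ => hLF u).subset ?_
      rintro a ⟨-, u, hu, hua⟩
      exact mem_biUnion hu hua
    have hN := h Y hconn hr
    obtain ⟨N, hNmem⟩ := hfin.exists_finset_coe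
    rw [← hNmem, ncard_coe_finset] at hN
    have hle := hexp (X ∪ N) 𝒞 Y (fun C hC => (h𝒞 C hC).change ?_ ?_) ?_
    · have hXN : ((X ∪ N).card : ℝ) ≤ X.card + N.card := by
        exact_mod_cast Finset.card_union_le X N
      have : c * Y.card ≤ ε * Y.card := by gcongr
      exact_mod_cast (by linarith : (𝒞.card : ℝ) ≤ X.card)
    · intro u hu huXN
      rcases Finset.mem_union.1 huXN with hu' | hu'
      · exact (h𝒞 C hC).notMem u hu (Or.inl hu')
      · have : u ∈ (N : Set V) := hu'
        rw [hNmem] at this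
        exact (h𝒞 C hC).notMem u hu (Or.inr this.1)
    · rintro u hu w (hw | hw) huw
      · exact Finset.mem_union_left _ hw
      · have : w ∈ (N : Set V) := by
          rw [hNmem]
          exact ⟨hw, u, hCY C hC hu, huw⟩
        exact Finset.mem_union_right _ this
    · intro y hy
      rcases Finset.mem_union.1 hy with hy | hy
      · exact Or.inl (Finset.mem_union_left _ hy)
      · exact Or.inr (by simpa using hy)
  · by_cases hnear : ∃ x ∈ B, ∃ u ∈ Y, ∃ p : G.Walk u x, p.length ≤ 2
    · obtain ⟨x, hx, u, hu, p, hp⟩ := hnear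
      refine (hB x hx (𝒞.biUnion id) fun v hv => ?_).card_le
        (fun C hC => Finset.subset_biUnion_of_mem id hC)
        fun C hC => (h𝒞 C hC).change ?_ ?_
      · obtain ⟨q, -⟩ := hconn.exists_walk hu (Finset.mem_union_right X hv)
        exact ⟨p.reverse.append q⟩
      · rintro v hv (hv' | hv' | hv')
        · exact (h𝒞 C hC).notMem v hv (Or.inl hv')
        · exact (h𝒞 C hC).notMem v hv (Or.inr ((hD' v).2 (Or.inl hv')))
        · exact (h𝒞 C hC).notMem v hv (Or.inr ((hD' v).2 (Or.inr ⟨x, hx, hv'⟩)))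
      · rintro v hv w (hw | hw) hvw
        · exact Or.inl hw
        · rcases exists_near_of_adj hadj hD' hvw hw with hw | ⟨x', hx', ⟨p', hp'⟩, hwx⟩
          · exact Or.inr (Or.inl hw)
          · obtain ⟨q, hq⟩ := hconn.exists_walk hu (hCY C hC hv)
            have : x = x' := hfar x hx x' hx' ⟨p.reverse.append (q.append p'), by
              simp only [SimpleGraph.Walk.length_append, SimpleGraph.Walk.length_reverse]
              omega⟩
            exact Or.inr (Or.inr (this ▸ hwx))
    · refine (hD (𝒞.biUnion id)).card_le
        (fun C hC => Finset.subset_biUnion_of_mem id hC)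
        fun C hC => (h𝒞 C hC).change ?_ ?_
      · rintro v hv (hv' | hv')
        · exact (h𝒞 C hC).notMem v hv (Or.inl hv')
        · exact (h𝒞 C hC).notMem v hv (Or.inr ((hD' v).2 (Or.inl hv')))
      · rintro v hv w (hw | hw) hvw
        · exact Or.inl hw
        · rcases exists_near_of_adj hadj hD' hvw hw with hw | ⟨x', hx', hp', -⟩
          · exact Or.inr hw
          · exact absurd ⟨x', hx', v, hCY C hC hv, hp'⟩ hnear

end Far

lemma IsPartialMatching.measurableSet_covered [MeasurableSpace V] {M : Set (V × V)} (hM : IsPartialMatching G M)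
    (hMm : MeasurableSet M) {e : ℕ → V → V} (hem : ∀ j, Measurable (e j))
    (he : EnumeratesNeighbors G e) : MeasurableSet (covered M) := by
  have : covered M = ⋃ j, {x | (x, e j x) ∈ M} := by
    ext x
    simp only [mem_iUnion]
    constructor
    · rintro ⟨y, hy⟩
      obtain ⟨j, rfl⟩ := he.exists_eq x y (hM.adj _ _ hy)
      exact ⟨j, hy⟩
    · rintro ⟨j, hj⟩
      exact ⟨_, hj⟩
  rw [this]
  exact MeasurableSet.iUnion fun j => (measurable_id.prodMk (hem j)) hMm

variable [TopologicalSpace V] [PolishSpace V] [MeasurableSpace V] [BorelSpace V]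

/-- A Borel matching `M` that meets the surroundings of large connected sets sparsely and for
which the uncovered part of every finite set can still be covered. -/
structure IsExtendable (G : SimpleGraph V) (ε : ℝ) (M : Set (V × V)) : Prop where
  measurableSet : MeasurableSet M
  isPartialMatching : IsPartialMatching G M
  matchableOff : ∀ F, MatchableOff G (covered M) F
  sparse : ∃ c < ε, ∃ m, SparseWith G (covered M) c m

lemma MeasurableSet.addEdges {M : Set (V × V)} (hM : MeasurableSet M) {B : Set V}
    (hB : MeasurableSet B) {f : V → V} (hf : Measurable f) : MeasurableSet (addEdges M B f) :=
  hM.union (((measurable_fst hB).inter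
      (measurableSet_eq_fun (hf.comp measurable_fst) measurable_snd)).union
    ((measurable_snd hB).inter
      (measurableSet_eq_fun (hf.comp measurable_snd) measurable_fst)))

/-- The vertex `x` can be matched to `f x` without making the uncovered part of a finite set in
the component of `x` impossible to cover. -/
lemma measurableSet_forall_matchableOff (hG : MeasurableSet {p : V × V | G.Adj p.1 p.2})
    {e : ℕ → V → V} (hem : ∀ j, Measurable (e j)) (he : EnumeratesNeighbors G e) {D : Set V}
    (hD : MeasurableSet D) {f : V → V} (hf : Measurable f) :
    MeasurableSet {x | ∀ F : Finset V, (∀ v ∈ F, G.Reachable x v) →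
      MatchableOff G (D ∪ {x, f x}) F} := by
  classical
  have : {x | ∀ F : Finset V, (∀ v ∈ F, G.Reachable x v) → MatchableOff G (D ∪ {x, f x}) F} =
      ⋂ s : Finset (List ℕ),
        {x | MatchableOff G (D ∪ {x, f x}) (s.image fun l => follow e l x)} := by
    ext x
    simp only [mem_iInter]
    constructor
    · intro h s
      refine h _ fun v hv => ?_
      obtain ⟨l, -, rfl⟩ := Finset.mem_image.1 hv
      exact (he.reachable_iff x _).2 ⟨l, rfl⟩
    · intro h F hF
      have hF' : ∀ v ∈ F, ∃ l, follow e l x = v := fun v hv => (he.reachable_iff x v).1 (hF v hv)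
      choose! l hl using hF'
      refine (h (F.image l)).mono fun v hv => ?_
      exact Finset.mem_image.2 ⟨l v, Finset.mem_image_of_mem l hv, hl v hv⟩
  rw [this]
  refine MeasurableSet.iInter fun s => ?_
  refine measurableSet_matchableOff hG (measurable_follow hem) (fun x l w h => ?_) (fun l => ?_) s
  · refine (he.reachable_iff x w).1 (SimpleGraph.Reachable.trans ?_ h.reachable)
    exact (he.reachable_iff x _).2 ⟨l, rfl⟩
  · have hl := measurable_follow hem l
    exact (hl hD).union ((measurableSet_eq_fun hl measurable_id).union
      (measurableSet_eq_fun hl hf))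

theorem IsExtendable.exists_extension (hG : MeasurableSet {p : V × V | G.Adj p.1 p.2})
    (hLF : ∀ v : V, (G.neighborSet v).Finite) {ε : ℝ}
    (hexp : ∀ (X : Finset V) (𝒞 : Finset (Finset V)) (Y : Finset V),
      (∀ C ∈ 𝒞, IsOddPiece G ↑X C) → (∀ y ∈ Y, y ∈ X ∨ ∃ C ∈ 𝒞, y ∈ C) →
        𝒞.card + ε * Y.card ≤ (X.card : ℝ)) {e : ℕ → V → V} (hem : ∀ j, Measurable (e j))
    (he : EnumeratesNeighbors G e) {M : Set (V × V)} (hM : IsExtendable G ε M) :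
    ∃ N : ℕ × ℕ → Set (V × V), (∀ i, IsExtendable G ε (N i) ∧ M ⊆ N i) ∧
      ∀ x, ∃ i, x ∈ covered (N i) := by
  obtain ⟨c, hc, m, hsparse⟩ := hM.sparse
  obtain ⟨r₀, hr₀⟩ := exists_nat_gt (2 / (ε - c))
  have hεc : 0 < ε - c := sub_pos.2 hc
  set r := max (max r₀ m) 1 with hr
  have hr₁ : 0 < r := lt_of_lt_of_le one_pos (le_max_right _ _)
  have hmr : m ≤ r := (le_max_right _ _).trans (le_max_left _ _)
  have hcr : c + 2 / r < ε := by
    have h1 : (r₀ : ℝ) ≤ r := by exact_mod_cast (le_max_left _ _).trans (le_max_left _ _)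
    have h2 : (0 : ℝ) < r := by exact_mod_cast hr₁
    have h3 : 2 / (r : ℝ) < ε - c := by
      rw [div_lt_iff₀ h2, mul_comm, ← div_lt_iff₀ hεc]
      exact hr₀.trans_le h1
    linarith
  obtain ⟨κ, hκ, hκfar⟩ := exists_distance_coloring hLF hem he (2 * r + 4)
  set D := covered M with hDdef
  have hD : MeasurableSet D := hM.isPartialMatching.measurableSet_covered hM.measurableSet hem he
  let B : ℕ × ℕ → Set V := fun i => {x | (κ x = i.1 ∧ x ∉ D ∧ e i.2 x ∉ D ∧ G.Adj x (e i.2 x)) ∧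
    ∀ F : Finset V, (∀ v ∈ F, G.Reachable x v) → MatchableOff G (D ∪ {x, e i.2 x}) F}
  have hBm : ∀ i, MeasurableSet (B i) := fun i =>
    ((measurableSet_eq_fun hκ measurable_const).inter (hD.compl.inter
      (((hem i.2) hD).compl.inter ((measurable_id.prodMk (hem i.2)) hG)))).inter
      (measurableSet_forall_matchableOff hG hem he hD (hem i.2))
  have hfar : ∀ i, ∀ x ∈ B i, ∀ y ∈ B i, (∃ p : G.Walk x y, p.length ≤ 2 * r + 4) → x = y :=
    fun i x hx y hy hp => hκfar x y hp (hx.1.1.trans hy.1.1.symm)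
  have hadj : ∀ i, ∀ x ∈ B i, G.Adj x (e i.2 x) := fun i x hx => hx.1.2.2.2
  refine ⟨fun i => addEdges M (B i) (e i.2), fun i => ⟨⟨?_, ?_, ?_, ?_⟩, subset_union_left⟩, ?_⟩
  · exact hM.measurableSet.addEdges (hBm i) (hem i.2)
  · refine hM.isPartialMatching.addEdges (fun x hx => hx.1.2) fun x hx y hy ⟨p, hp⟩ => ?_
    exact hfar i x hx y hy ⟨p, hp.trans (by omega)⟩
  · have hs := hsparse.add hLF hmr hr₁ (hadj i)
      (fun _ => mem_covered_addEdges (M := M) (B := B i)) (hfar i)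
    exact (hs.tutteOff hLF hexp hcr.le (hadj i) (fun _ => mem_covered_addEdges) (hfar i)
      hM.matchableOff fun x hx => hx.2).matchableOff hLF
  · exact ⟨_, hcr, r, hsparse.add hLF hmr hr₁ (hadj i) (fun _ => mem_covered_addEdges) (hfar i)⟩
  · intro x
    by_cases hx : x ∈ D
    · exact ⟨(0, 0), mem_covered_addEdges.2 (Or.inl hx)⟩
    · obtain ⟨y, hxy, hy, hF⟩ := exists_adj_matchableOff hLF hM.matchableOff hx
      obtain ⟨j, rfl⟩ := he.exists_eq x y hxy
      exact ⟨(κ x, j), mem_covered_addEdges.2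
        (Or.inr ⟨x, ⟨⟨rfl, hx, hy, hxy⟩, fun F _ => hF F⟩, Or.inl rfl⟩)⟩

end Extension

/-! ### The generic construction -/

section Generic

open MeasureTheory TopologicalSpace

variable {V : Type*}

/-- Given countably many extensions at each stage, which together cover everything, there is an
increasing sequence of extensions which generically covers every orbit of the maps `g l`. -/
theorem exists_generic_sequence [TopologicalSpace V] [BaireSpace V] [SecondCountableTopology V]
    [MeasurableSpace V] [BorelSpace V] {P : Set (V × V) → Prop} {ι κ : Type*} [Countable ι]
    [Countable κ] [Nonempty κ] {g : κ → V → V}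
    (hstep : ∀ M, P M → ∃ N : ι → Set (V × V), (∀ i, P (N i) ∧ M ⊆ N i) ∧
      ∀ x, ∃ i, x ∈ covered (N i))
    (hmeas : ∀ M, P M → ∀ l, MeasurableSet {x | g l x ∈ covered M})
    {M₀ : Set (V × V)} (hM₀ : P M₀) :
    ∃ M : ℕ → Set (V × V), Monotone M ∧ (∀ k, P (M k)) ∧
      {x | ∀ l, ∃ k, g l x ∈ covered (M k)} ∈ residual V := by
  have hone : ∀ (U : Set V) (l : κ) (M : Subtype P), ∃ N : Subtype P, M.1 ⊆ N.1 ∧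
      (IsMeagre (U ∩ {x | g l x ∈ covered N.1}) → IsMeagre U) := by
    intro U l M
    obtain ⟨N, hN, hcov⟩ := hstep M.1 M.2
    by_cases hU : IsMeagre U
    · exact ⟨M, Subset.rfl, fun _ => hU⟩
    · by_contra! hcon
      refine hU ((isMeagre_iUnion fun i => (hcon ⟨N i, (hN i).1⟩ (hN i).2).1).mono ?_)
      intro x hx
      obtain ⟨i, hi⟩ := hcov (g l x)
      exact mem_iUnion.2 ⟨i, hx, hi⟩
  choose next hsub hnext using hone
  have : Countable (countableBasis V) := (countable_countableBasis V).to_subtype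
  obtain ⟨task, htask⟩ := exists_surjective_nat (Option (countableBasis V) × κ)
  let U : ℕ → Set V := fun k => ((task k).1.map Subtype.val).getD ∅
  let M : ℕ → Subtype P := fun k =>
    Nat.rec ⟨M₀, hM₀⟩ (fun k M => next (U k) (task k).2 M) k
  have hmono : Monotone fun k => (M k).1 := monotone_nat_of_le_succ fun k => hsub _ _ _
  refine ⟨fun k => (M k).1, hmono, fun k => (M k).2, ?_⟩
  rw [ofPred_forall, countable_iInter_mem]
  intro l
  have hWm : MeasurableSet {x | ∃ k, g l x ∈ covered (M k).1} := by
    rw [ofPred_exists]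
    exact MeasurableSet.iUnion fun k => hmeas _ (M k).2 l
  set W := {x | ∃ k, g l x ∈ covered (M k).1} with hW
  obtain ⟨O, hO, hWO⟩ := hWm.compl.residualEq_isOpen
  rcases O.eq_empty_or_nonempty with rfl | ⟨x, hx⟩
  · filter_upwards [hWO.mem_iff] with x hx
    by_contra hxW
    exact hx.1 hxW
  · exfalso
    obtain ⟨u, hu, hxu, huO⟩ := (isBasis_countableBasis V).exists_subset_of_mem_open hx hO
    obtain ⟨k, hk⟩ := htask (some ⟨u, hu⟩, l)
    have hUk : U k = u := by simp [U, hk]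
    refine not_isMeagre_of_isOpen ((isBasis_countableBasis V).isOpen hu) ⟨x, hxu⟩ ?_
    rw [← hUk]
    refine hnext (U k) (task k).2 (M k) ?_
    rw [hUk, hk, IsMeagre]
    filter_upwards [hWO.mem_iff] with y hy hyu
    exact hy.2 (huO hyu.1) ⟨k + 1, by simpa [M, hUk, hk] using hyu.2⟩

end Generic

/-- If a locally finite Borel graph satisfies the strengthened Tutte
condition `|X| ≥ |C_odd(X)| + ε|hull_odd(X)|` for all finite `X`, then it admits a Borel
perfect matching on a Borel comeager invariant set. -/
theorem stmt_4 {V : Type*} [TopologicalSpace V] [PolishSpace V]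
    [MeasurableSpace V] [BorelSpace V]
    (G : SimpleGraph V) (hGmeas : MeasurableSet {p : V × V | G.Adj p.1 p.2})
    (hLF : ∀ v : V, (G.neighborSet v).Finite)
    (ε : ℝ) (hε : 0 < ε)
    (hTutte : ∀ X : Set V, X.Finite →
      (oddComponents G X).Finite ∧ (hullOdd G X).Finite ∧
      (oddComponents G X).ncard + ε * (hullOdd G X).ncard ≤ (X.ncard : ℝ)) :
    ∃ S : Set V, MeasurableSet S ∧ S ∈ residual V ∧ Invariant G S ∧
      ∃ M : Set (V × V), MeasurableSet M ∧ IsPerfectMatchingOn G S M := by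
  classical
  have hexp : ∀ (X : Finset V) (𝒞 : Finset (Finset V)) (Y : Finset V),
      (∀ C ∈ 𝒞, IsOddPiece G ↑X C) → (∀ y ∈ Y, y ∈ X ∨ ∃ C ∈ 𝒞, y ∈ C) →
        𝒞.card + ε * Y.card ≤ (X.card : ℝ) := by
    intro X 𝒞 Y h𝒞 hY
    have hle := expansion_of_oddComponents hε hTutte X 𝒞 h𝒞
    have hcard : (Y.card : ℝ) ≤ (X ∪ 𝒞.biUnion id).card := by
      exact_mod_cast Finset.card_le_card fun y hy => by simpa using hY y hy
    have := mul_le_mul_of_nonneg_left hcard hε.le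
    linarith
  obtain ⟨e, hem, he⟩ := exists_enumeratesNeighbors hGmeas hLF
  have hcov : covered (∅ : Set (V × V)) = ∅ := by
    ext x
    simp [covered]
  have hbase : IsExtendable G ε (∅ : Set (V × V)) := by
    refine ⟨MeasurableSet.empty, ⟨by simp, by simp, by simp⟩, ?_, 0, hε, 0, fun Y _ _ => ?_⟩
    · rw [hcov]
      refine TutteOff.matchableOff hLF fun X 𝒞 h𝒞 => ?_
      simp only [union_empty] at h𝒞
      have := hexp X 𝒞 ∅ h𝒞 (by simp)
      simpa using this
    · simp [hcov]
  obtain ⟨M, hmono, hM, hres⟩ := exists_generic_sequence (g := follow e)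
    (fun N hN => hN.exists_extension hGmeas hLF hexp hem he)
    (fun N hN l => measurable_follow hem l
      (hN.isPartialMatching.measurableSet_covered hN.measurableSet hem he)) hbase
  set S := {x | ∀ l, ∃ k, follow e l x ∈ covered (M k)} with hS
  have hSm : MeasurableSet S := by
    simp only [hS, ofPred_forall, ofPred_exists]
    exact MeasurableSet.iInter fun l => MeasurableSet.iUnion fun k => measurable_follow hem l
      ((hM k).isPartialMatching.measurableSet_covered (hM k).measurableSet hem he)
  have hSinv : Invariant G S := by
    intro x hx y hxy l
    obtain ⟨l', hl'⟩ := (he.reachable_iff x (follow e l y)).1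
      (hxy.trans ((he.reachable_iff y _).2 ⟨l, rfl⟩))
    rw [← hl']
    exact hx l'
  have hSadj : ∀ x y, x ∈ S → G.Adj x y → y ∈ S := fun x y hx hxy => hSinv hx hxy.reachable
  refine ⟨S, hSm, hres, hSinv, (⋃ k, M k) ∩ S ×ˢ S,
    (MeasurableSet.iUnion fun k => (hM k).measurableSet).inter (hSm.prod hSm), ?_, ?_, ?_, ?_⟩
  · rintro ⟨x, y⟩ ⟨h, -⟩
    obtain ⟨k, hk⟩ := mem_iUnion.1 h
    exact (hM k).isPartialMatching.adj _ _ hk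
  · rintro x y ⟨h, hx, hy⟩
    obtain ⟨k, hk⟩ := mem_iUnion.1 h
    exact ⟨mem_iUnion.2 ⟨k, (hM k).isPartialMatching.symm _ _ hk⟩, hy, hx⟩
  · exact fun p hp => hp.2
  · intro x hx
    obtain ⟨k, y, hk⟩ := hx []
    have hxy := (hM k).isPartialMatching.adj _ _ hk
    refine ⟨y, ⟨mem_iUnion.2 ⟨k, hk⟩, hx, hSadj _ _ hx hxy⟩, ?_⟩
    rintro z ⟨h, -⟩
    obtain ⟨k', hk'⟩ := mem_iUnion.1 h
    exact (hM (max k k')).isPartialMatching.unique x z y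
      (hmono (le_max_right _ _) hk') (hmono (le_max_left _ _) hk)
end

section
/- Let G be a locally finite Borel graph on a Polish space V(G), and let f: ℕ → ℕ. Then there exist Borel sets A_n ⊆ V(G), n ∈ ℕ, such that ⋃_n A_n is a Borel comeager G-invariant set and, for each n, any two distinct vertices x, y ∈ A_n satisfy d_G(x, y) > f(n) (i.e., there is no path in G of length at most f(n) joining x and y). -/
open Set

/-- The sets `P i` are contained in Borel sets with empty intersection. -/
def MeasurablyDisjoinable {X : Type*} [MeasurableSpace X] (P : ℕ → Set X) : Prop :=
  ∃ Q : ℕ → Set X, (∀ i, MeasurableSet (Q i)) ∧ (∀ i, P i ⊆ Q i) ∧ ⋂ i, Q i = ∅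

theorem MeasurablyDisjoinable.of_forall {X : Type*} [MeasurableSpace X] {P : ℕ → Set X}
    {R : ℕ → ℕ → Set X} (k : ℕ) (hk : P k ⊆ ⋃ j, R j k) (hne : ∀ j, ∀ i ≠ k, P i ⊆ R j i)
    (h : ∀ j, MeasurablyDisjoinable (R j)) : MeasurablyDisjoinable P := by
  choose Q hQm hQ hQe using h
  refine ⟨fun i => if i = k then ⋃ j, Q j i else ⋂ j, Q j i, fun i => ?_, fun i => ?_, ?_⟩
  · dsimp only
    split_ifs
    · exact MeasurableSet.iUnion fun j => hQm j i
    · exact MeasurableSet.iInter fun j => hQm j i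
  · dsimp only
    split_ifs with hi
    · subst hi
      exact hk.trans (iUnion_mono fun j => hQ j i)
    · exact subset_iInter fun j => (hne j i hi).trans (hQ j i)
  · refine eq_empty_of_forall_notMem fun y hy => ?_
    rw [mem_iInter] at hy
    have hyk := hy k
    rw [if_pos rfl, mem_iUnion] at hyk
    obtain ⟨j, hj⟩ := hyk
    have : y ∈ ⋂ i, Q j i := by
      refine mem_iInter.2 fun i => ?_
      by_cases hi : i = k
      · exact hi ▸ hj
      · have := hy i
        rw [if_neg hi] at this
        exact mem_iInter.1 this j
    rw [hQe j] at this
    exact this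

/-- Novikov separation for ranges of continuous maps on the Baire space. -/
theorem measurablyDisjoinable_range {X : Type*} [TopologicalSpace X] [T2Space X]
    [MeasurableSpace X] [OpensMeasurableSpace X] {F : ℕ → (ℕ → ℕ) → X}
    (hF : ∀ i, Continuous (F i)) (h : ⋂ i, range (F i) = ∅) :
    MeasurablyDisjoinable fun i => range (F i) := by
  by_contra hsep
  -- All the maps are read off a single point of the Baire space, through disjoint coordinates.
  let g : ℕ → (ℕ → ℕ) → X := fun i z => F i fun d => z (Nat.pair i d)
  have hg : ∀ i, Continuous (g i) := fun i =>
    (hF i).comp (continuous_pi fun d => continuous_apply _)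
  let S : ℕ → (ℕ → ℕ) → ℕ → Set X := fun n x i => g i '' PiNat.cylinder x n
  have split : ∀ n x, ¬ MeasurablyDisjoinable (S n x) →
      ∃ j, ¬ MeasurablyDisjoinable (S (n + 1) (Function.update x n j)) := by
    intro n x
    contrapose!
    refine MeasurablyDisjoinable.of_forall n.unpair.1 ?_ ?_
    · rintro _ ⟨z, hz, rfl⟩
      rw [← PiNat.iUnion_cylinder_update x n, mem_iUnion] at hz
      obtain ⟨j, hj⟩ := hz
      exact mem_iUnion.2 ⟨j, z, hj, rfl⟩
    · rintro j i hi _ ⟨z, hz, rfl⟩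
      refine ⟨Function.update z n j, fun m hm => ?_, ?_⟩
      · rcases (Nat.lt_succ_iff.1 hm).eq_or_lt with rfl | hlt
        · simp
        · simp [Function.update_of_ne hlt.ne, hz m hlt]
      · simp only [g]
        congr 1
        funext d
        refine Function.update_of_ne (fun hd => hi ?_) _ _
        rw [← hd, Nat.unpair_pair]
  choose! next hnext using split
  let u : ℕ → ℕ → ℕ := fun n => Nat.rec (fun _ => 0) (fun n x => Function.update x n (next n x)) n
  have hu : ∀ n, u (n + 1) = Function.update (u n) n (next n (u n)) := fun _ => rfl
  have husep : ∀ n, ¬ MeasurablyDisjoinable (S n (u n)) := by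
    intro n
    induction n with
    | zero =>
      intro h0
      refine hsep ?_
      obtain ⟨Q, hQm, hQ, hQe⟩ := h0
      refine ⟨Q, hQm, fun i => ?_, hQe⟩
      rintro _ ⟨z, rfl⟩
      refine hQ i ⟨fun n => z n.unpair.2, by simp, ?_⟩
      simp [g]
    | succ n ih => exact hnext n _ ih
  let y : ℕ → ℕ := fun n => u (n + 1) n
  have hy : ∀ n, ∀ m < n, y m = u n m := by
    intro n m hm
    induction n, hm using Nat.le_induction with
    | base => rfl
    | succ n hmn ih => rw [hu, Function.update_of_ne (Nat.ne_of_lt hmn), ih]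
  have hysep : ∀ n, ¬ MeasurablyDisjoinable (S n y) := by
    intro n
    have : PiNat.cylinder y n = PiNat.cylinder (u n) n :=
      PiNat.mem_cylinder_iff_eq.1 fun m hm => hy n m hm
    simpa only [S, this] using husep n
  obtain ⟨i, hi⟩ : ∃ i, g 0 y ≠ g i y := by
    by_contra! hall
    have : g 0 y ∈ ⋂ i, range (F i) := mem_iInter.2 fun i => ⟨_, (hall i).symm⟩
    rw [h] at this
    exact this
  obtain ⟨v, w, hv, hw, hvy, hwy, hvw⟩ := t2_separation hi
  have small : ∀ (O : Set (ℕ → ℕ)), IsOpen O → y ∈ O → ∃ n, PiNat.cylinder y n ⊆ O := by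
    intro O hO hyO
    obtain ⟨_, ⟨x, n, rfl⟩, hyx, hsub⟩ :=
      (PiNat.isTopologicalBasis_cylinders fun _ => ℕ).exists_subset_of_mem_open hyO hO
    exact ⟨n, (PiNat.mem_cylinder_iff_eq.1 hyx).symm ▸ hsub⟩
  obtain ⟨a, ha⟩ := small _ (hv.preimage (hg 0)) hvy
  obtain ⟨b, hb⟩ := small _ (hw.preimage (hg i)) hwy
  have hi0 : i ≠ 0 := by
    rintro rfl
    exact hi rfl
  refine hysep (max a b) ⟨fun k => if k = 0 then v else if k = i then w else univ, ?_, ?_, ?_⟩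
  · intro k
    dsimp only
    split_ifs
    exacts [hv.measurableSet, hw.measurableSet, MeasurableSet.univ]
  · intro k
    dsimp only
    split_ifs with h1 h2
    · subst h1
      exact image_subset_iff.2 ((PiNat.cylinder_anti y (le_max_left a b)).trans ha)
    · subst h2
      exact image_subset_iff.2 ((PiNat.cylinder_anti y (le_max_right a b)).trans hb)
    · exact subset_univ _
  · refine eq_empty_of_forall_notMem fun z hz => ?_
    rw [mem_iInter] at hz
    have hz0 := hz 0
    have hzi := hz i
    rw [if_pos rfl] at hz0
    rw [if_neg hi0, if_pos rfl] at hzi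
    exact disjoint_left.1 hvw hz0 hzi

/-- Novikov separation: countably many analytic sets with empty intersection are contained in
Borel sets with empty intersection. -/
theorem measurablyDisjoinable_of_analyticSet {X : Type*} [TopologicalSpace X] [T2Space X]
    [MeasurableSpace X] [OpensMeasurableSpace X] {P : ℕ → Set X}
    (hP : ∀ i, MeasureTheory.AnalyticSet (P i)) (h : ⋂ i, P i = ∅) :
    MeasurablyDisjoinable P := by
  by_cases hk : ∃ k, P k = ∅
  · obtain ⟨k, hk⟩ := hk
    refine ⟨fun i => if i = k then ∅ else univ, fun i => ?_, fun i => ?_, ?_⟩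
    · dsimp only
      split_ifs
      exacts [MeasurableSet.empty, MeasurableSet.univ]
    · dsimp only
      split_ifs with hi
      exacts [hi ▸ hk.subset, subset_univ _]
    · exact eq_empty_of_forall_notMem fun y hy => by simpa using mem_iInter.1 hy k
  · push Not at hk
    have : ∀ i, ∃ F : (ℕ → ℕ) → X, Continuous F ∧ range F = P i := fun i => by
      have := hP i
      rw [MeasureTheory.AnalyticSet] at this
      exact this.resolve_left (hk i).ne_empty
    choose F hF hFP using this
    obtain rfl : (fun i => range (F i)) = P := funext hFP
    exact measurablyDisjoinable_range hF h

/-- The projection of a Borel set with finite sections is Borel. -/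
theorem measurableSet_image_fst_of_finite_sections {X Y : Type*}
    [TopologicalSpace X] [PolishSpace X] [MeasurableSpace X] [BorelSpace X]
    [TopologicalSpace Y] [PolishSpace Y] [MeasurableSpace Y] [BorelSpace Y]
    {E : Set (X × Y)} (hE : MeasurableSet E) (hfin : ∀ x, {y | (x, y) ∈ E}.Finite) :
    MeasurableSet (Prod.fst '' E) := by
  obtain ⟨b, hbc, -, hb⟩ := TopologicalSpace.exists_countable_basis Y
  obtain ⟨U, hU⟩ := (hbc.insert ∅).exists_eq_range (insert_nonempty _ _)
  have hUb : ∀ s ∈ b, ∃ i, U i = s := fun s hs => by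
    have : s ∈ range U := hU ▸ mem_insert_of_mem _ hs
    exact this
  have hUo : ∀ i, IsOpen (U i) := fun i => by
    have : U i ∈ insert ∅ b := hU ▸ mem_range_self i
    rcases this with h | h
    exacts [h ▸ isOpen_empty, hb.isOpen h]
  -- `(x, y) ∉ P i` when `U i` isolates `y` in the section at `x`.
  let P : ℕ → Set (X × Y) := fun i =>
    {p | p ∈ E ∧ ∃ y', p.2 ∉ U i ∨ (y' ≠ p.2 ∧ y' ∈ U i ∧ (p.1, y') ∈ E)}
  have hPa : ∀ i, MeasureTheory.AnalyticSet (P i) := by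
    intro i
    have hm : MeasurableSet {q : (X × Y) × Y |
        q.1 ∈ E ∧ (q.1.2 ∉ U i ∨ (q.2 ≠ q.1.2 ∧ q.2 ∈ U i ∧ (q.1.1, q.2) ∈ E))} := by
      have hUi := (hUo i).measurableSet
      refine (measurable_fst hE).inter (MeasurableSet.union ?_ (MeasurableSet.inter ?_
        (MeasurableSet.inter ?_ ?_)))
      · exact (measurable_snd.comp measurable_fst) hUi.compl
      · exact (measurableSet_eq_fun measurable_snd (measurable_snd.comp measurable_fst)).compl
      · exact measurable_snd hUi
      · exact ((measurable_fst.comp measurable_fst).prodMk measurable_snd) hE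
    convert hm.analyticSet.image_of_continuous continuous_fst using 1
    ext p
    simp [P]
  have hPe : ⋂ i, P i = ∅ := by
    refine eq_empty_of_forall_notMem fun p hp => ?_
    rw [mem_iInter] at hp
    have hpE : p ∈ E := (hp 0).1
    have hO : IsOpen ({y | (p.1, y) ∈ E} \ {p.2})ᶜ :=
      ((hfin p.1).subset sdiff_subset).isClosed.isOpen_compl
    obtain ⟨s, hs, hps, hsO⟩ := hb.exists_subset_of_mem_open (a := p.2) (by simp) hO
    obtain ⟨i, rfl⟩ := hUb s hs
    obtain ⟨-, y', hy' | ⟨hne, hyU, hyE⟩⟩ := hp i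
    · exact hy' hps
    · exact hsO hyU ⟨hyE, hne⟩
  obtain ⟨Q, hQm, hQ, hQe⟩ := measurablyDisjoinable_of_analyticSet hPa hPe
  have hEU : E = ⋃ i, E \ Q i := by
    rw [← sdiff_iInter, hQe, sdiff_empty]
  rw [hEU, image_iUnion]
  refine MeasurableSet.iUnion fun i =>
    (hE.diff (hQm i)).image_of_measurable_injOn measurable_fst ?_
  rintro ⟨x, y⟩ ⟨hxy, hxyQ⟩ ⟨x', y'⟩ ⟨hxy', hxyQ'⟩ (rfl : x = x')
  by_contra hne
  have h1 : y ∈ U i := by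
    by_contra hyU
    exact hxyQ (hQ i ⟨hxy, y, Or.inl hyU⟩)
  exact hxyQ' (hQ i ⟨hxy', y, Or.inr ⟨fun h => hne (by rw [h]), h1, hxy⟩⟩)

theorem finite_setOf_walk_length {V : Type*} (G : SimpleGraph V)
    (hLF : ∀ v : V, (G.neighborSet v).Finite) (m : ℕ) (x : V) :
    {y | ∃ p : G.Walk x y, p.length = m}.Finite := by
  induction m generalizing x with
  | zero =>
    refine (finite_singleton x).subset ?_
    rintro y ⟨p, hp⟩
    exact (SimpleGraph.Walk.eq_of_length_eq_zero hp).symm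
  | succ m ih =>
    refine ((hLF x).biUnion fun z _ => ih z).subset ?_
    rintro y ⟨p, hp⟩
    cases p with
    | nil => simp at hp
    | cons hadj q => exact mem_biUnion hadj ⟨q, by simpa using hp⟩

theorem measurableSet_setOf_walk_length {V : Type*} [TopologicalSpace V] [PolishSpace V]
    [MeasurableSpace V] [BorelSpace V]
    (G : SimpleGraph V) (hGmeas : MeasurableSet {p : V × V | G.Adj p.1 p.2})
    (hLF : ∀ v : V, (G.neighborSet v).Finite) (m : ℕ) :
    MeasurableSet {q : V × V | ∃ p : G.Walk q.1 q.2, p.length = m} := by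
  induction m with
  | zero =>
    convert measurableSet_diagonal (α := V) using 1
    ext ⟨x, y⟩
    constructor
    · rintro ⟨p, hp⟩
      exact SimpleGraph.Walk.eq_of_length_eq_zero hp
    · rintro (rfl : x = y)
      exact ⟨.nil, rfl⟩
  | succ m ih =>
    have hm : MeasurableSet {q : (V × V) × V |
        G.Adj q.1.1 q.2 ∧ ∃ p : G.Walk q.2 q.1.2, p.length = m} :=
      (((measurable_fst.comp measurable_fst).prodMk measurable_snd) hGmeas).inter
        ((measurable_snd.prodMk (measurable_snd.comp measurable_fst)) ih)
    convert measurableSet_image_fst_of_finite_sections hm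
      (fun q => (hLF q.1).subset fun z hz => hz.1) using 1
    ext ⟨x, y⟩
    constructor
    · rintro ⟨p, hp⟩
      cases p with
      | nil => simp at hp
      | cons hadj q => exact ⟨((x, y), _), ⟨hadj, q, by simpa using hp⟩, rfl⟩
    · rintro ⟨⟨⟨x', y'⟩, z⟩, ⟨hadj, q, hq⟩, h⟩
      cases h
      exact ⟨.cons hadj q, by simpa using hq⟩

/-- A Borel set which is nonmeager in every nonempty basic open set is comeager. -/
theorem mem_residual_of_forall_not_isMeagre {V : Type*} [TopologicalSpace V]
    [MeasurableSpace V] [BorelSpace V] {b : Set (Set V)} (hb : TopologicalSpace.IsTopologicalBasis b)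
    {T : Set V} (hT : MeasurableSet T) (h : ∀ u ∈ b, u.Nonempty → ¬ IsMeagre (u ∩ T)) :
    T ∈ residual V := by
  obtain ⟨O, hO, hTO⟩ := hT.compl.residualEq_isOpen
  rcases O.eq_empty_or_nonempty with rfl | ⟨x, hx⟩
  · filter_upwards [hTO.mem_iff] with y hy
    by_contra hyT
    exact hy.1 hyT
  · obtain ⟨u, hu, hxu, huO⟩ := hb.exists_subset_of_mem_open hx hO
    refine absurd ?_ (h u hu ⟨x, hxu⟩)
    change (u ∩ T)ᶜ ∈ residual V
    filter_upwards [hTO.mem_iff] with y hy hyuT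
    exact hy.2 (huO hyuT.1) hyuT.2

/-- For a locally finite Borel graph `G` and `f : ℕ → ℕ`, there are
Borel sets `A n` whose union is a Borel comeager invariant set, such that distinct
vertices of `A n` are at graph distance greater than `f n` (i.e. every path joining
them has length greater than `f n`). -/
theorem stmt_5 {V : Type*} [TopologicalSpace V] [PolishSpace V]
    [MeasurableSpace V] [BorelSpace V]
    (G : SimpleGraph V) (hGmeas : MeasurableSet {p : V × V | G.Adj p.1 p.2})
    (hLF : ∀ v : V, (G.neighborSet v).Finite)
    (f : ℕ → ℕ) :
    ∃ A : ℕ → Set V,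
      (∀ n, MeasurableSet (A n)) ∧
      (⋃ n, A n) ∈ residual V ∧
      Invariant G (⋃ n, A n) ∧
      (∀ n, ∀ x ∈ A n, ∀ y ∈ A n, x ≠ y → ∀ p : G.Walk x y, f n < p.length) := by
  obtain ⟨b, hbc, -, hb⟩ := TopologicalSpace.exists_countable_basis V
  obtain ⟨U, hU⟩ := (hbc.insert ∅).exists_eq_range (insert_nonempty _ _)
  have hUb : ∀ s ∈ b, ∃ i, U i = s := fun s hs => by
    have : s ∈ range U := hU ▸ mem_insert_of_mem _ hs
    exact this
  have hUo : ∀ i, IsOpen (U i) := fun i => by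
    have : U i ∈ insert ∅ b := hU ▸ mem_range_self i
    rcases this with h | h
    exacts [h ▸ isOpen_empty, hb.isOpen h]
  let D : ℕ → Set (V × V) := fun m => {q | ∃ p : G.Walk q.1 q.2, p.length = m}
  have hD : ∀ m, MeasurableSet (D m) := measurableSet_setOf_walk_length G hGmeas hLF
  have hDfin : ∀ m x, {y | (x, y) ∈ D m}.Finite := finite_setOf_walk_length G hLF
  -- The points that `U i` isolates from the other vertices at distance at most `r`.
  let B : ℕ → ℕ → Set V := fun i r =>
    U i \ ⋃ m ∈ Iic r, Prod.fst '' {q : V × V | q ∈ D m ∧ q.1 ≠ q.2 ∧ q.2 ∈ U i}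
  have hBm : ∀ i r, MeasurableSet (B i r) := by
    intro i r
    refine (hUo i).measurableSet.diff (MeasurableSet.biUnion (to_countable _) fun m _ => ?_)
    refine measurableSet_image_fst_of_finite_sections ?_
      fun x => (hDfin m x).subset fun y hy => hy.1
    exact (hD m).inter ((measurableSet_eq_fun measurable_fst measurable_snd).compl.inter
      (measurable_snd (hUo i).measurableSet))
  have hBsep : ∀ i r, ∀ x ∈ B i r, ∀ y ∈ B i r, x ≠ y → ∀ p : G.Walk x y, r < p.length := by
    intro i r x hx y hy hxy p
    by_contra! hp
    exact hx.2 (mem_biUnion (mem_Iic.2 hp) ⟨(x, y), ⟨⟨p, rfl⟩, hxy, hy.1⟩, rfl⟩)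
  have hBcov : ∀ r x, ∃ i, x ∈ B i r := by
    intro r x
    have hO : IsOpen ((⋃ m ∈ Iic r, {y | (x, y) ∈ D m}) \ {x})ᶜ :=
      (((finite_Iic r).biUnion fun m _ => hDfin m x).subset sdiff_subset).isClosed.isOpen_compl
    obtain ⟨s, hs, hxs, hsO⟩ := hb.exists_subset_of_mem_open (a := x) (by simp) hO
    obtain ⟨i, rfl⟩ := hUb s hs
    refine ⟨i, hxs, fun hx => ?_⟩
    obtain ⟨m, hm, ⟨x', y⟩, ⟨hD', hne, hyU⟩, rfl⟩ := mem_iUnion₂.1 hx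
    exact hsO hyU ⟨mem_biUnion hm hD', fun h => hne h.symm⟩
  choose idx hidx using hBcov
  -- The block of indices `Nat.pair q l`, `l ∈ ℕ`, takes care of one basic open set and one radius.
  have block : ∀ q : ℕ, ∃ t : List ℕ, (U q.unpair.1).Nonempty →
      ¬ IsMeagre (U q.unpair.1 ∩ {x | ∀ y, (x, y) ∈ D q.unpair.2 →
        ∃ l, y ∈ B (t.getD l 0) (f (Nat.pair q l))}) := by
    intro q
    by_contra! hq
    have hmeagre := isMeagre_iUnion fun t => (hq t).2
    refine not_isMeagre_of_isOpen (hUo q.unpair.1) (hq []).1 (hmeagre.mono fun x hx => ?_)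
    obtain ⟨L, hL⟩ := (hDfin q.unpair.2 x).exists_finset_coe
    refine mem_iUnion.2 ⟨L.toList.mapIdx fun l y => idx (f (Nat.pair q l)) y, hx, fun y hy => ?_⟩
    have hyL : y ∈ L.toList := by
      rw [Finset.mem_toList, ← Finset.mem_coe, hL]
      exact hy
    obtain ⟨l, hl, rfl⟩ := List.getElem_of_mem hyL
    refine ⟨l, ?_⟩
    rw [List.getD_eq_getElem _ _ (by simpa using hl), List.getElem_mapIdx]
    exact hidx _ _
  choose t ht using block
  let A : ℕ → Set V := fun n => B ((t n.unpair.1).getD n.unpair.2 0) (f n)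
  have hAm : ∀ n, MeasurableSet (A n) := fun n => hBm _ _
  let T : ℕ → Set V := fun m => {x | ∀ y, (x, y) ∈ D m → y ∈ ⋃ n, A n}
  have hTm : ∀ m, MeasurableSet (T m) := by
    intro m
    convert (measurableSet_image_fst_of_finite_sections
      ((hD m).inter (measurable_snd (MeasurableSet.iUnion hAm).compl))
      fun x => (hDfin m x).subset fun y hy => hy.1).compl using 1
    ext x
    simp [T]
  have hTres : ∀ m, T m ∈ residual V := by
    intro m
    refine mem_residual_of_forall_not_isMeagre hb (hTm m) fun u hu hne hmeagre => ?_
    obtain ⟨i, rfl⟩ := hUb u hu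
    have := ht (Nat.pair i m)
    rw [Nat.unpair_pair] at this
    refine this hne (hmeagre.mono ?_)
    rintro x hx
    refine ⟨hx.1, fun y hy => ?_⟩
    obtain ⟨l, hl⟩ := hx.2 y hy
    exact mem_iUnion.2 ⟨Nat.pair (Nat.pair i m) l, by simpa only [A, Nat.unpair_pair] using hl⟩
  have hTA : (⋂ m, T m) ⊆ ⋃ n, A n := fun x hx => mem_iInter.1 hx 0 x ⟨.nil, rfl⟩
  have hunion : ⋃ n, A n ∩ ⋂ m, T m = ⋂ m, T m := by
    rw [← iUnion_inter, inter_eq_right.2 hTA]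
  refine ⟨fun n => A n ∩ ⋂ m, T m, fun n => (hAm n).inter (MeasurableSet.iInter hTm), ?_, ?_, ?_⟩
  · rw [hunion]
    exact countable_iInter_mem.2 hTres
  · rw [hunion]
    rintro x hx y ⟨p⟩
    refine mem_iInter.2 fun m z ⟨q, _⟩ => ?_
    have hx' : x ∈ T (p.append q).length := mem_iInter.1 hx _
    exact hx' z ⟨p.append q, rfl⟩
  · exact fun n x hx y hy => hBsep _ _ x hx.1 y hy.1
end
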